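/- arXiv:1606.07308 — 2 statements merged into one kernel-verified Lean document; each statement's English description precedes it below -/
import Mathlib

section
/- Let n ≥ 1 be an integer, m > 0, k > 0. Let u: (0,∞) → ℝ be infinitely differentiable, strictly positive, satisfying u''(r) = u(r) − 2m u(r)^{1+2k} − ((n−1)/r) u'(r) for all r > 0, and suppose there exists c₁ < ∞ with |u'(r)/u(r)| ≤ c₁ r/√(1+r²) for all r > 0. Then for every integer j ≥ 2 there exists C_j < ∞ such that |u^{(j)}(r)| ≤ C_j (√(1+r²)/r)^{j−2} u(r) for all r > 0, where u^{(j)} denotes the j-th derivative of u. -/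
/-- Functions built from constants, `q`, `V` and `r ↦ r⁻¹`, filtered by a degree which is `0` for
constants and `V`, `-1` for `q` and `1` for `r⁻¹`. -/
inductive RadialSymbol (q V : ℝ → ℝ) : ℤ → (ℝ → ℝ) → Prop
  | const (x : ℝ) : RadialSymbol q V 0 (fun _ => x)
  | logDeriv : RadialSymbol q V (-1) q
  | potential : RadialSymbol q V 0 V
  | inv : RadialSymbol q V 1 (fun r => r⁻¹)
  | add {d : ℤ} {f g : ℝ → ℝ} : RadialSymbol q V d f → RadialSymbol q V d g →
      RadialSymbol q V d (fun r => f r + g r)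
  | mul {d e : ℤ} {f g : ℝ → ℝ} : RadialSymbol q V d f → RadialSymbol q V e g →
      RadialSymbol q V (d + e) (fun r => f r * g r)
  | mono {d e : ℤ} {f : ℝ → ℝ} : d ≤ e → RadialSymbol q V d f → RadialSymbol q V e f

lemma one_le_sqrt_one_add_sq_div {r : ℝ} (hr : 0 < r) : 1 ≤ √(1 + r ^ 2) / r := by
  rw [one_le_div hr]
  exact Real.le_sqrt_of_sq_le (by linarith)

namespace RadialSymbol

variable {q V : ℝ → ℝ}

lemma exists_bound {c B : ℝ}
    (hq : ∀ r, 0 < r → |q r| ≤ c * (√(1 + r ^ 2) / r)⁻¹) (hV : ∀ r, 0 < r → |V r| ≤ B)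
    {d : ℤ} {f : ℝ → ℝ} (hf : RadialSymbol q V d f) :
    ∃ C : ℝ, ∀ r, 0 < r → |f r| ≤ C * (√(1 + r ^ 2) / r) ^ d := by
  induction hf with
  | const x => exact ⟨|x|, fun r _ => by simp⟩
  | logDeriv => exact ⟨c, fun r hr => by simpa using hq r hr⟩
  | potential => exact ⟨B, fun r hr => by simpa using hV r hr⟩
  | inv =>
    refine ⟨1, fun r hr => ?_⟩
    rw [abs_of_pos (inv_pos.2 hr), zpow_one, one_mul, inv_eq_one_div]
    gcongr
    exact Real.le_sqrt_of_sq_le (by nlinarith)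
  | add _ _ ihf ihg =>
    obtain ⟨C, hC⟩ := ihf
    obtain ⟨C', hC'⟩ := ihg
    refine ⟨C + C', fun r hr => (abs_add_le _ _).trans ?_⟩
    rw [add_mul]
    exact add_le_add (hC r hr) (hC' r hr)
  | mul _ _ ihf ihg =>
    obtain ⟨C, hC⟩ := ihf
    obtain ⟨C', hC'⟩ := ihg
    refine ⟨C * C', fun r hr => ?_⟩
    have hs := one_le_sqrt_one_add_sq_div hr
    rw [abs_mul, zpow_add₀ (by positivity), mul_mul_mul_comm]
    exact mul_le_mul (hC r hr) (hC' r hr) (abs_nonneg _) ((abs_nonneg _).trans (hC r hr))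
  | mono hde _ ih =>
    obtain ⟨C, hC⟩ := ih
    refine ⟨|C|, fun r hr => (hC r hr).trans ?_⟩
    have hs := one_le_sqrt_one_add_sq_div hr
    exact mul_le_mul (le_abs_self C) (zpow_le_zpow_right₀ hs hde) (by positivity) (abs_nonneg C)

lemma exists_hasDerivAt {a b l : ℝ}
    (hq : ∀ r, 0 < r → HasDerivAt q (1 + a * V r + b * (r⁻¹ * q r) + -1 * (q r * q r)) r)
    (hV : ∀ r, 0 < r → HasDerivAt V (l * (q r * V r)) r)
    {d : ℤ} {f : ℝ → ℝ} (hf : RadialSymbol q V d f) :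
    ∃ g, RadialSymbol q V (d + 1) g ∧ ∀ r, 0 < r → HasDerivAt f (g r) r := by
  induction hf with
  | const x =>
    exact ⟨fun _ => 0, (const 0).mono (by norm_num), fun r _ => hasDerivAt_const r x⟩
  | logDeriv =>
    exact ⟨_, ((((const 1).mono (by norm_num)).add (((const a).mul potential).mono (by norm_num))).add
      (((const b).mul (inv.mul logDeriv)).mono (by norm_num))).add
      (((const (-1)).mul (logDeriv.mul logDeriv)).mono (by norm_num)), hq⟩
  | potential =>
    exact ⟨_, ((const l).mul (logDeriv.mul potential)).mono (by norm_num), hV⟩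
  | inv =>
    refine ⟨_, ((const (-1)).mul (inv.mul inv)).mono (by norm_num), fun r hr => ?_⟩
    exact (hasDerivAt_inv hr.ne').congr_deriv (by ring)
  | add _ _ ihf ihg =>
    obtain ⟨f', hf', hf⟩ := ihf
    obtain ⟨g', hg', hg⟩ := ihg
    exact ⟨_, hf'.add hg', fun r hr => (hf r hr).add (hg r hr)⟩
  | mul hf₀ hg₀ ihf ihg =>
    obtain ⟨f', hf', hf⟩ := ihf
    obtain ⟨g', hg', hg⟩ := ihg
    exact ⟨_, ((hf'.mul hg₀).mono (by omega)).add ((hf₀.mul hg').mono (by omega)),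
      fun r hr => (hf r hr).mul (hg r hr)⟩
  | mono hde _ ih =>
    obtain ⟨g, hg, h⟩ := ih
    exact ⟨g, hg.mono (by omega), h⟩

end RadialSymbol

/-- A positive function whose logarithmic derivative is bounded below by `-c` on `(0, 1]` is
bounded there. -/
lemma le_mul_exp_of_neg_mul_le_deriv {u u' : ℝ → ℝ} {c : ℝ} (hc : 0 ≤ c)
    (hu : ∀ r, 0 < r → HasDerivAt u (u' r) r) (hpos : ∀ r, 0 < r → 0 < u r)
    (h : ∀ r, 0 < r → -(c * u r) ≤ u' r) {r : ℝ} (hr : 0 < r) (hr1 : r ≤ 1) :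
    u r ≤ u 1 * Real.exp c := by
  have hd : ∀ x, 0 < x →
      HasDerivAt (fun x => u x * Real.exp (c * x))
        (u' x * Real.exp (c * x) + u x * (Real.exp (c * x) * (c * 1))) x := fun x hx =>
    (hu x hx).mul (((hasDerivAt_id x).const_mul c).exp)
  have hm : MonotoneOn (fun x => u x * Real.exp (c * x)) (Set.Ioi 0) := by
    refine monotoneOn_of_hasDerivWithinAt_nonneg (convex_Ioi 0)
      (fun x hx => (hd x hx).continuousAt.continuousWithinAt)
      (fun x hx => (hd x (interior_subset hx)).hasDerivWithinAt) (fun x hx => ?_)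
    have := h x (interior_subset hx)
    have := Real.exp_pos (c * x)
    nlinarith
  have h1 := hm hr (Set.mem_Ioi.2 one_pos) hr1
  simp only [mul_one] at h1
  refine le_trans ?_ h1
  exact le_mul_of_one_le_right (hpos r hr).le (Real.one_le_exp (by positivity))

/-- The potential of a positive solution is bounded on `[1, ∞)`, since the energy decreases. -/
lemma exists_potential_bound {u u' V : ℝ → ℝ} {m k N : ℝ} (hm : 0 < m) (hk : 0 < k) (hN : 0 ≤ N)
    (hpos : ∀ r, 0 < r → 0 < u r)
    (hV1 : ∀ r, 0 < r → u r ≤ 1 → V r ≤ 1)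
    (hu : ∀ r, 0 < r → HasDerivAt u (u' r) r)
    (hu' : ∀ r, 0 < r → HasDerivAt u' (u r - 2 * m * (u r * V r) - N / r * u' r) r)
    (hV : ∀ r, 0 < r → HasDerivAt V (2 * k * (u' r / u r * V r)) r) :
    ∃ B, ∀ r, 1 ≤ r → V r ≤ B := by
  set E : ℝ → ℝ := fun r => u' r ^ 2 / 2 - u r ^ 2 / 2 + m / (1 + k) * (u r ^ 2 * V r) with hE
  have hd : ∀ r, 0 < r → HasDerivAt E (-(N / r * u' r ^ 2)) r := by
    intro r hr
    have h := ((((hu' r hr).pow 2).div_const 2).sub (((hu r hr).pow 2).div_const 2)).add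
      ((((hu r hr).pow 2).mul (hV r hr)).const_mul (m / (1 + k)))
    refine HasDerivAt.congr_deriv h ?_
    have := (hpos r hr).ne'
    have : 1 + k ≠ 0 := by positivity
    have := hr.ne'
    simp only [Pi.pow_apply, Nat.cast_ofNat, Nat.add_one_sub_one, pow_one]
    field_simp
    ring
  have hanti : AntitoneOn E (Set.Ioi 0) := by
    refine antitoneOn_of_hasDerivWithinAt_nonpos (convex_Ioi 0)
      (fun x hx => (hd x hx).continuousAt.continuousWithinAt)
      (fun x hx => (hd x (interior_subset hx)).hasDerivWithinAt) (fun x hx => ?_)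
    have : 0 < x := interior_subset hx
    rw [neg_nonpos]
    positivity
  refine ⟨max 1 ((1 / 2 + |E 1|) * ((1 + k) / m)), fun r hr => ?_⟩
  have hr0 : 0 < r := by linarith
  rcases le_total (u r) 1 with h1 | h1
  · exact le_max_of_le_left (hV1 r hr0 h1)
  refine le_max_of_le_right ?_
  have hEr : E r ≤ E 1 := hanti (Set.mem_Ioi.2 one_pos) (Set.mem_Ioi.2 hr0) hr
  have hmk : 0 < m / (1 + k) := by positivity
  rw [← div_le_iff₀ (by positivity), div_div_eq_mul_div, mul_div_assoc]
  by_contra! hlt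
  have hu2 : 1 ≤ u r ^ 2 := one_le_pow₀ h1
  have hlow : u r ^ 2 * (m / (1 + k) * V r - 1 / 2) ≤ E r := by
    simp only [hE]
    nlinarith [sq_nonneg (u' r)]
  have : |E 1| < m / (1 + k) * V r - 1 / 2 := by linarith [mul_comm (V r) (m / (1 + k))]
  have := abs_nonneg (E 1)
  nlinarith [le_abs_self (E 1)]


/-- derivative bounds `|u^{(j)}(r)| ≤ C_j (⟨r⟩/r)^{j−2} u(r)`:
for a strictly positive smooth solution of the radial equation
`u'' = u − 2m u^{1+2k} − ((n−1)/r) u'` on `(0,∞)` with `|u'/u| ≤ c₁ r/⟨r⟩`,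
every iterated derivative `u^{(j)}`, `j ≥ 2`, satisfies
`|u^{(j)}(r)| ≤ C_j (√(1+r²)/r)^{j−2} u(r)`. -/
theorem stmt17 (n : ℕ) (hn : 1 ≤ n) (m k : ℝ) (hm : 0 < m) (hk : 0 < k)
    (u : ℝ → ℝ) (hu : ContDiffOn ℝ (⊤ : ℕ∞) u (Set.Ioi 0))
    (hupos : ∀ r : ℝ, 0 < r → 0 < u r)
    (heq : ∀ r : ℝ, 0 < r →
      deriv (deriv u) r
        = u r - 2 * m * u r ^ (1 + 2 * k) - ((n : ℝ) - 1) / r * deriv u r)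
    (hu'u : ∃ c₁ : ℝ, ∀ r : ℝ, 0 < r →
      |deriv u r / u r| ≤ c₁ * r / Real.sqrt (1 + r ^ 2)) :
    ∀ j : ℕ, 2 ≤ j → ∃ C : ℝ, ∀ r : ℝ, 0 < r →
      |iteratedDeriv j u r| ≤ C * (Real.sqrt (1 + r ^ 2) / r) ^ ((j : ℝ) - 2) * u r := by
  obtain ⟨c, hc⟩ := hu'u
  have hc0 : 0 ≤ c := by
    have h := (abs_nonneg _).trans (hc 1 one_pos)
    rw [mul_one] at h
    exact nonneg_of_mul_nonneg_left (by simpa [div_eq_mul_inv] using h)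
      (inv_pos.2 (Real.sqrt_pos.2 (by norm_num : (0 : ℝ) < 1 + 1 ^ 2)))
  have hN : (0 : ℝ) ≤ (n : ℝ) - 1 := by
    have : (1 : ℝ) ≤ n := by exact_mod_cast hn
    linarith
  set q : ℝ → ℝ := fun r => deriv u r / u r with hq
  set V : ℝ → ℝ := fun r => u r ^ (2 * k) with hVdef
  have hud : ∀ r, 0 < r → HasDerivAt u (deriv u r) r := fun r hr =>
    ((hu.differentiableOn (by simp)).differentiableAt (Ioi_mem_nhds hr)).hasDerivAt
  have hu'smooth : ContDiffOn ℝ (⊤ : ℕ∞) (deriv u) (Set.Ioi 0) :=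
    hu.deriv_of_isOpen isOpen_Ioi (by simp)
  have hu'd : ∀ r, 0 < r → HasDerivAt (deriv u)
      (u r - 2 * m * (u r * V r) - ((n : ℝ) - 1) / r * deriv u r) r := by
    intro r hr
    have h := ((hu'smooth.differentiableOn (by simp)).differentiableAt
      (Ioi_mem_nhds hr)).hasDerivAt
    rwa [heq r hr, Real.rpow_add (hupos r hr), Real.rpow_one] at h
  have hVd : ∀ r, 0 < r → HasDerivAt V (2 * k * (q r * V r)) r := by
    intro r hr
    refine ((hud r hr).rpow_const (p := 2 * k) (Or.inl (hupos r hr).ne')).congr_deriv ?_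
    have := (hupos r hr).ne'
    simp only [hq, hVdef]
    rw [Real.rpow_sub_one this]
    field_simp
  have hqd : ∀ r, 0 < r → HasDerivAt q
      (1 + (-(2 * m)) * V r + (-((n : ℝ) - 1)) * (r⁻¹ * q r) + -1 * (q r * q r)) r := by
    intro r hr
    have := (hupos r hr).ne'
    refine ((hu'd r hr).div (hud r hr) this).congr_deriv ?_
    simp only [hq]
    field_simp
    ring
  have hqb : ∀ r, 0 < r → |q r| ≤ c * (√(1 + r ^ 2) / r)⁻¹ := by
    intro r hr
    rw [inv_div, ← mul_div_assoc]
    exact hc r hr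
  have hVb : ∃ B, ∀ r, 0 < r → |V r| ≤ B := by
    obtain ⟨B, hB⟩ := exists_potential_bound hm hk hN hupos
      (fun r hr h => Real.rpow_le_one (hupos r hr).le h (by positivity)) hud hu'd hVd
    refine ⟨max B ((u 1 * Real.exp c) ^ (2 * k)), fun r hr => ?_⟩
    rw [abs_of_pos (Real.rpow_pos_of_pos (hupos r hr) _)]
    rcases le_total 1 r with h | h
    · exact le_max_of_le_left (hB r h)
    refine le_max_of_le_right (Real.rpow_le_rpow (hupos r hr).le ?_ (by positivity))
    refine le_mul_exp_of_neg_mul_le_deriv hc0 hud hupos (fun x hx => ?_) hr h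
    have hle : |q x| ≤ c := (hqb x hx).trans
      (mul_le_of_le_one_right hc0 (inv_le_one_of_one_le₀ (one_le_sqrt_one_add_sq_div hx)))
    rw [← neg_mul, ← le_div_iff₀ (hupos x hx)]
    exact (abs_le.1 hle).1
  obtain ⟨B, hB⟩ := hVb
  have key : ∀ i : ℕ, ∃ p, RadialSymbol q V i p ∧
      ∀ r, 0 < r → iteratedDeriv (i + 2) u r = u r * p r := by
    intro i
    induction i with
    | zero =>
      refine ⟨_, ((RadialSymbol.const 1).add (((RadialSymbol.const (-(2 * m))).mul
        RadialSymbol.potential).mono (by norm_num))).add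
        (((RadialSymbol.const (-((n : ℝ) - 1))).mul
        (RadialSymbol.inv.mul RadialSymbol.logDeriv)).mono (by norm_num)), fun r hr => ?_⟩
      have := (hupos r hr).ne'
      rw [iteratedDeriv_succ, iteratedDeriv_one, (hu'd r hr).deriv]
      simp only [hq]
      field_simp
      ring
    | succ i ih =>
      obtain ⟨p, hp, hpu⟩ := ih
      obtain ⟨p', hp', hd⟩ := hp.exists_hasDerivAt hqd hVd
      refine ⟨_, ((RadialSymbol.logDeriv.mul hp).mono (by push_cast; omega)).add
        (hp'.mono (by push_cast; omega)), fun r hr => ?_⟩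
      have hev : iteratedDeriv (i + 2) u =ᶠ[nhds r] fun x => u x * p x :=
        Filter.eventuallyEq_of_mem (Ioi_mem_nhds hr) hpu
      rw [show i + 1 + 2 = i + 2 + 1 by ring, iteratedDeriv_succ, hev.deriv_eq,
        ((hud r hr).fun_mul (hd r hr)).deriv]
      have := (hupos r hr).ne'
      simp only [hq]
      field_simp
  intro j hj
  obtain ⟨i, rfl⟩ := Nat.exists_eq_add_of_le' hj
  obtain ⟨p, hp, hpu⟩ := key i
  obtain ⟨C, hC⟩ := hp.exists_bound hqb hB
  refine ⟨C, fun r hr => ?_⟩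
  have h := hC r hr
  rw [zpow_natCast] at h
  rw [hpu r hr, abs_mul, abs_of_pos (hupos r hr), mul_comm, Nat.cast_add, Nat.cast_ofNat,
    add_sub_cancel_right, Real.rpow_natCast]
  exact mul_le_mul_of_nonneg_right h (hupos r hr).le
end

section
/- Let n ≥ 1 be an integer, m > 0, k > 0 with k < 2/(n−2) if n ≥ 3, and let f: ℝ → ℝ be continuous with the property that for every η > 0 there exists δ > 0 such that |f(τ) − |τ|^k| ≤ η|τ|^k whenever |τ| ≤ δ. Then there exist ω₁ ∈ (m/2, m), b₀ < ∞ and c₀ > 0 such that for every ω ∈ (ω₁, m), setting ε = √(m² − ω²), there exist continuously differentiable functions v, u: ℝ → ℝ with v even, u odd (so u(0) = 0), satisfying for all r ∈ ℝ the system u'(r) + ((n−1)/r) u(r) + (m−ω) v(r) = f(v(r)² − u(r)²) v(r) and v'(r) + (m+ω) u(r) = f(v(r)² − u(r)²) u(r) (where at r = 0 the quotient u(r)/r is interpreted as u'(0)), and such that: (i) v(r) > 0 for all r ∈ ℝ; (ii) v(r)² − u(r)² ≥ (v(r)² + u(r)²)/2 for all r ∈ ℝ; (iii) |v(r)| + ε^{−1}|u(r)|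 ≤ b₀ ε^{1/k} (1 + ε²r²)^{−(n−1)/4} e^{−ε|r|} for all r ∈ ℝ; and (iv) v(0) ≥ c₀ ε^{1/k}. -/
open Set Filter Topology

theorem antitoneOn_Icc_of_hasDerivAt {f f' : ℝ → ℝ} {a b : ℝ} (hc : ContinuousOn f (Icc a b))
    (hd : ∀ t ∈ Ioo a b, HasDerivAt f (f' t) t) (hn : ∀ t ∈ Ioo a b, f' t ≤ 0) :
    AntitoneOn f (Icc a b) := by
  refine antitoneOn_of_deriv_nonpos (convex_Icc a b) hc ?_ ?_
  · rw [interior_Icc]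
    exact fun t ht => (hd t ht).differentiableAt.differentiableWithinAt
  · rw [interior_Icc]
    intro t ht
    rw [(hd t ht).deriv]
    exact hn t ht

theorem monotoneOn_Icc_of_hasDerivAt {f f' : ℝ → ℝ} {a b : ℝ} (hc : ContinuousOn f (Icc a b))
    (hd : ∀ t ∈ Ioo a b, HasDerivAt f (f' t) t) (hn : ∀ t ∈ Ioo a b, 0 ≤ f' t) :
    MonotoneOn f (Icc a b) := by
  refine monotoneOn_of_deriv_nonneg (convex_Icc a b) hc ?_ ?_
  · rw [interior_Icc]
    exact fun t ht => (hd t ht).differentiableAt.differentiableWithinAt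
  · rw [interior_Icc]
    intro t ht
    rw [(hd t ht).deriv]
    exact hn t ht

/-- A solution of `U' + d/(t+h) U = g ≥ 0`, `U(0) = 0` is nonnegative. -/
theorem nonneg_of_radial_source {d : ℕ} {h T : ℝ} {U g : ℝ → ℝ} (hh : 0 ≤ h)
    (hc : ContinuousOn U (Icc 0 T)) (h0 : U 0 = 0)
    (hd : ∀ t ∈ Ioo 0 T, HasDerivAt U (g t - d / (t + h) * U t) t)
    (hg : ∀ t ∈ Ioo 0 T, 0 ≤ g t) : ∀ t ∈ Icc 0 T, 0 ≤ U t := by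
  have hm : MonotoneOn (fun t => (t + h) ^ d * U t) (Icc 0 T) := by
    refine monotoneOn_Icc_of_hasDerivAt (f' := fun t => (t + h) ^ d * g t) (by fun_prop) ?_ ?_
    · intro t ht
      have hpos : 0 < t + h := by linarith [ht.1]
      have h1 := (((hasDerivAt_id t).add_const h).pow d).mul (hd t ht)
      refine h1.congr_deriv ?_
      rcases d with _ | d
      · simp
      · push_cast
        simp only [id, Pi.pow_apply]
        field_simp
        ring
    · intro t ht
      have hpos : 0 < t + h := by linarith [ht.1]
      have := hg t ht
      positivity
  intro t ht
  rcases ht.1.eq_or_lt with rfl | htp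
  · simp [h0]
  have h1 := hm (left_mem_Icc.2 (ht.1.trans ht.2)) ht ht.1
  simp only [h0, mul_zero] at h1
  have hpos : 0 < (t + h) ^ d := by positivity
  exact nonneg_of_mul_nonneg_right h1 hpos

theorem abs_le_of_radial_source {d : ℕ} {h T G : ℝ} {U g : ℝ → ℝ} (hh : 0 ≤ h)
    (hc : ContinuousOn U (Icc 0 T)) (h0 : U 0 = 0)
    (hd : ∀ t ∈ Ioo 0 T, HasDerivAt U (g t - d / (t + h) * U t) t)
    (hg : ∀ t ∈ Ioo 0 T, |g t| ≤ G) : ∀ t ∈ Icc 0 T, |U t| ≤ G * t := by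
  have key : ∀ σ : ℝ, |σ| = 1 → ∀ t ∈ Icc 0 T, 0 ≤ G * t - σ * U t := by
    intro σ hσ
    refine nonneg_of_radial_source (d := d) (U := fun t => G * t - σ * U t)
      (g := fun t => (G - σ * g t) + d / (t + h) * (G * t)) hh (by fun_prop) (by simp [h0]) ?_ ?_
    · intro t ht
      have h1 := ((hasDerivAt_id t).const_mul G).sub ((hd t ht).const_mul σ)
      refine h1.congr_deriv ?_
      simp only [mul_one]
      ring
    · intro t ht
      have h1 : σ * g t ≤ G := (le_abs_self _).trans (by rw [abs_mul, hσ, one_mul]; exact hg t ht)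
      have hG : 0 ≤ G := (abs_nonneg _).trans (hg t ht)
      have ht0 := ht.1
      have : 0 ≤ d / (t + h) * (G * t) := by positivity
      linarith
  intro t ht
  have h1 := key 1 (by simp) t ht
  have h2 := key (-1) (by simp) t ht
  rw [abs_le]
  constructor <;> linarith

/-- An unstable quantity that is bounded above must be nonpositive. -/
theorem nonpos_of_unstable {z z' : ℝ → ℝ} {a c B : ℝ} (hc : 0 < c)
    (hd : ∀ t, a < t → HasDerivAt z (z' t) t)
    (hz : ∀ t, a < t → 0 < z t → c * z t ≤ z' t) (hB : ∀ t, a < t → z t ≤ B) :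
    ∀ t, a < t → z t ≤ 0 := by
  intro t₀ ht₀
  by_contra hpos
  push Not at hpos
  have hw : ∀ t, HasDerivAt (fun s => z t₀ * Real.exp (c / 2 * (s - t₀)))
      (c / 2 * (z t₀ * Real.exp (c / 2 * (t - t₀)))) t := by
    intro t
    have h1 := ((((hasDerivAt_id t).sub_const t₀).const_mul (c / 2)).exp).const_mul (z t₀)
    refine h1.congr_deriv ?_
    simp only [id, mul_one]
    ring
  have hle : ∀ b, t₀ ≤ b → z t₀ * Real.exp (c / 2 * (b - t₀)) ≤ z b := by
    intro b hb
    refine image_le_of_deriv_right_lt_deriv_boundary' (a := t₀) (b := b)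
      (f := fun s => z t₀ * Real.exp (c / 2 * (s - t₀))) (B := z) (B' := z')
      (fun x _ => (hw x).continuousAt.continuousWithinAt) (fun x _ => (hw x).hasDerivWithinAt)
      (by simp) (fun x hx => (hd x (ht₀.trans_le hx.1)).continuousAt.continuousWithinAt)
      (fun x hx => (hd x (ht₀.trans_le hx.1)).hasDerivWithinAt) ?_ (right_mem_Icc.2 hb)
    intro x hx heq
    have hzx : 0 < z x := by rw [← heq]; positivity
    have := hz x (ht₀.trans_le hx.1) hzx
    change c / 2 * (z t₀ * Real.exp (c / 2 * (x - t₀))) < z' x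
    rw [heq]
    nlinarith
  have hlim : Tendsto (fun b => z t₀ * Real.exp (c / 2 * (b - t₀))) atTop atTop := by
    refine Tendsto.const_mul_atTop hpos (Real.tendsto_exp_atTop.comp ?_)
    exact Tendsto.const_mul_atTop (by positivity) (tendsto_atTop_add_const_right _ _ tendsto_id)
  obtain ⟨b, hb1, hb2⟩ := ((hlim.eventually_gt_atTop B).and (eventually_ge_atTop t₀)).exists
  linarith [hle b hb2, hB b (ht₀.trans_le hb2)]

/-- Radial profile equations on `[0, T]`, normalized so that both mass parameters are explicit
(`e` is the relativistic correction, `h ≥ 0` regularizes the singularity at the origin):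
`V' = -(1 - e F(V² - e U²)) U` and `U' + d/(t+h) U = (F(V² - e U²) - μ) V`, `U(0) = 0`. -/
structure IsRadialSol (d : ℕ) (h e μ : ℝ) (F : ℝ → ℝ) (T : ℝ) (V U : ℝ → ℝ) : Prop where
  contV : ContinuousOn V (Icc 0 T)
  contU : ContinuousOn U (Icc 0 T)
  init : U 0 = 0
  derivV : ∀ t ∈ Ioo 0 T, HasDerivAt V (-((1 - e * F (V t ^ 2 - e * U t ^ 2)) * U t)) t
  derivU : ∀ t ∈ Ioo 0 T,
    HasDerivAt U ((F (V t ^ 2 - e * U t ^ 2) - μ) * V t - d / (t + h) * U t) t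

namespace IsRadialSol

variable {d : ℕ} {h e μ C T : ℝ} {F V U : ℝ → ℝ}

theorem mono {T' : ℝ} (hS : IsRadialSol d h e μ F T V U) (hT : T' ≤ T) :
    IsRadialSol d h e μ F T' V U where
  contV := hS.contV.mono (Icc_subset_Icc_right hT)
  contU := hS.contU.mono (Icc_subset_Icc_right hT)
  init := hS.init
  derivV t ht := hS.derivV t ⟨ht.1, ht.2.trans_le hT⟩
  derivU t ht := hS.derivU t ⟨ht.1, ht.2.trans_le hT⟩

theorem hasDerivAt_sq_add_sq (hS : IsRadialSol d h e μ F T V U) {t : ℝ} (ht : t ∈ Ioo 0 T) :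
    HasDerivAt (fun t => V t ^ 2 + U t ^ 2)
      (2 * (V t * U t) * (F (V t ^ 2 - e * U t ^ 2) - μ - (1 - e * F (V t ^ 2 - e * U t ^ 2)))
        - 2 * (d / (t + h) * U t ^ 2)) t := by
  refine (((hS.derivV t ht).pow 2).add ((hS.derivU t ht).pow 2)).congr_deriv ?_
  simp only [Nat.cast_ofNat, Nat.add_one_sub_one, pow_one]
  ring

theorem abs_coupling_le (hF0 : ∀ s, 0 ≤ F s) (hFC : ∀ s, F s ≤ C) (he : 0 ≤ e) (heC : e * C ≤ 1)
    (hμ0 : 0 ≤ μ) (hμ1 : μ ≤ 1) (s v u : ℝ) :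
    |2 * (v * u) * (F s - μ - (1 - e * F s))| ≤ (C + 2) * (v ^ 2 + u ^ 2) := by
  have h1 : 0 ≤ e * F s := mul_nonneg he (hF0 s)
  have h2 : e * F s ≤ 1 := (mul_le_mul_of_nonneg_left (hFC s) he).trans heC
  have h3 : |F s - μ - (1 - e * F s)| ≤ C + 2 := by
    rw [abs_le]
    constructor <;> linarith [hF0 s, hFC s]
  have h4 : |2 * (v * u)| ≤ v ^ 2 + u ^ 2 := by
    rw [abs_le]
    constructor <;> nlinarith [sq_nonneg (v + u), sq_nonneg (v - u)]
  rw [abs_mul, mul_comm]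
  exact mul_le_mul h3 h4 (abs_nonneg _) ((abs_nonneg _).trans h3)

theorem sq_add_sq_le (hS : IsRadialSol d h e μ F T V U) (hh : 0 ≤ h)
    (hF0 : ∀ s, 0 ≤ F s) (hFC : ∀ s, F s ≤ C) (he : 0 ≤ e) (heC : e * C ≤ 1)
    (hμ0 : 0 ≤ μ) (hμ1 : μ ≤ 1) {t : ℝ} (ht : t ∈ Icc 0 T) :
    V t ^ 2 + U t ^ 2 ≤ V 0 ^ 2 * Real.exp ((C + 2) * t) := by
  have hcV := hS.contV
  have hcU := hS.contU
  have hm : AntitoneOn (fun t => Real.exp (-((C + 2) * t)) * (V t ^ 2 + U t ^ 2)) (Icc 0 T) := by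
    refine antitoneOn_Icc_of_hasDerivAt (by fun_prop) (fun t ht =>
      ((((hasDerivAt_id t).const_mul (C + 2)).neg).exp).mul (hS.hasDerivAt_sq_add_sq ht)) ?_
    intro t ht
    have h1 := abs_coupling_le hF0 hFC he heC hμ0 hμ1 (V t ^ 2 - e * U t ^ 2) (V t) (U t)
    have h2 := (abs_le.1 h1).2
    have hpos : 0 < t + h := by linarith [ht.1]
    have h3 : 0 ≤ d / (t + h) * U t ^ 2 := by positivity
    have h4 := Real.exp_pos (-((C + 2) * t))
    simp only [id, mul_one]
    rw [mul_assoc, ← mul_add]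
    refine mul_nonpos_of_nonneg_of_nonpos h4.le ?_
    linarith
  have h1 := hm (left_mem_Icc.2 (ht.1.trans ht.2)) ht ht.1
  simp only [mul_zero, neg_zero, Real.exp_zero, one_mul, hS.init] at h1
  rw [Real.exp_neg, inv_mul_le_iff₀ (Real.exp_pos _)] at h1
  linarith

/-- Backward uniqueness for the zero solution. -/
theorem init_eq_zero_of_zero (hS : IsRadialSol d h e μ F T V U) (hh : 0 ≤ h)
    (hF0 : ∀ s, 0 ≤ F s) (hFC : ∀ s, F s ≤ C) (he : 0 ≤ e) (heC : e * C ≤ 1)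
    (hμ0 : 0 ≤ μ) (hμ1 : μ ≤ 1) {t₁ : ℝ} (ht₁ : 0 < t₁) (ht₁T : t₁ ≤ T) (hV : V t₁ = 0)
    (hU : U t₁ = 0) : V 0 = 0 := by
  have hzero : ∀ δ ∈ Ioc 0 t₁, V δ = 0 := by
    intro δ hδ
    have hcV := hS.contV.mono (Icc_subset_Icc hδ.1.le ht₁T)
    have hcU := hS.contU.mono (Icc_subset_Icc hδ.1.le ht₁T)
    set c := C + 2 + 2 * (d / δ) with hc
    have hm : MonotoneOn (fun t => Real.exp (c * t) * (V t ^ 2 + U t ^ 2)) (Icc δ t₁) := by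
      refine monotoneOn_Icc_of_hasDerivAt (by fun_prop) (fun t ht =>
        ((((hasDerivAt_id t).const_mul c)).exp).mul
          (hS.hasDerivAt_sq_add_sq ⟨hδ.1.trans ht.1, ht.2.trans_le ht₁T⟩)) ?_
      intro t ht
      have h1 := abs_coupling_le hF0 hFC he heC hμ0 hμ1 (V t ^ 2 - e * U t ^ 2) (V t) (U t)
      have h2 := (abs_le.1 h1).1
      have hδ0 := hδ.1
      have hpos : 0 < t + h := by linarith [ht.1]
      have h3 : d / (t + h) * U t ^ 2 ≤ d / δ * (V t ^ 2 + U t ^ 2) := by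
        have : (d : ℝ) / (t + h) ≤ d / δ := by
          have := ht.1
          gcongr
          linarith
        have h5 : U t ^ 2 ≤ V t ^ 2 + U t ^ 2 := by nlinarith [sq_nonneg (V t)]
        gcongr
      simp only [id, mul_one]
      rw [mul_assoc, ← mul_add]
      refine mul_nonneg (Real.exp_pos _).le ?_
      rw [hc]
      linarith
    have h1 := hm (left_mem_Icc.2 hδ.2) (right_mem_Icc.2 hδ.2) hδ.2
    simp only [hV, hU] at h1
    have h2 := Real.exp_pos (c * δ)
    have h3 : V δ ^ 2 + U δ ^ 2 ≤ 0 := by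
      by_contra hcon
      push Not at hcon
      have := mul_pos h2 hcon
      norm_num at h1
      linarith
    have : V δ ^ 2 = 0 := by nlinarith [sq_nonneg (V δ), sq_nonneg (U δ)]
    exact pow_eq_zero_iff (two_ne_zero) |>.1 this
  have hc : Tendsto V (𝓝[Ioc 0 t₁] 0) (𝓝 (V 0)) :=
    (hS.contV 0 (left_mem_Icc.2 (ht₁.le.trans ht₁T))).mono_left
      (nhdsWithin_mono _ fun x hx => ⟨hx.1.le, hx.2.trans ht₁T⟩)
  have hne : (𝓝[Ioc 0 t₁] (0 : ℝ)).NeBot := by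
    rw [nhdsWithin_Ioc_eq_nhdsGT ht₁]
    infer_instance
  refine tendsto_nhds_unique hc (tendsto_const_nhds.congr' ?_)
  filter_upwards [self_mem_nhdsWithin] with x hx
  exact (hzero x hx).symm

end IsRadialSol

/-- The primitive of the nonlinearity vanishing at the origin. -/
noncomputable def primitive (F : ℝ → ℝ) (s : ℝ) : ℝ := ∫ x in (0 : ℝ)..s, F x

theorem hasDerivAt_primitive {F : ℝ → ℝ} (hF : Continuous F) (s : ℝ) :
    HasDerivAt (primitive F) (F s) s :=
  intervalIntegral.integral_hasDerivAt_right (hF.intervalIntegrable _ _)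
    (hF.stronglyMeasurableAtFilter _ _) hF.continuousAt

theorem continuous_primitive {F : ℝ → ℝ} (hF : Continuous F) : Continuous (primitive F) :=
  continuous_iff_continuousAt.2 fun s => (hasDerivAt_primitive hF s).continuousAt

theorem primitive_eq_zero {F : ℝ → ℝ} (hF : ∀ s ≤ 0, F s = 0) {s : ℝ} (hs : s ≤ 0) :
    primitive F s = 0 := by
  unfold primitive
  rw [intervalIntegral.integral_congr (g := fun _ => (0 : ℝ))]
  · simp
  · intro x hx
    rw [uIcc_of_ge hs] at hx
    exact hF x hx.2

theorem primitive_nonneg {F : ℝ → ℝ} (hF0 : ∀ s, 0 ≤ F s) (hF : ∀ s ≤ 0, F s = 0) (s : ℝ) :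
    0 ≤ primitive F s := by
  rcases le_total s 0 with hs | hs
  · rw [primitive_eq_zero hF hs]
  · exact intervalIntegral.integral_nonneg hs fun x _ => hF0 x

theorem abs_primitive_sub_le {F G : ℝ → ℝ} (hF : Continuous F) (hG : Continuous G) {η : ℝ}
    (h : ∀ s, |F s - G s| ≤ η) (s : ℝ) : |primitive F s - primitive G s| ≤ η * |s| := by
  unfold primitive
  rw [← intervalIntegral.integral_sub (hF.intervalIntegrable _ _) (hG.intervalIntegrable _ _)]
  have := intervalIntegral.norm_integral_le_of_norm_le_const (a := 0) (b := s) (C := η)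
    (f := fun x => F x - G x) (fun x _ => h x)
  simpa using this

/-- Twice the Hamiltonian of the radial system. -/
noncomputable def hamiltonian (e μ : ℝ) (F : ℝ → ℝ) (v u : ℝ) : ℝ :=
  primitive F (v ^ 2 - e * u ^ 2) - μ * v ^ 2 + u ^ 2

theorem hamiltonian_nonneg_of_zero {e μ : ℝ} {F : ℝ → ℝ} (he : 0 ≤ e) (hF : ∀ s ≤ 0, F s = 0)
    (u : ℝ) : 0 ≤ hamiltonian e μ F 0 u := by
  unfold hamiltonian
  rw [primitive_eq_zero hF (by nlinarith [sq_nonneg u])]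
  nlinarith [sq_nonneg u]

theorem IsRadialSol.antitoneOn_hamiltonian {d : ℕ} {h e μ T : ℝ} {F V U : ℝ → ℝ}
    (hS : IsRadialSol d h e μ F T V U) (hh : 0 ≤ h) (hF : Continuous F)
    (heF : ∀ s, e * F s ≤ 1) :
    AntitoneOn (fun t => hamiltonian e μ F (V t) (U t)) (Icc 0 T) := by
  have hcV := hS.contV
  have hcU := hS.contU
  have hΦ := continuous_primitive hF
  unfold hamiltonian
  refine antitoneOn_Icc_of_hasDerivAt
    (f' := fun t => -(2 * (d / (t + h)) * (1 - e * F (V t ^ 2 - e * U t ^ 2)) * U t ^ 2))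
    (by fun_prop) ?_ ?_
  · intro t ht
    have h1 := hS.derivV t ht
    have h2 := hS.derivU t ht
    have h3 := (hasDerivAt_primitive hF (V t ^ 2 - e * U t ^ 2)).comp t
      ((h1.pow 2).sub ((h2.pow 2).const_mul e))
    refine ((h3.sub ((h1.pow 2).const_mul μ)).add (h2.pow 2)).congr_deriv ?_
    simp only [Nat.cast_ofNat, Nat.add_one_sub_one, pow_one]
    ring
  · intro t ht
    have hpos : 0 < t + h := by linarith [ht.1]
    have := heF (V t ^ 2 - e * U t ^ 2)
    have h1 : 0 ≤ 1 - e * F (V t ^ 2 - e * U t ^ 2) := by linarith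
    have : 0 ≤ 2 * (d / (t + h)) * (1 - e * F (V t ^ 2 - e * U t ^ 2)) * U t ^ 2 := by positivity
    linarith

theorem abs_sub_le_of_hasDerivAt {f f' : ℝ → ℝ} {a b K : ℝ} (hc : ContinuousOn f (Icc a b))
    (hd : ∀ t ∈ Ioo a b, HasDerivAt f (f' t) t) (hK : ∀ t ∈ Ioo a b, |f' t| ≤ K) :
    ∀ s ∈ Icc a b, ∀ t ∈ Icc a b, |f s - f t| ≤ K * |s - t| := by
  have h1 : AntitoneOn (fun t => f t - K * t) (Icc a b) :=
    antitoneOn_Icc_of_hasDerivAt (by fun_prop)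
      (fun t ht => (hd t ht).sub ((hasDerivAt_id t).const_mul K))
      (fun t ht => by linarith [(abs_le.1 (hK t ht)).2])
  have h2 : MonotoneOn (fun t => f t + K * t) (Icc a b) :=
    monotoneOn_Icc_of_hasDerivAt (by fun_prop)
      (fun t ht => (hd t ht).add ((hasDerivAt_id t).const_mul K))
      (fun t ht => by linarith [(abs_le.1 (hK t ht)).1])
  have key : ∀ s ∈ Icc a b, ∀ t ∈ Icc a b, s ≤ t → |f s - f t| ≤ K * |s - t| := by
    intro s hs t ht hst
    have h3 := h1 hs ht hst
    have h4 := h2 hs ht hst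
    simp only at h3 h4
    rw [abs_of_nonpos (sub_nonpos.2 hst), abs_le]
    constructor <;> linarith
  intro s hs t ht
  rcases le_total s t with hst | hst
  · exact key s hs t ht hst
  · rw [abs_sub_comm, abs_sub_comm s t]
    exact key t ht s hs hst

/-- Arzelà–Ascoli for locally uniformly Lipschitz sequences of curves. -/
theorem exists_subseq_tendsto_of_lipschitz {E : Type*} [NormedAddCommGroup E] [ProperSpace E]
    {x : ℕ → ℝ → E} {B : ℝ} (hB : ∀ j, ‖x j 0‖ ≤ B)
    (hL : ∀ T : ℝ, ∃ K : ℝ, ∀ j, ∀ s ∈ Icc (-T) T, ∀ t ∈ Icc (-T) T,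
      ‖x j s - x j t‖ ≤ K * |s - t|) :
    ∃ φ : ℕ → ℕ, StrictMono φ ∧ ∃ y : ℝ → E, Continuous y ∧
      ∀ t, Tendsto (fun j => x (φ j) t) atTop (𝓝 (y t)) := by
  choose K hK using hL
  have hbd : ∀ q : ℚ, ∀ j, ‖x j q‖ ≤ B + K |(q : ℝ)| * |(q : ℝ)| := by
    intro q j
    have h1 := hK |(q : ℝ)| j q ⟨neg_abs_le _, le_abs_self _⟩ 0
      ⟨by simp, abs_nonneg _⟩
    rw [sub_zero] at h1
    have h2 : x j q = x j 0 + (x j q - x j 0) := by abel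
    rw [h2]
    exact (norm_add_le _ _).trans (add_le_add (hB j) h1)
  have hcomp : IsCompact (Set.pi univ fun q : ℚ =>
      Metric.closedBall (0 : E) (B + K |(q : ℝ)| * |(q : ℝ)|)) :=
    isCompact_univ_pi fun q => isCompact_closedBall _ _
  obtain ⟨z, -, φ, hφ, hz⟩ := hcomp.tendsto_subseq (x := fun j (q : ℚ) => x j q)
    (fun j q _ => by simpa using hbd q j)
  have hz' : ∀ q : ℚ, Tendsto (fun j => x (φ j) q) atTop (𝓝 (z q)) := fun q =>
    (tendsto_pi_nhds.1 hz q)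
  have hcau : ∀ t : ℝ, CauchySeq fun j => x (φ j) t := by
    intro t
    rw [Metric.cauchySeq_iff']
    intro r hr
    set T := |t| + 1 with hT
    set L := max (K T) 1 with hLdef
    have hL1 : 1 ≤ L := le_max_right _ _
    have hLpos : 0 < L := by linarith
    have hδ : 0 < min 1 (r / (3 * L)) := by positivity
    obtain ⟨q, hq1, hq2⟩ := exists_rat_btwn (show t < t + min 1 (r / (3 * L)) by linarith)
    have hqT : (q : ℝ) ∈ Icc (-T) T := by
      have := min_le_left 1 (r / (3 * L))
      constructor <;> linarith [le_abs_self t, neg_abs_le t]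
    have htT : t ∈ Icc (-T) T := by
      constructor <;> linarith [le_abs_self t, neg_abs_le t]
    have hclose : ∀ j, ‖x j t - x j q‖ ≤ r / 3 := by
      intro j
      refine (hK T j t htT q hqT).trans ?_
      have h1 : |t - q| ≤ r / (3 * L) := by
        rw [abs_le]
        have := min_le_right 1 (r / (3 * L))
        constructor <;> linarith
      calc K T * |t - q| ≤ L * (r / (3 * L)) :=
            mul_le_mul (le_max_left _ _) h1 (abs_nonneg _) hLpos.le
        _ = r / 3 := by field_simp
    obtain ⟨N, hN⟩ := Metric.cauchySeq_iff'.1 (hz' q).cauchySeq (r / 3) (by positivity)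
    refine ⟨N, fun j hj => ?_⟩
    have h1 := hN j hj
    rw [dist_eq_norm] at h1 ⊢
    have h2 : x (φ j) t - x (φ N) t = (x (φ j) t - x (φ j) q) + (x (φ j) q - x (φ N) q)
      - (x (φ N) t - x (φ N) q) := by abel
    rw [h2]
    have h3 := norm_sub_le ((x (φ j) t - x (φ j) q) + (x (φ j) q - x (φ N) q))
      (x (φ N) t - x (φ N) q)
    have h4 := norm_add_le (x (φ j) t - x (φ j) q) (x (φ j) q - x (φ N) q)
    linarith [hclose (φ j), hclose (φ N)]
  choose y hy using fun t => cauchySeq_tendsto_of_complete (hcau t)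
  refine ⟨φ, hφ, y, ?_, hy⟩
  rw [continuous_iff_continuousAt]
  intro t
  have hlim : ∀ s ∈ Icc (-(|t| + 1)) (|t| + 1), ‖y s - y t‖ ≤ K (|t| + 1) * |s - t| := by
    intro s hs
    refine le_of_tendsto ((hy s).sub (hy t)).norm (Eventually.of_forall fun j => ?_)
    exact hK _ (φ j) s hs t (by constructor <;> linarith [le_abs_self t, neg_abs_le t])
  rw [ContinuousAt, tendsto_iff_norm_sub_tendsto_zero]
  have h0 : Tendsto (fun s => K (|t| + 1) * |s - t|) (𝓝 t) (𝓝 0) := by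
    have : Continuous fun s => K (|t| + 1) * |s - t| := by fun_prop
    simpa using this.tendsto t
  refine squeeze_zero' (Eventually.of_forall fun s => norm_nonneg _) ?_ h0
  filter_upwards [Icc_mem_nhds (show -(|t| + 1) < t by linarith [neg_abs_le t])
    (show t < |t| + 1 by linarith [le_abs_self t])] with s hs
  exact hlim s hs

namespace IsRadialSol

variable {d : ℕ} {h e μ C T : ℝ} {F V U : ℝ → ℝ}

/-- Local Lipschitz bounds, uniform in all parameters. -/
theorem lipschitz_bound (hS : IsRadialSol d h e μ F T V U) (hh : 0 ≤ h)
    (hF0 : ∀ s, 0 ≤ F s) (hFC : ∀ s, F s ≤ C) (he : 0 ≤ e) (heC : e * C ≤ 1)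
    (hμ0 : 0 ≤ μ) (hμ1 : μ ≤ 1) {B : ℝ} (hB0 : 0 ≤ B)
    (hB : ∀ t ∈ Icc 0 T, V t ^ 2 + U t ^ 2 ≤ B ^ 2) :
    ∀ s ∈ Icc 0 T, ∀ t ∈ Icc 0 T,
      |V s - V t| ≤ (d + 1) * ((C + 1) * B) * |s - t| ∧
      |U s - U t| ≤ (d + 1) * ((C + 1) * B) * |s - t| := by
  have hC : 0 ≤ C := (hF0 0).trans (hFC 0)
  have hVB : ∀ t ∈ Icc 0 T, |V t| ≤ B := fun t ht =>
    abs_le_of_sq_le_sq (by nlinarith [hB t ht, sq_nonneg (U t)]) hB0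
  have hUB : ∀ t ∈ Icc 0 T, |U t| ≤ B := fun t ht =>
    abs_le_of_sq_le_sq (by nlinarith [hB t ht, sq_nonneg (V t)]) hB0
  have hg : ∀ t ∈ Ioo 0 T, |(F (V t ^ 2 - e * U t ^ 2) - μ) * V t| ≤ (C + 1) * B := by
    intro t ht
    rw [abs_mul]
    refine mul_le_mul ?_ (hVB t (Ioo_subset_Icc_self ht)) (abs_nonneg _) (by linarith)
    have := hF0 (V t ^ 2 - e * U t ^ 2)
    have := hFC (V t ^ 2 - e * U t ^ 2)
    rw [abs_le]
    constructor <;> linarith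
  have hU := abs_le_of_radial_source hh hS.contU hS.init hS.derivU hg
  have hKV : ∀ t ∈ Ioo 0 T,
      |-((1 - e * F (V t ^ 2 - e * U t ^ 2)) * U t)| ≤ (d + 1) * ((C + 1) * B) := by
    intro t ht
    have h1 : 0 ≤ e * F (V t ^ 2 - e * U t ^ 2) := mul_nonneg he (hF0 _)
    have h2 : e * F (V t ^ 2 - e * U t ^ 2) ≤ 1 :=
      (mul_le_mul_of_nonneg_left (hFC _) he).trans heC
    rw [abs_neg, abs_mul, abs_of_nonneg (by linarith)]
    have h3 := hUB t (Ioo_subset_Icc_self ht)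
    have hd0 : (0 : ℝ) ≤ d := Nat.cast_nonneg d
    have h4 : 0 ≤ C * B := by positivity
    have h5 : 0 ≤ d * ((C + 1) * B) := by positivity
    have h6 := abs_nonneg (U t)
    nlinarith
  have hKU : ∀ t ∈ Ioo 0 T, |(F (V t ^ 2 - e * U t ^ 2) - μ) * V t - d / (t + h) * U t|
      ≤ (d + 1) * ((C + 1) * B) := by
    intro t ht
    have h1 := hU t (Ioo_subset_Icc_self ht)
    have h0 := ht.1
    have hd0 : (0 : ℝ) ≤ d := Nat.cast_nonneg d
    have h2 : |d / (t + h) * U t| ≤ d * ((C + 1) * B) := by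
      rw [abs_mul, abs_of_nonneg (by positivity)]
      calc d / (t + h) * |U t| ≤ d / t * ((C + 1) * B * t) := by
            gcongr
            linarith
        _ = d * ((C + 1) * B) := by field_simp
    refine (abs_sub _ _).trans ?_
    linarith [hg t ht]
  intro s hs t ht
  exact ⟨abs_sub_le_of_hasDerivAt hS.contV hS.derivV hKV s hs t ht,
    abs_sub_le_of_hasDerivAt hS.contU hS.derivU hKU s hs t ht⟩

end IsRadialSol

/-- Interval integrals converge under pointwise convergence of bounded continuous integrands. -/
theorem tendsto_integral_of_bounded {f : ℕ → ℝ → ℝ} {g : ℝ → ℝ} {t K : ℝ} (ht : 0 ≤ t)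
    (hc : ∀ᶠ j in atTop, ContinuousOn (f j) (Icc 0 t))
    (hb : ∀ᶠ j in atTop, ∀ s ∈ Icc 0 t, |f j s| ≤ K)
    (hlim : ∀ s ∈ Icc 0 t, Tendsto (fun j => f j s) atTop (𝓝 (g s))) :
    Tendsto (fun j => ∫ s in (0 : ℝ)..t, f j s) atTop (𝓝 (∫ s in (0 : ℝ)..t, g s)) := by
  refine intervalIntegral.tendsto_integral_filter_of_dominated_convergence (fun _ => K) ?_ ?_
    (by simp) ?_
  · filter_upwards [hc] with j hj
    rw [uIoc_of_le ht]
    exact (hj.mono Ioc_subset_Icc_self).aestronglyMeasurable measurableSet_Ioc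
  · filter_upwards [hb] with j hj
    refine Eventually.of_forall fun s hs => ?_
    rw [uIoc_of_le ht] at hs
    exact hj s (Ioc_subset_Icc_self hs)
  · refine Eventually.of_forall fun s hs => ?_
    rw [uIoc_of_le ht] at hs
    exact hlim s (Ioc_subset_Icc_self hs)

theorem hasDerivAt_of_integral_eq {f g : ℝ → ℝ} {T : ℝ} (hg : Continuous g)
    (h : ∀ t ∈ Icc 0 T, f t = ∫ s in (0 : ℝ)..t, g s) : ∀ t ∈ Ioo 0 T, HasDerivAt f (g t) t := by
  intro t ht
  refine (hasDerivAt_primitive hg t).congr_of_eventuallyEq ?_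
  filter_upwards [Icc_mem_nhds ht.1 ht.2] with s hs
  exact h s hs

namespace IsRadialSol

variable {d : ℕ} {h e μ T : ℝ} {F V U : ℝ → ℝ}

theorem integral_V (hS : IsRadialSol d h e μ F T V U) (hF : Continuous F) {t : ℝ}
    (ht : t ∈ Icc 0 T) :
    V t - V 0 = ∫ s in (0 : ℝ)..t, -((1 - e * F (V s ^ 2 - e * U s ^ 2)) * U s) := by
  have hcV := (hS.mono ht.2).contV
  have hcU := (hS.mono ht.2).contU
  refine (intervalIntegral.integral_eq_sub_of_hasDerivAt_of_le ht.1 hcV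
    (hS.mono ht.2).derivV ?_).symm
  refine ContinuousOn.intervalIntegrable ?_
  rw [uIcc_of_le ht.1]
  fun_prop

theorem integral_U (hS : IsRadialSol d h e μ F T V U) (hF : Continuous F) (hh : 0 ≤ h) {t : ℝ}
    (ht : t ∈ Icc 0 T) :
    (t + h) ^ d * U t =
      ∫ s in (0 : ℝ)..t, (s + h) ^ d * ((F (V s ^ 2 - e * U s ^ 2) - μ) * V s) := by
  have hcV := (hS.mono ht.2).contV
  have hcU := (hS.mono ht.2).contU
  rw [intervalIntegral.integral_eq_sub_of_hasDerivAt_of_le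
    (f := fun t => (t + h) ^ d * U t) ht.1 (by fun_prop) ?_ ?_]
  · simp [hS.init]
  · intro s hs
    have hpos : 0 < s + h := by linarith [hs.1]
    refine ((((hasDerivAt_id s).add_const h).pow d).mul
      ((hS.mono ht.2).derivU s hs)).congr_deriv ?_
    rcases d with _ | d
    · simp
    · push_cast
      simp only [id, Pi.pow_apply]
      field_simp
      ring
  · refine ContinuousOn.intervalIntegrable ?_
    rw [uIcc_of_le ht.1]
    fun_prop

end IsRadialSol

theorem exists_limit_sol {d : ℕ} {h e μ T : ℕ → ℝ} {F V U : ℕ → ℝ → ℝ} {A C e' μ' : ℝ}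
    {F' : ℝ → ℝ} (hS : ∀ j, IsRadialSol d (h j) (e j) (μ j) (F j) (T j) (V j) (U j))
    (hh : ∀ j, 0 ≤ h j) (hhlim : Tendsto h atTop (𝓝 0)) (hFc : ∀ j, Continuous (F j))
    (hF0 : ∀ j s, 0 ≤ F j s) (hFC : ∀ j s, F j s ≤ C) (he : ∀ j, 0 ≤ e j)
    (heC : ∀ j, e j * C ≤ 1) (helim : Tendsto e atTop (𝓝 e')) (hμ0 : ∀ j, 0 ≤ μ j)
    (hμ1 : ∀ j, μ j ≤ 1) (hμlim : Tendsto μ atTop (𝓝 μ')) (hT0 : ∀ j, 0 ≤ T j)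
    (hT : Tendsto T atTop atTop) (hA : ∀ j, |V j 0| ≤ A) (hF' : Continuous F')
    (hFlim : TendstoUniformly F F' atTop) :
    ∃ φ : ℕ → ℕ, StrictMono φ ∧ ∃ V' U' : ℝ → ℝ, (∀ T, IsRadialSol d 0 e' μ' F' T V' U') ∧
      ∀ t, 0 ≤ t → Tendsto (fun j => V (φ j) t) atTop (𝓝 (V' t)) ∧
        Tendsto (fun j => U (φ j) t) atTop (𝓝 (U' t)) := by
  have hC : 0 ≤ C := (hF0 0 0).trans (hFC 0 0)
  have hA0 : 0 ≤ A := (abs_nonneg _).trans (hA 0)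
  -- uniform bounds
  have hbd : ∀ j, ∀ t ∈ Icc 0 (T j), ∀ t' ≥ t,
      V j t ^ 2 + U j t ^ 2 ≤ (A * Real.exp ((C + 2) * t')) ^ 2 := by
    intro j t ht t' ht'
    refine ((hS j).sq_add_sq_le (hh j) (hF0 j) (hFC j) (he j) (heC j) (hμ0 j) (hμ1 j) ht).trans ?_
    rw [mul_pow]
    have h1 : V j 0 ^ 2 ≤ A ^ 2 := sq_le_sq' (abs_le.1 (hA j)).1 (abs_le.1 (hA j)).2
    have h2 : Real.exp ((C + 2) * t) ≤ Real.exp ((C + 2) * t') ^ 2 := by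
      rw [← Real.exp_nat_mul]
      refine Real.exp_le_exp.2 ?_
      have : 0 ≤ (C + 2) * (t' - t) := mul_nonneg (by linarith) (by linarith)
      have : 0 ≤ (C + 2) * t' := mul_nonneg (by linarith) (by linarith [ht.1])
      push_cast
      linarith
    exact mul_le_mul h1 h2 (Real.exp_pos _).le (sq_nonneg _)
  have hbd1 : ∀ j, ∀ t ∈ Icc 0 (T j), ∀ t' ≥ t,
      |V j t| ≤ A * Real.exp ((C + 2) * t') ∧ |U j t| ≤ A * Real.exp ((C + 2) * t') := by
    intro j t ht t' ht'
    have h1 := hbd j t ht t' ht'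
    exact ⟨abs_le_of_sq_le_sq (by nlinarith [sq_nonneg (U j t)]) (by positivity),
      abs_le_of_sq_le_sq (by nlinarith [sq_nonneg (V j t)]) (by positivity)⟩
  -- the curves, frozen outside their interval of definition
  let c : ℕ → ℝ → ℝ := fun j t => max 0 (min t (T j))
  have hcmem : ∀ j t, c j t ∈ Icc 0 (T j) := fun j t =>
    ⟨le_max_left _ _, max_le (hT0 j) (min_le_right _ _)⟩
  have hceq : ∀ j, ∀ t ∈ Icc 0 (T j), c j t = t := by
    intro j t ht
    simp only [c]
    rw [min_eq_left ht.2, max_eq_right ht.1]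
  have hclip : ∀ j s t, |c j s - c j t| ≤ |s - t| := by
    intro j s t
    simp only [c]
    refine (abs_max_sub_max_le_max _ _ _ _).trans ?_
    simp only [sub_self, abs_zero]
    refine max_le (abs_nonneg _) ((abs_min_sub_min_le_max _ _ _ _).trans ?_)
    simp
  obtain ⟨φ, hφ, y, hyc, hy⟩ := exists_subseq_tendsto_of_lipschitz (B := A)
    (x := fun j t => (V j (c j t), U j (c j t))) (by
      intro j
      have h0 : c j 0 = 0 := hceq j 0 (left_mem_Icc.2 (hT0 j))
      simp only [h0, (hS j).init]
      rw [Prod.norm_def]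
      exact max_le (hA j) (by simpa using hA0)) (by
      intro R
      refine ⟨(d + 1) * ((C + 1) * (A * Real.exp ((C + 2) * R))), ?_⟩
      intro j s hs t ht
      have hR0 : 0 ≤ R := by linarith [hs.1, hs.2]
      have hcm : ∀ s ∈ Icc (-R) R, c j s ∈ Icc 0 (min (T j) R) := fun s hs =>
        ⟨le_max_left _ _, le_min (hcmem j s).2
          (max_le hR0 ((min_le_left _ _).trans hs.2))⟩
      have h1 := ((hS j).mono (min_le_left (T j) R)).lipschitz_bound (hh j) (hF0 j) (hFC j) (he j)
        (heC j) (hμ0 j) (hμ1 j) (B := A * Real.exp ((C + 2) * R)) (by positivity)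
        (fun t ht => hbd j t ⟨ht.1, ht.2.trans (min_le_left _ _)⟩ R
          (ht.2.trans (min_le_right _ _))) (c j s) (hcm s hs) (c j t) (hcm t ht)
      have h2 := hclip j s t
      have hK : 0 ≤ (d + 1) * ((C + 1) * (A * Real.exp ((C + 2) * R))) := by positivity
      rw [Prod.norm_def]
      exact max_le (h1.1.trans (mul_le_mul_of_nonneg_left h2 hK))
        (h1.2.trans (mul_le_mul_of_nonneg_left h2 hK)))
  have hTφ : ∀ t, ∀ᶠ j in atTop, t ≤ T (φ j) := fun t =>
    (hT.comp hφ.tendsto_atTop).eventually_ge_atTop t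
  have hVlim : ∀ t, 0 ≤ t → Tendsto (fun j => V (φ j) t) atTop (𝓝 (y t).1) := by
    intro t ht
    refine ((continuous_fst.tendsto _).comp (hy t)).congr' ?_
    filter_upwards [hTφ t] with j hj
    simp [hceq (φ j) t ⟨ht, hj⟩]
  have hUlim : ∀ t, 0 ≤ t → Tendsto (fun j => U (φ j) t) atTop (𝓝 (y t).2) := by
    intro t ht
    refine ((continuous_snd.tendsto _).comp (hy t)).congr' ?_
    filter_upwards [hTφ t] with j hj
    simp [hceq (φ j) t ⟨ht, hj⟩]
  have heφ := helim.comp hφ.tendsto_atTop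
  have hμφ := hμlim.comp hφ.tendsto_atTop
  have hhφ := hhlim.comp hφ.tendsto_atTop
  have hgl : ∀ t, 0 ≤ t → Tendsto (fun j => F (φ j) (V (φ j) t ^ 2 - e (φ j) * U (φ j) t ^ 2))
      atTop (𝓝 (F' ((y t).1 ^ 2 - e' * (y t).2 ^ 2))) := by
    intro t ht
    have h1 : TendstoUniformly (fun j => F (φ j)) F' atTop := fun u hu =>
      hφ.tendsto_atTop.eventually (hFlim u hu)
    exact h1.tendsto_comp hF'.continuousAt
      (((hVlim t ht).pow 2).sub (heφ.mul ((hUlim t ht).pow 2)))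
  have hFabs : ∀ j s, |F j s| ≤ C := fun j s => by
    rw [abs_of_nonneg (hF0 j s)]
    exact hFC j s
  have hcj : ∀ t, ∀ᶠ j in atTop, ContinuousOn (V (φ j)) (Icc 0 t) ∧
      ContinuousOn (U (φ j)) (Icc 0 t) := by
    intro t
    filter_upwards [hTφ t] with j hj
    exact ⟨((hS (φ j)).mono hj).contV, ((hS (φ j)).mono hj).contU⟩
  have hV' : ∀ t, 0 ≤ t → (y t).1 - (y 0).1 =
      ∫ s in (0 : ℝ)..t, -((1 - e' * F' ((y s).1 ^ 2 - e' * (y s).2 ^ 2)) * (y s).2) := by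
    intro t ht
    have h1 : Tendsto (fun j => ∫ s in (0 : ℝ)..t,
        -((1 - e (φ j) * F (φ j) (V (φ j) s ^ 2 - e (φ j) * U (φ j) s ^ 2)) * U (φ j) s)) atTop
        (𝓝 (∫ s in (0 : ℝ)..t, -((1 - e' * F' ((y s).1 ^ 2 - e' * (y s).2 ^ 2)) * (y s).2))) := by
      refine tendsto_integral_of_bounded (K := A * Real.exp ((C + 2) * t)) ht ?_ ?_ ?_
      · filter_upwards [hcj t] with j hj
        obtain ⟨hj1, hj2⟩ := hj
        have := hFc (φ j)
        fun_prop
      · filter_upwards [hTφ t] with j hj s hs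
        have h1 : 0 ≤ e (φ j) * F (φ j) (V (φ j) s ^ 2 - e (φ j) * U (φ j) s ^ 2) :=
          mul_nonneg (he _) (hF0 _ _)
        have h2 : e (φ j) * F (φ j) (V (φ j) s ^ 2 - e (φ j) * U (φ j) s ^ 2) ≤ 1 :=
          (mul_le_mul_of_nonneg_left (hFC _ _) (he _)).trans (heC _)
        rw [abs_neg, abs_mul, abs_of_nonneg (by linarith)]
        have h3 := (hbd1 (φ j) s ⟨hs.1, hs.2.trans hj⟩ t hs.2).2
        have h4 := abs_nonneg (U (φ j) s)
        nlinarith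
      · intro s hs
        exact (((tendsto_const_nhds).sub (heφ.mul (hgl s hs.1))).mul (hUlim s hs.1)).neg
    refine tendsto_nhds_unique ((hVlim t ht).sub (hVlim 0 le_rfl)) (h1.congr' ?_)
    filter_upwards [hTφ t] with j hj
    exact ((hS (φ j)).integral_V (hFc _) ⟨ht, hj⟩).symm
  have hU' : ∀ t, 0 ≤ t → t ^ d * (y t).2 =
      ∫ s in (0 : ℝ)..t, s ^ d * ((F' ((y s).1 ^ 2 - e' * (y s).2 ^ 2) - μ') * (y s).1) := by
    intro t ht
    have h1 : Tendsto (fun j => ∫ s in (0 : ℝ)..t, (s + h (φ j)) ^ d *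
        ((F (φ j) (V (φ j) s ^ 2 - e (φ j) * U (φ j) s ^ 2) - μ (φ j)) * V (φ j) s)) atTop
        (𝓝 (∫ s in (0 : ℝ)..t,
          s ^ d * ((F' ((y s).1 ^ 2 - e' * (y s).2 ^ 2) - μ') * (y s).1))) := by
      refine tendsto_integral_of_bounded
        (K := (t + 1) ^ d * ((C + 1) * (A * Real.exp ((C + 2) * t)))) ht ?_ ?_ ?_
      · filter_upwards [hcj t] with j hj
        obtain ⟨hj1, hj2⟩ := hj
        have := hFc (φ j)
        fun_prop
      · filter_upwards [hTφ t, hhφ.eventually_le_const (show (0 : ℝ) < 1 by norm_num)]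
          with j hj hj2 s hs
        simp only [Function.comp] at hj2
        have h3 := (hbd1 (φ j) s ⟨hs.1, hs.2.trans hj⟩ t hs.2).1
        have h5 := hh (φ j)
        have h6 := hs.1
        rw [abs_mul, abs_mul, abs_of_nonneg (by positivity)]
        have h7 : |F (φ j) (V (φ j) s ^ 2 - e (φ j) * U (φ j) s ^ 2) - μ (φ j)| ≤ C + 1 := by
          refine (abs_sub _ _).trans (add_le_add (hFabs _ _) ?_)
          rw [abs_of_nonneg (hμ0 _)]
          exact hμ1 _
        have h8 := hs.2
        gcongr
      · intro s hs
        have h3 : Tendsto (fun j => (s + h (φ j)) ^ d) atTop (𝓝 (s ^ d)) := by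
          have := (hhφ.const_add s).pow d
          simpa using this
        exact h3.mul (((hgl s hs.1).sub hμφ).mul (hVlim s hs.1))
    have h2 : Tendsto (fun j => (t + h (φ j)) ^ d * U (φ j) t) atTop (𝓝 (t ^ d * (y t).2)) := by
      have := (hhφ.const_add t).pow d
      rw [add_zero] at this
      exact this.mul (hUlim t ht)
    refine tendsto_nhds_unique h2 (h1.congr' ?_)
    filter_upwards [hTφ t] with j hj
    exact ((hS (φ j)).integral_U (hFc _) (hh _) ⟨ht, hj⟩).symm
  refine ⟨φ, hφ, fun t => (y t).1, fun t => (y t).2, fun R => ⟨by fun_prop, by fun_prop, ?_, ?_, ?_⟩,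
    fun t ht => ⟨hVlim t ht, hUlim t ht⟩⟩
  · refine tendsto_nhds_unique (hUlim 0 le_rfl) (tendsto_const_nhds.congr fun j => ?_)
    exact (hS (φ j)).init.symm
  · intro t ht
    have h1 := hasDerivAt_of_integral_eq (f := fun t => (y t).1 - (y 0).1) (T := R)
      (g := fun s => -((1 - e' * F' ((y s).1 ^ 2 - e' * (y s).2 ^ 2)) * (y s).2)) (by fun_prop)
      (fun t ht => hV' t ht.1) t ht
    simpa using h1.add_const (y 0).1
  · intro t ht
    have h1 := hasDerivAt_of_integral_eq (f := fun t => t ^ d * (y t).2) (T := R)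
      (g := fun s => s ^ d * ((F' ((y s).1 ^ 2 - e' * (y s).2 ^ 2) - μ') * (y s).1)) (by fun_prop)
      (fun t ht => hU' t ht.1) t ht
    have ht0 := ht.1
    have h2 := h1.div (hasDerivAt_pow d t) (by positivity)
    refine (h2.congr_of_eventuallyEq ?_).congr_deriv ?_
    · filter_upwards [lt_mem_nhds ht0] with s hs
      simp only [Pi.div_apply]
      field_simp
    · simp only [add_zero]
      rcases d with _ | d
      · simp
      · push_cast
        field_simp
        ring

/-- Truncation of a real number to `[-B, B]`. -/
noncomputable def truncate (B x : ℝ) : ℝ := max (-B) (min x B)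

theorem abs_truncate_le {B : ℝ} (hB : 0 ≤ B) (x : ℝ) : |truncate B x| ≤ B :=
  abs_le.2 ⟨le_max_left _ _, max_le (by linarith) (min_le_right _ _)⟩

theorem truncate_eq {B x : ℝ} (hx : |x| ≤ B) : truncate B x = x := by
  unfold truncate
  rw [min_eq_left (abs_le.1 hx).2, max_eq_right (abs_le.1 hx).1]

theorem abs_truncate_sub_le (B x y : ℝ) : |truncate B x - truncate B y| ≤ |x - y| := by
  unfold truncate
  refine (abs_max_sub_max_le_max _ _ _ _).trans (max_le (by simp) ?_)
  exact (abs_min_sub_min_le_max _ _ _ _).trans (by simp)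

theorem truncate_zero {B : ℝ} (hB : 0 ≤ B) : truncate B 0 = 0 := truncate_eq (by simpa using hB)

theorem abs_truncate_le_abs {B : ℝ} (hB : 0 ≤ B) (x : ℝ) : |truncate B x| ≤ |x| := by
  have := abs_truncate_sub_le B x 0
  rwa [truncate_zero hB, sub_zero, sub_zero] at this

theorem mul_truncate_nonneg {B : ℝ} (hB : 0 ≤ B) (x : ℝ) : 0 ≤ x * truncate B x := by
  unfold truncate
  rcases le_total 0 x with hx | hx
  · exact mul_nonneg hx (le_max_of_le_right (le_min hx hB))
  · exact mul_nonneg_of_nonpos_of_nonpos hx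
      (max_le (by linarith) ((min_le_left _ _).trans hx))

/-- The truncated vector field of the radial system. -/
noncomputable def truncatedField (d : ℕ) (h e : ℝ) (F : ℝ → ℝ) (B t : ℝ) (x : ℝ × ℝ) : ℝ × ℝ :=
  (-((1 - e * F (truncate B x.1 ^ 2 - e * truncate B x.2 ^ 2)) * truncate B x.2),
    (F (truncate B x.1 ^ 2 - e * truncate B x.2 ^ 2) - 1) * truncate B x.1
      - d / (t + h) * truncate B x.2)

section Flow

variable {d : ℕ} {h e C L : ℝ} {F : ℝ → ℝ}

theorem norm_truncatedField_le (hh : 0 < h) (hF0 : ∀ s, 0 ≤ F s) (hFC : ∀ s, F s ≤ C)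
    (he : 0 ≤ e) (heC : e * C ≤ 1) {B t : ℝ} (hB : 0 ≤ B) (ht : 0 ≤ t) (x : ℝ × ℝ) :
    ‖truncatedField d h e F B t x‖ ≤ (C + 2 + d / h) * B := by
  have hC : 0 ≤ C := (hF0 0).trans (hFC 0)
  unfold truncatedField
  set v := truncate B x.1
  set u := truncate B x.2
  have hv : |v| ≤ B := abs_truncate_le hB _
  have hu : |u| ≤ B := abs_truncate_le hB _
  have h1 : 0 ≤ e * F (v ^ 2 - e * u ^ 2) := mul_nonneg he (hF0 _)
  have h2 : e * F (v ^ 2 - e * u ^ 2) ≤ 1 := (mul_le_mul_of_nonneg_left (hFC _) he).trans heC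
  have h3 : |F (v ^ 2 - e * u ^ 2) - 1| ≤ C + 1 := by
    rw [abs_le]
    constructor <;> linarith [hF0 (v ^ 2 - e * u ^ 2), hFC (v ^ 2 - e * u ^ 2)]
  have h4 : |d / (t + h)| ≤ d / h := by
    rw [abs_of_nonneg (by positivity)]
    gcongr
    linarith
  have h5 : 0 ≤ d / h * B := by positivity
  have h6 : 0 ≤ C * B := by positivity
  rw [Prod.norm_def]
  refine max_le ?_ ?_
  · rw [Real.norm_eq_abs, abs_neg, abs_mul, abs_of_nonneg (by linarith)]
    nlinarith [abs_nonneg u]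
  · rw [Real.norm_eq_abs]
    refine (abs_sub _ _).trans ?_
    rw [abs_mul, abs_mul]
    have h7 := mul_le_mul h3 hv (abs_nonneg _) (by linarith)
    have h8 := mul_le_mul h4 hu (abs_nonneg _) (by positivity)
    linarith

theorem dist_truncatedField_le (hh : 0 < h) (hF0 : ∀ s, 0 ≤ F s) (hFC : ∀ s, F s ≤ C)
    (hL0 : 0 ≤ L) (hFL : ∀ s s', |F s - F s'| ≤ L * |s - s'|)
    (he : 0 ≤ e) (heC : e * C ≤ 1) {B t : ℝ} (hB : 0 ≤ B) (ht : 0 ≤ t) (x y : ℝ × ℝ) :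
    dist (truncatedField d h e F B t x) (truncatedField d h e F B t y) ≤
      (C + 2 + d / h + (1 + e) * (L * (2 * B * (1 + e))) * B) * dist x y := by
  have hC : 0 ≤ C := (hF0 0).trans (hFC 0)
  unfold truncatedField
  have hvv : |truncate B x.1 - truncate B y.1| ≤ dist x y :=
    (abs_truncate_sub_le B x.1 y.1).trans (by rw [Prod.dist_eq]; exact le_max_left _ _)
  have huu : |truncate B x.2 - truncate B y.2| ≤ dist x y :=
    (abs_truncate_sub_le B x.2 y.2).trans (by rw [Prod.dist_eq]; exact le_max_right _ _)
  have hD0 : 0 ≤ dist x y := dist_nonneg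
  set D := dist x y
  have hv : |truncate B x.1| ≤ B := abs_truncate_le hB _
  have hu : |truncate B x.2| ≤ B := abs_truncate_le hB _
  have hv' : |truncate B y.1| ≤ B := abs_truncate_le hB _
  have hu' : |truncate B y.2| ≤ B := abs_truncate_le hB _
  set v := truncate B x.1
  set u := truncate B x.2
  set v' := truncate B y.1
  set u' := truncate B y.2
  have hsq : ∀ a b : ℝ, |a| ≤ B → |b| ≤ B → |a - b| ≤ D → |a ^ 2 - b ^ 2| ≤ 2 * B * D := by
    intro a b ha hb hab
    have : a ^ 2 - b ^ 2 = (a + b) * (a - b) := by ring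
    rw [this, abs_mul]
    refine mul_le_mul ((abs_add_le _ _).trans (by linarith)) hab (abs_nonneg _) (by linarith)
  have hs : |(v ^ 2 - e * u ^ 2) - (v' ^ 2 - e * u' ^ 2)| ≤ 2 * B * (1 + e) * D := by
    have h1 := hsq v v' hv hv' hvv
    have h2 := hsq u u' hu hu' huu
    have h3 : (v ^ 2 - e * u ^ 2) - (v' ^ 2 - e * u' ^ 2)
      = (v ^ 2 - v' ^ 2) - e * (u ^ 2 - u' ^ 2) := by ring
    rw [h3]
    refine (abs_sub _ _).trans ?_
    rw [abs_mul, abs_of_nonneg he]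
    have := mul_le_mul_of_nonneg_left h2 he
    linarith
  have hFF := (hFL (v ^ 2 - e * u ^ 2) (v' ^ 2 - e * u' ^ 2)).trans
    (mul_le_mul_of_nonneg_left hs hL0)
  set s := v ^ 2 - e * u ^ 2
  set s' := v' ^ 2 - e * u' ^ 2
  have h1 : 0 ≤ e * F s := mul_nonneg he (hF0 _)
  have h2 : e * F s ≤ 1 := (mul_le_mul_of_nonneg_left (hFC _) he).trans heC
  have h3 : |F s - 1| ≤ C + 1 := by
    rw [abs_le]
    constructor <;> linarith [hF0 s, hFC s]
  have h4 : |d / (t + h)| ≤ d / h := by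
    rw [abs_of_nonneg (by positivity)]
    gcongr
    linarith
  have h5 : 0 ≤ d / h * D := by positivity
  have h6 : 0 ≤ C * D := by positivity
  set M := L * (2 * B * (1 + e)) with hM
  have hM0 : 0 ≤ M := by positivity
  have hFF' : |F s - F s'| ≤ M * D := by rw [hM]; linarith
  have hMB : 0 ≤ M * D * B := by positivity
  have heMB : 0 ≤ e * (M * D * B) := by positivity
  rw [Prod.dist_eq]
  refine max_le ?_ ?_
  · rw [Real.dist_eq]
    have h7 : -((1 - e * F s) * u) - -((1 - e * F s') * u') =
      -((1 - e * F s) * (u - u')) + e * ((F s - F s') * u') := by ring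
    change |-((1 - e * F s) * u) - -((1 - e * F s') * u')| ≤ _
    rw [h7]
    refine (abs_add_le _ _).trans ?_
    rw [abs_neg, abs_mul, abs_mul, abs_mul, abs_of_nonneg he,
      abs_of_nonneg (show 0 ≤ 1 - e * F s by linarith)]
    have h8 : (1 - e * F s) * |u - u'| ≤ D := by nlinarith [abs_nonneg (u - u')]
    have h9 := mul_le_mul_of_nonneg_left
      (mul_le_mul hFF' hu' (abs_nonneg _) (by positivity)) he
    linarith
  · rw [Real.dist_eq]
    have h7 : ((F s - 1) * v - d / (t + h) * u) - ((F s' - 1) * v' - d / (t + h) * u') =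
      (F s - 1) * (v - v') + (F s - F s') * v' - d / (t + h) * (u - u') := by ring
    change |((F s - 1) * v - d / (t + h) * u) - ((F s' - 1) * v' - d / (t + h) * u')| ≤ _
    rw [h7]
    refine (abs_sub _ _).trans ((add_le_add_left (abs_add_le _ _) _).trans ?_)
    rw [abs_mul, abs_mul, abs_mul]
    have h8 := mul_le_mul h3 hvv (abs_nonneg _) (by linarith)
    have h9 := mul_le_mul hFF' hv' (abs_nonneg _) (by positivity)
    have h10 := mul_le_mul h4 huu (abs_nonneg _) (by positivity)
    linarith

/-- The flow of the regularized radial system, Lipschitz in the initial amplitude. -/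
theorem exists_radial_flow (hh : 0 < h) (hF0 : ∀ s, 0 ≤ F s) (hFC : ∀ s, F s ≤ C)
    (hL0 : 0 ≤ L) (hFL : ∀ s s', |F s - F s'| ≤ L * |s - s'|)
    (he : 0 ≤ e) (heC : e * C ≤ 1) {T A : ℝ} (hT : 0 ≤ T) (hA : 0 ≤ A) :
    ∃ V U : ℝ → ℝ → ℝ, ∃ K : ℝ,
      (∀ α ∈ Icc 0 A, V α 0 = α ∧ IsRadialSol d h e 1 F T (V α) (U α)) ∧
      ∀ t ∈ Icc 0 T, ∀ α ∈ Icc 0 A, ∀ β ∈ Icc 0 A, |V α t - V β t| ≤ K * |α - β| := by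
  have hC : 0 ≤ C := (hF0 0).trans (hFC 0)
  have hFcont : Continuous F := by
    refine (LipschitzWith.of_dist_le_mul (K := L.toNNReal) fun x y => ?_).continuous
    rw [Real.coe_toNNReal _ hL0]
    exact hFL x y
  set B := A * Real.exp ((C + 2) * T) with hB
  have hB0 : 0 ≤ B := by positivity
  have hpl : IsPicardLindelof (truncatedField d h e F B)
      (tmin := 0) (tmax := T) ⟨0, left_mem_Icc.2 hT⟩ ((0, 0) : ℝ × ℝ)
      (A + (C + 2 + d / h) * B * T).toNNReal A.toNNReal ((C + 2 + d / h) * B).toNNReal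
      (C + 2 + d / h + (1 + e) * (L * (2 * B * (1 + e))) * B).toNNReal := by
    refine ⟨?_, ?_, ?_, ?_⟩
    · intro t ht
      refine (LipschitzWith.of_dist_le_mul fun x y => ?_).lipschitzOnWith
      rw [Real.coe_toNNReal _ (by positivity)]
      exact dist_truncatedField_le hh hF0 hFC hL0 hFL he heC hB0 ht.1 x y
    · intro x _
      unfold truncatedField
      have : ∀ t ∈ Icc 0 T, t + h ≠ 0 := fun t ht => by linarith [ht.1]
      fun_prop (disch := assumption)
    · intro t ht x _
      rw [Real.coe_toNNReal _ (by positivity)]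
      exact norm_truncatedField_le hh hF0 hFC he heC hB0 ht.1 x
    · rw [Real.coe_toNNReal _ (by positivity), Real.coe_toNNReal _ (by positivity),
        Real.coe_toNNReal _ hA]
      simp [hT]
  obtain ⟨X, hX, L', hL'⟩ :=
    hpl.exists_forall_mem_closedBall_eq_hasDerivWithinAt_lipschitzOnWith
  have hmem : ∀ α ∈ Icc 0 A, ((α, 0) : ℝ × ℝ) ∈
      Metric.closedBall ((0, 0) : ℝ × ℝ) (A.toNNReal) := by
    intro α hα
    rw [Real.coe_toNNReal _ hA, mem_closedBall_iff_norm, Prod.norm_def]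
    simpa [abs_of_nonneg hα.1] using ⟨hα.2, hA⟩
  refine ⟨fun α t => (X (α, 0) t).1, fun α t => (X (α, 0) t).2, L', ?_, ?_⟩
  · intro α hα
    obtain ⟨hX0, hXd⟩ := hX (α, 0) (hmem α hα)
    have hX0' : X (α, 0) 0 = (α, 0) := hX0
    have hXc : ContinuousOn (X (α, 0)) (Icc 0 T) := fun t ht =>
      (hXd t ht).continuousWithinAt
    have hXd' : ∀ t ∈ Ioo 0 T,
        HasDerivAt (X (α, 0)) (truncatedField d h e F B t (X (α, 0) t)) t := fun t ht =>
      (hXd t (Ioo_subset_Icc_self ht)).hasDerivAt (Icc_mem_nhds ht.1 ht.2)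
    have hV : ∀ t ∈ Ioo 0 T, HasDerivAt (fun t => (X (α, 0) t).1)
        (truncatedField d h e F B t (X (α, 0) t)).1 t := fun t ht => (hXd' t ht).fst
    have hU : ∀ t ∈ Ioo 0 T, HasDerivAt (fun t => (X (α, 0) t).2)
        (truncatedField d h e F B t (X (α, 0) t)).2 t := fun t ht => (hXd' t ht).snd
    set V := fun t => (X (α, 0) t).1 with hVdef
    set U := fun t => (X (α, 0) t).2 with hUdef
    have hVc : ContinuousOn V (Icc 0 T) := continuous_fst.comp_continuousOn hXc
    have hUc : ContinuousOn U (Icc 0 T) := continuous_snd.comp_continuousOn hXc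
    have hV0 : V 0 = α := by simp [hVdef, hX0']
    have hU0 : U 0 = 0 := by simp [hUdef, hX0']
    have hm : AntitoneOn (fun t => Real.exp (-(2 * (C + 2) * t)) * (V t ^ 2 + U t ^ 2))
        (Icc 0 T) := by
      refine antitoneOn_Icc_of_hasDerivAt (by fun_prop) (fun t ht =>
        ((((hasDerivAt_id t).const_mul (2 * (C + 2))).neg).exp).mul
          (((hV t ht).pow 2).add ((hU t ht).pow 2))) ?_
      intro t ht
      change _ * (2 * (C + 2) * 1 |> Neg.neg) * _ + _ * ((2 : ℕ) * V t ^ (2 - 1) * _ + (2 : ℕ) * U t ^ (2 - 1) * _) ≤ 0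
      simp only [truncatedField]
      change _ * (2 * (C + 2) * 1 |> Neg.neg) * (V t ^ 2 + U t ^ 2) + _ * ((2 : ℕ) * V t ^ (2 - 1) *
        (-((1 - e * F (truncate B (V t) ^ 2 - e * truncate B (U t) ^ 2)) * truncate B (U t)))
        + (2 : ℕ) * U t ^ (2 - 1) *
        ((F (truncate B (V t) ^ 2 - e * truncate B (U t) ^ 2) - 1) * truncate B (V t)
          - d / (t + h) * truncate B (U t))) ≤ 0
      set s := truncate B (V t) ^ 2 - e * truncate B (U t) ^ 2
      have h1 : 0 ≤ e * F s := mul_nonneg he (hF0 _)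
      have h2 : e * F s ≤ 1 := (mul_le_mul_of_nonneg_left (hFC _) he).trans heC
      have h3 : |F s - 1| ≤ C + 1 := by
        rw [abs_le]
        constructor <;> linarith [hF0 s, hFC s]
      have h3' : |1 - e * F s| ≤ 1 := by
        rw [abs_le]
        constructor <;> linarith
      have h4 : |V t * ((1 - e * F s) * truncate B (U t))| ≤ |V t| * |U t| := by
        rw [abs_mul, abs_mul]
        refine mul_le_mul_of_nonneg_left ?_ (abs_nonneg _)
        have := mul_le_mul h3' (abs_truncate_le_abs hB0 (U t)) (abs_nonneg _) zero_le_one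
        linarith
      have h5 : |U t * ((F s - 1) * truncate B (V t))| ≤ (C + 1) * (|V t| * |U t|) := by
        rw [abs_mul, abs_mul]
        have := mul_le_mul h3 (abs_truncate_le_abs hB0 (V t)) (abs_nonneg _) (by linarith)
        have := mul_le_mul_of_nonneg_left this (abs_nonneg (U t))
        linarith
      have h6 : 0 ≤ d / (t + h) * (U t * truncate B (U t)) := by
        have := mul_truncate_nonneg hB0 (U t)
        have := ht.1
        positivity
      have h7 : 2 * (|V t| * |U t|) ≤ V t ^ 2 + U t ^ 2 := by
        nlinarith [sq_nonneg (|V t| - |U t|), sq_abs (V t), sq_abs (U t)]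
      have h8 := neg_le_of_abs_le h4
      have h9 := le_of_abs_le h5
      have h10 := mul_le_mul_of_nonneg_left h7 (show 0 ≤ C + 2 by linarith)
      have h11 := mul_nonneg (show 0 ≤ C + 2 by linarith)
        (add_nonneg (sq_nonneg (V t)) (sq_nonneg (U t)))
      rw [mul_assoc, ← mul_add]
      refine mul_nonpos_of_nonneg_of_nonpos (Real.exp_pos _).le ?_
      push_cast
      norm_num
      linarith
    have hbd : ∀ t ∈ Icc 0 T, V t ^ 2 + U t ^ 2 ≤ B ^ 2 := by
      intro t ht
      have h1 := hm (left_mem_Icc.2 hT) ht ht.1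
      simp only [mul_zero, neg_zero, Real.exp_zero, one_mul, hV0, hU0] at h1
      rw [Real.exp_neg, inv_mul_le_iff₀ (Real.exp_pos _)] at h1
      refine h1.trans ?_
      rw [hB, mul_pow, ← Real.exp_nat_mul, mul_comm]
      have h2 : α ^ 2 ≤ A ^ 2 := pow_le_pow_left₀ hα.1 hα.2 2
      have h3 : Real.exp (2 * (C + 2) * t) ≤ Real.exp ((2 : ℕ) * ((C + 2) * T)) := by
        refine Real.exp_le_exp.2 ?_
        have := mul_le_mul_of_nonneg_left ht.2 (show 0 ≤ C + 2 by linarith)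
        push_cast
        linarith
      refine mul_le_mul ?_ h3 (Real.exp_pos _).le (sq_nonneg _)
      simpa using h2
    have hVB : ∀ t ∈ Icc 0 T, truncate B (V t) = V t := fun t ht => truncate_eq
      (abs_le_of_sq_le_sq (by nlinarith [hbd t ht, sq_nonneg (U t)]) hB0)
    have hUB : ∀ t ∈ Icc 0 T, truncate B (U t) = U t := fun t ht => truncate_eq
      (abs_le_of_sq_le_sq (by nlinarith [hbd t ht, sq_nonneg (V t)]) hB0)
    refine ⟨hV0, ⟨hVc, hUc, hU0, ?_, ?_⟩⟩
    · intro t ht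
      refine (hV t ht).congr_deriv ?_
      change -((1 - e * F (truncate B (V t) ^ 2 - e * truncate B (U t) ^ 2)) * truncate B (U t)) = _
      rw [hVB t (Ioo_subset_Icc_self ht), hUB t (Ioo_subset_Icc_self ht)]
    · intro t ht
      refine (hU t ht).congr_deriv ?_
      change (F (truncate B (V t) ^ 2 - e * truncate B (U t) ^ 2) - 1) * truncate B (V t)
        - d / (t + h) * truncate B (U t) = _
      rw [hVB t (Ioo_subset_Icc_self ht), hUB t (Ioo_subset_Icc_self ht)]
  · intro t ht α hα β hβ
    have h1 := (hL' t ht).dist_le_mul (α, 0) (hmem α hα) (β, 0) (hmem β hβ)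
    have h2 : dist ((α, 0) : ℝ × ℝ) (β, 0) = |α - β| := by
      rw [Prod.dist_eq, Real.dist_eq]
      simp
    rw [h2] at h1
    refine le_trans ?_ h1
    rw [Prod.dist_eq]
    exact le_max_left _ _

end Flow

theorem IsRadialSol.hamiltonian_nonneg_of_zero_end {d : ℕ} {h e T : ℝ} {F V U : ℝ → ℝ}
    (hS : IsRadialSol d h e 1 F T V U) (hh : 0 ≤ h) (hF : Continuous F)
    (hFneg : ∀ s ≤ 0, F s = 0) (he : 0 ≤ e) (heF : ∀ s, e * F s ≤ 1) (hT : 0 ≤ T)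
    (hV : V T = 0) : ∀ t ∈ Icc 0 T, 0 ≤ hamiltonian e 1 F (V t) (U t) := by
  intro t ht
  have h1 := hS.antitoneOn_hamiltonian hh hF heF ht ⟨hT, le_rfl⟩ ht.2
  have h2 := hamiltonian_nonneg_of_zero (μ := 1) he hFneg (U T)
  simp only [hV] at h1
  linarith

theorem IsRadialSol.nonneg_of_subcritical {d : ℕ} {h e T : ℝ} {F V U : ℝ → ℝ}
    (hS : IsRadialSol d h e 1 F T V U) (hh : 0 ≤ h) (hF : Continuous F)
    (hFneg : ∀ s ≤ 0, F s = 0) (he : 0 ≤ e) (heF : ∀ s, e * F s ≤ 1) (h0 : 0 ≤ V 0)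
    (hsub : primitive F (V 0 ^ 2) < V 0 ^ 2) : ∀ t ∈ Icc 0 T, 0 ≤ V t := by
  intro t ht
  by_contra hneg
  push Not at hneg
  obtain ⟨s, hs, hs0⟩ := intermediate_value_Icc' ht.1
    (hS.contV.mono (Icc_subset_Icc_right ht.2)) (show (0 : ℝ) ∈ Icc (V t) (V 0) from ⟨hneg.le, h0⟩)
  have h1 := (hS.mono (hs.2.trans ht.2)).hamiltonian_nonneg_of_zero_end hh hF hFneg he heF hs.1 hs0
    0 ⟨le_rfl, hs.1⟩
  unfold hamiltonian at h1
  rw [hS.init] at h1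
  norm_num at h1
  linarith

theorem exists_shooting {d : ℕ} {h e C L T a b : ℝ} {F : ℝ → ℝ} (hh : 0 < h)
    (hF0 : ∀ s, 0 ≤ F s) (hFC : ∀ s, F s ≤ C) (hFneg : ∀ s ≤ 0, F s = 0) (hL0 : 0 ≤ L)
    (hFL : ∀ s s', |F s - F s'| ≤ L * |s - s'|) (he : 0 ≤ e) (heC : e * C ≤ 1 / 2)
    (hT : 0 < T) (ha : 0 < a) (hab : a ≤ b) (hsub : primitive F (a ^ 2) < a ^ 2)
    (hcross : ∀ V U, IsRadialSol d h e 1 F T V U → V 0 = b → ∃ t ∈ Icc 0 T, V t < 0) :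
    ∃ V U, IsRadialSol d h e 1 F T V U ∧ V 0 ∈ Icc a b ∧ (∀ t ∈ Icc 0 T, 0 ≤ V t) ∧
      ∀ t ∈ Icc 0 T, 0 ≤ hamiltonian e 1 F (V t) (U t) := by
  have hF : Continuous F := by
    refine (LipschitzWith.of_dist_le_mul (K := ⟨L, hL0⟩) fun s s' => ?_).continuous
    rw [Real.dist_eq, Real.dist_eq]
    exact hFL s s'
  have heC1 : e * C ≤ 1 := by linarith
  have heF : ∀ s, e * F s ≤ 1 / 2 := fun s =>
    (mul_le_mul_of_nonneg_left (hFC s) he).trans heC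
  have heF1 : ∀ s, e * F s ≤ 1 := fun s => (heF s).trans (by norm_num)
  obtain ⟨V, U, K, hsol, hK⟩ := exists_radial_flow (d := d) hh hF0 hFC hL0 hFL he heC1 hT.le
    (ha.le.trans hab)
  have hsub' : Icc a b ⊆ Icc 0 b := Icc_subset_Icc_left ha.le
  have hcontα : ∀ t ∈ Icc 0 T, ContinuousOn (fun α => V α t) (Icc a b) := by
    intro t ht
    refine (LipschitzOnWith.of_dist_le_mul (K := K.toNNReal) fun α hα β hβ => ?_).continuousOn
    rw [Real.dist_eq, Real.dist_eq]
    exact (hK t ht α (hsub' hα) β (hsub' hβ)).trans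
      (mul_le_mul_of_nonneg_right (Real.le_coe_toNNReal K) (abs_nonneg _))
  set S : Set ℝ := ⋂ t ∈ Icc 0 T, (Icc a b ∩ (fun α => V α t) ⁻¹' Ici 0) with hSdef
  have hmem : ∀ α, α ∈ S ↔ α ∈ Icc a b ∧ ∀ t ∈ Icc 0 T, 0 ≤ V α t := by
    intro α
    simp only [hSdef, mem_iInter, mem_inter_iff, mem_preimage, mem_Ici]
    exact ⟨fun hα => ⟨(hα 0 ⟨le_rfl, hT.le⟩).1, fun t ht => (hα t ht).2⟩,
      fun hα t ht => ⟨hα.1, hα.2 t ht⟩⟩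
  have hclosed : IsClosed S := isClosed_biInter fun t ht =>
    (hcontα t ht).preimage_isClosed_of_isClosed isClosed_Icc isClosed_Ici
  have hcomp : IsCompact S := isCompact_Icc.of_isClosed_subset hclosed fun α hα => ((hmem α).1 hα).1
  have haS : a ∈ S := by
    obtain ⟨h1, h2⟩ := hsol a (hsub' ⟨le_rfl, hab⟩)
    exact (hmem a).2 ⟨⟨le_rfl, hab⟩, h2.nonneg_of_subcritical hh.le hF hFneg he heF1
      (by rw [h1]; exact ha.le) (by rw [h1]; exact hsub)⟩
  obtain ⟨α, hαS, hαmax⟩ := hcomp.exists_isGreatest ⟨a, haS⟩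
  obtain ⟨hαI, hαV⟩ := (hmem α).1 hαS
  obtain ⟨hα0, hαsol⟩ := hsol α (hsub' hαI)
  have hαpos : 0 < α := ha.trans_le hαI.1
  have hαb : α < b := by
    refine lt_of_le_of_ne hαI.2 fun hEq => ?_
    obtain ⟨t, ht, htn⟩ := hcross _ _ hαsol (hα0.trans hEq)
    linarith [hαV t ht]
  obtain ⟨t₀, ht₀, hmin⟩ := isCompact_Icc.exists_isMinOn (nonempty_Icc.2 hT.le) hαsol.contV
  have hzero : V α t₀ = 0 := by
    refine le_antisymm ?_ (hαV t₀ ht₀)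
    by_contra hpos
    push Not at hpos
    obtain ⟨β, hβ1, hβ2⟩ : ∃ β, α < β ∧ β ≤ b ∧ |K| * (β - α) ≤ V α t₀ := by
      refine ⟨min b (α + V α t₀ / (|K| + 1)), lt_min hαb (by
        have : 0 < V α t₀ / (|K| + 1) := by positivity
        linarith), min_le_left _ _, ?_⟩
      have h1 : min b (α + V α t₀ / (|K| + 1)) - α ≤ V α t₀ / (|K| + 1) := by
        linarith [min_le_right b (α + V α t₀ / (|K| + 1))]
      calc |K| * (min b (α + V α t₀ / (|K| + 1)) - α) ≤ |K| * (V α t₀ / (|K| + 1)) :=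
            mul_le_mul_of_nonneg_left h1 (abs_nonneg K)
        _ ≤ V α t₀ := by
            rw [mul_div_assoc', div_le_iff₀ (by positivity)]
            nlinarith [abs_nonneg K]
    have hβI : β ∈ Icc a b := ⟨hαI.1.trans hβ1.le, hβ2.1⟩
    have hβS : β ∈ S := by
      refine (hmem β).2 ⟨hβI, fun t ht => ?_⟩
      have h1 := hK t ht α (hsub' hαI) β (hsub' hβI)
      rw [abs_sub_comm α β, abs_of_pos (sub_pos.2 hβ1)] at h1
      have h2 : K * (β - α) ≤ |K| * (β - α) :=
        mul_le_mul_of_nonneg_right (le_abs_self K) (sub_pos.2 hβ1).le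
      have h3 : V α t₀ ≤ V α t := hmin ht
      linarith [le_abs_self (V α t - V β t)]
    linarith [hαmax hβS]
  have ht₀T : t₀ = T := by
    by_contra hne
    have ht₀pos : 0 < t₀ := by
      refine lt_of_le_of_ne ht₀.1 fun h0 => ?_
      rw [← h0, hα0] at hzero
      linarith
    have ht₀I : t₀ ∈ Ioo 0 T := ⟨ht₀pos, lt_of_le_of_ne ht₀.2 hne⟩
    have hloc : IsLocalMin (V α) t₀ := hmin.isLocalMin (Icc_mem_nhds ht₀I.1 ht₀I.2)
    have hd := hloc.hasDerivAt_eq_zero (hαsol.derivV t₀ ht₀I)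
    have hU : U α t₀ = 0 := by
      have h1 := heF (V α t₀ ^ 2 - e * U α t₀ ^ 2)
      rcases mul_eq_zero.1 (neg_eq_zero.1 hd) with h2 | h2
      · linarith
      · exact h2
    have := hαsol.init_eq_zero_of_zero hh.le hF0 hFC he heC1 zero_le_one le_rfl ht₀pos ht₀.2 hzero hU
    linarith
  subst ht₀T
  exact ⟨V α, U α, hαsol, hα0.symm ▸ hαI, hαV,
    hαsol.hamiltonian_nonneg_of_zero_end hh.le hF hFneg he heF1 hT.le hzero⟩

theorem abs_primitive_sub_primitive_le {F : ℝ → ℝ} {C : ℝ} (hF : Continuous F)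
    (hC : ∀ s, |F s| ≤ C) (s s' : ℝ) : |primitive F s - primitive F s'| ≤ C * |s - s'| := by
  have := (convex_univ (𝕜 := ℝ) (E := ℝ)).norm_image_sub_le_of_norm_hasDerivWithin_le
    (f := primitive F) (f' := F) (C := C)
    (fun x _ => (hasDerivAt_primitive hF x).hasDerivWithinAt) (fun x _ => hC x) (mem_univ s')
    (mem_univ s)
  simpa [Real.norm_eq_abs] using this

/-- Uniform approximation by Lipschitz functions through averages over short intervals. -/
theorem exists_lipschitz_approx {F : ℝ → ℝ} {C : ℝ} (hF : UniformContinuous F)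
    (hF0 : ∀ s, 0 ≤ F s) (hFC : ∀ s, F s ≤ C) (hFneg : ∀ s ≤ 0, F s = 0) {ρ : ℝ} (hρ : 0 < ρ) :
    ∃ G : ℝ → ℝ, ∃ L : ℝ, 0 ≤ L ∧ (∀ s s', |G s - G s'| ≤ L * |s - s'|) ∧ (∀ s, 0 ≤ G s) ∧
      (∀ s, G s ≤ C) ∧ (∀ s ≤ 0, G s = 0) ∧ ∀ s, |G s - F s| < ρ := by
  obtain ⟨δ, hδ, hFδ⟩ := Metric.uniformContinuous_iff.1 hF ρ hρ
  have hC0 : 0 ≤ C := (hF0 0).trans (hFC 0)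
  set G : ℝ → ℝ := fun s => (primitive F s - primitive F (s - δ / 2)) / (δ / 2) with hG
  have hmean : ∀ s, ∃ x ∈ Ioo (s - δ / 2) s, G s = F x := by
    intro s
    obtain ⟨x, hx, hx'⟩ := exists_hasDerivAt_eq_slope (primitive F) F
      (show s - δ / 2 < s by linarith) (continuous_primitive hF.continuous).continuousOn
      (fun x _ => hasDerivAt_primitive hF.continuous x)
    refine ⟨x, hx, ?_⟩
    rw [hx', hG]
    simp
  refine ⟨G, 2 * C / (δ / 2), by positivity, fun s s' => ?_, fun s => ?_, fun s => ?_,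
    fun s hs => ?_, fun s => ?_⟩
  · have hb : ∀ s, |F s| ≤ C := fun s => by rw [abs_of_nonneg (hF0 s)]; exact hFC s
    have h1 := abs_primitive_sub_primitive_le hF.continuous hb s s'
    have h2 := abs_primitive_sub_primitive_le hF.continuous hb (s - δ / 2) (s' - δ / 2)
    rw [sub_sub_sub_cancel_right] at h2
    have h3 : G s - G s' = ((primitive F s - primitive F s')
        - (primitive F (s - δ / 2) - primitive F (s' - δ / 2))) / (δ / 2) := by
      simp only [hG]; ring
    rw [h3, abs_div, abs_of_pos (half_pos hδ), div_mul_eq_mul_div,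
      div_le_div_iff_of_pos_right (half_pos hδ)]
    refine (abs_sub _ _).trans ?_
    linarith
  · obtain ⟨x, -, hx⟩ := hmean s
    exact hx ▸ hF0 x
  · obtain ⟨x, -, hx⟩ := hmean s
    exact hx ▸ hFC x
  · obtain ⟨x, hx, hx'⟩ := hmean s
    exact hx' ▸ hFneg x (hx.2.le.trans hs)
  · obtain ⟨x, hx, hx'⟩ := hmean s
    rw [hx', ← Real.dist_eq]
    refine hFδ ?_
    rw [Real.dist_eq, abs_lt]
    constructor <;> linarith [hx.1, hx.2]

/-- The pure power nonlinearity, extended by zero to the left and by a constant to the right. -/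
noncomputable def plateau (k R s : ℝ) : ℝ := min (max s 0) R ^ k

theorem continuous_plateau {k : ℝ} (hk : 0 < k) (R : ℝ) : Continuous (plateau k R) :=
  ((continuous_id.max continuous_const).min continuous_const).rpow_const fun _ => Or.inr hk.le

theorem plateau_nonneg {k R : ℝ} (hR : 0 ≤ R) (s : ℝ) : 0 ≤ plateau k R s :=
  Real.rpow_nonneg (le_min (le_max_right _ _) hR) _

theorem plateau_le {k R : ℝ} (hk : 0 < k) (hR : 0 ≤ R) (s : ℝ) : plateau k R s ≤ R ^ k :=
  Real.rpow_le_rpow (le_min (le_max_right _ _) hR) (min_le_right _ _) hk.le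

theorem plateau_of_nonpos {k R s : ℝ} (hk : 0 < k) (hR : 0 ≤ R) (hs : s ≤ 0) :
    plateau k R s = 0 := by
  rw [plateau, max_eq_right hs, min_eq_left hR, Real.zero_rpow hk.ne']

theorem plateau_of_mem {k R s : ℝ} (hs : s ∈ Icc 0 R) : plateau k R s = s ^ k := by
  rw [plateau, max_eq_left hs.1, min_eq_left hs.2]

theorem plateau_of_le {k R s : ℝ} (hR : 0 ≤ R) (hs : R ≤ s) : plateau k R s = R ^ k := by
  rw [plateau, max_eq_left (hR.trans hs), min_eq_right hs]

/-- Nonlinearities within distance `η` of the truncated power. -/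
structure IsAdm (k η R : ℝ) (F : ℝ → ℝ) : Prop where
  cont : Continuous F
  nonneg : ∀ s, 0 ≤ F s
  zero : ∀ s ≤ 0, F s = 0
  near : ∀ s, |F s - plateau k R s| ≤ η

theorem IsAdm.le {k η R : ℝ} {F : ℝ → ℝ} (hF : IsAdm k η R F) (hk : 0 < k) (hR : 0 ≤ R) (s : ℝ) :
    F s ≤ R ^ k + η := by
  linarith [(abs_le.1 (hF.near s)).2, plateau_le hk hR s]

theorem isAdm_plateau {k η R : ℝ} (hk : 0 < k) (hη : 0 ≤ η) (hR : 0 ≤ R) :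
    IsAdm k η R (plateau k R) where
  cont := continuous_plateau hk R
  nonneg := plateau_nonneg hR
  zero _ hs := plateau_of_nonpos hk hR hs
  near s := by simpa using hη

theorem tendsto_primitive {F : ℕ → ℝ → ℝ} {F' : ℝ → ℝ} (hFc : ∀ j, Continuous (F j))
    (hF' : Continuous F') (hFlim : TendstoUniformly F F' atTop) {s : ℕ → ℝ} {s' : ℝ}
    (hs : Tendsto s atTop (𝓝 s')) :
    Tendsto (fun j => primitive (F j) (s j)) atTop (𝓝 (primitive F' s')) := by
  have h1 : Tendsto (fun j => primitive F' (s j)) atTop (𝓝 (primitive F' s')) :=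
    ((continuous_primitive hF').tendsto s').comp hs
  have h2 : Tendsto (fun j => primitive (F j) (s j) - primitive F' (s j)) atTop (𝓝 0) := by
    obtain ⟨M, hM⟩ : ∃ M, ∀ᶠ j in atTop, |s j| ≤ M :=
      ⟨|s'| + 1, (hs.abs.eventually (eventually_lt_nhds (lt_add_one _))).mono fun _ h => h.le⟩
    rw [Metric.tendsto_nhds]
    intro ρ hρ
    have hM0 : 0 < |M| + 1 := by positivity
    filter_upwards [Metric.tendstoUniformly_iff.1 hFlim (ρ / (|M| + 1)) (by positivity), hM]
      with j hj hjM
    rw [Real.dist_eq, sub_zero]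
    have h3 := abs_primitive_sub_le (hFc j) hF' (η := ρ / (|M| + 1)) (fun x => by
      have := hj x
      rw [Real.dist_eq, abs_sub_comm] at this
      exact this.le) (s j)
    refine h3.trans_lt ?_
    rw [div_mul_eq_mul_div, div_lt_iff₀ hM0]
    have : |s j| < |M| + 1 := by linarith [le_abs_self M]
    nlinarith
  simpa using h2.add h1

theorem tendsto_hamiltonian {F : ℕ → ℝ → ℝ} {F' : ℝ → ℝ} (hFc : ∀ j, Continuous (F j))
    (hF' : Continuous F') (hFlim : TendstoUniformly F F' atTop) {e μ v u : ℕ → ℝ}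
    {e' μ' v' u' : ℝ} (he : Tendsto e atTop (𝓝 e')) (hμ : Tendsto μ atTop (𝓝 μ'))
    (hv : Tendsto v atTop (𝓝 v')) (hu : Tendsto u atTop (𝓝 u')) :
    Tendsto (fun j => hamiltonian (e j) (μ j) (F j) (v j) (u j)) atTop
      (𝓝 (hamiltonian e' μ' F' v' u')) := by
  unfold hamiltonian
  exact ((tendsto_primitive hFc hF' hFlim ((hv.pow 2).sub (he.mul (hu.pow 2)))).sub
    (hμ.mul (hv.pow 2))).add (hu.pow 2)

theorem exists_nonneg_global {d : ℕ} {k η R e a b h₁ T₁ : ℝ} {F : ℝ → ℝ} (hk : 0 < k)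
    (hη : 0 < η) (hR : 0 ≤ R) (hF : IsAdm k η R F) (hFu : UniformContinuous F) (he : 0 ≤ e)
    (heC : e * (R ^ k + η) ≤ 1 / 2) (ha : 0 < a) (hab : a ≤ b)
    (hsub : primitive F (a ^ 2) < a ^ 2) (hh₁ : 0 < h₁)
    (hcross : ∀ h ∈ Ioc 0 h₁, ∀ G, IsAdm k (2 * η) R G → ∀ V U,
      IsRadialSol d h e 1 G T₁ V U → V 0 = b → ∃ t ∈ Icc 0 T₁, V t < 0) :
    ∃ V U, (∀ T, IsRadialSol d 0 e 1 F T V U) ∧ V 0 ∈ Icc a b ∧ (∀ t, 0 ≤ t → 0 ≤ V t) ∧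
      ∀ t, 0 ≤ t → 0 ≤ hamiltonian e 1 F (V t) (U t) := by
  set C := R ^ k + η with hC
  have hFC : ∀ s, F s ≤ C := hF.le hk hR
  have hgap : 0 < (a ^ 2 - primitive F (a ^ 2)) / a ^ 2 := by
    have := sub_pos.2 hsub
    positivity
  set ρ : ℕ → ℝ := fun j => min η ((a ^ 2 - primitive F (a ^ 2)) / a ^ 2 / 2) / (j + 1) with hρdef
  have hρ0 : ∀ j, 0 < ρ j := fun j => div_pos (lt_min hη (half_pos hgap)) (by positivity)
  have hρle : ∀ j, ρ j ≤ min η ((a ^ 2 - primitive F (a ^ 2)) / a ^ 2 / 2) := fun j =>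
    div_le_self (lt_min hη (half_pos hgap)).le (by linarith [Nat.cast_nonneg (α := ℝ) j])
  have hρlim : Tendsto ρ atTop (𝓝 0) :=
    tendsto_const_nhds.div_atTop (tendsto_atTop_add_const_right _ _ tendsto_natCast_atTop_atTop)
  choose G L hL0 hGL hG0 hGC hGneg hGF using fun j =>
    exists_lipschitz_approx hFu hF.nonneg hFC hF.zero (hρ0 j)
  have hGcont : ∀ j, Continuous (G j) := by
    intro j
    refine (LipschitzWith.of_dist_le_mul (K := ⟨L j, hL0 j⟩) fun s s' => ?_).continuous
    rw [Real.dist_eq, Real.dist_eq]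
    exact hGL j s s'
  have hGadm : ∀ j, IsAdm k (2 * η) R (G j) := fun j =>
    ⟨hGcont j, hG0 j, hGneg j, fun s => by
      have h1 := hGF j s
      have h2 := hF.near s
      have h3 := (hρle j).trans (min_le_left _ _)
      rw [abs_lt] at h1
      rw [abs_le] at h2 ⊢
      constructor <;> linarith⟩
  have hGlim : TendstoUniformly G F atTop := by
    rw [Metric.tendstoUniformly_iff]
    intro r hr
    filter_upwards [hρlim.eventually (gt_mem_nhds hr)] with j hj s
    rw [dist_comm, Real.dist_eq]
    exact (hGF j s).trans hj
  have hGsub : ∀ j, primitive (G j) (a ^ 2) < a ^ 2 := by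
    intro j
    have h1 := abs_primitive_sub_le (hGcont j) hF.cont (fun s => (hGF j s).le) (a ^ 2)
    have h2 := (hρle j).trans (min_le_right _ _)
    have ha2 : 0 < a ^ 2 := by positivity
    rw [abs_of_pos ha2] at h1
    have h3 : ρ j * a ^ 2 ≤ (a ^ 2 - primitive F (a ^ 2)) / 2 := by
      calc ρ j * a ^ 2 ≤ (a ^ 2 - primitive F (a ^ 2)) / a ^ 2 / 2 * a ^ 2 :=
            mul_le_mul_of_nonneg_right h2 ha2.le
        _ = _ := by field_simp
    linarith [(abs_le.1 h1).2]
  have hTj : ∀ j : ℕ, 0 < |T₁| + (j + 1 : ℝ) := fun j => by positivity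
  have hhj : ∀ j : ℕ, 0 < h₁ / (j + 1 : ℝ) := fun j => by positivity
  choose V U hsol hinit hV hH using fun j : ℕ =>
    exists_shooting (d := d) (hhj j) (hG0 j) (hGC j) (hGneg j) (hL0 j) (hGL j) he heC (hTj j) ha
      hab (hGsub j) (fun V U hS hV0 => by
        have hle : T₁ ≤ |T₁| + (j + 1 : ℝ) := by
          linarith [le_abs_self T₁, Nat.cast_nonneg (α := ℝ) j]
        obtain ⟨t, ht, htn⟩ := hcross _ ⟨hhj j, div_le_self hh₁.le
          (by linarith [Nat.cast_nonneg (α := ℝ) j])⟩ _ (hGadm j) V U (hS.mono hle) hV0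
        exact ⟨t, ⟨ht.1, ht.2.trans hle⟩, htn⟩)
  have hTlim : Tendsto (fun j : ℕ => |T₁| + (j + 1 : ℝ)) atTop atTop :=
    tendsto_atTop_add_const_left _ _
      (tendsto_atTop_add_const_right _ _ tendsto_natCast_atTop_atTop)
  have hhlim : Tendsto (fun j : ℕ => h₁ / (j + 1 : ℝ)) atTop (𝓝 0) :=
    tendsto_const_nhds.div_atTop (tendsto_atTop_add_const_right _ _ tendsto_natCast_atTop_atTop)
  obtain ⟨φ, hφ, V', U', hsol', hlim⟩ := exists_limit_sol (e := fun _ => e) (μ := fun _ => 1)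
    (A := b) hsol (fun j => (hhj j).le) hhlim hGcont hG0 hGC (fun _ => he)
    (fun _ => by linarith) tendsto_const_nhds (fun _ => zero_le_one) (fun _ => le_rfl)
    tendsto_const_nhds (fun j => (hTj j).le) hTlim (fun j => by
      rw [abs_of_nonneg (ha.le.trans (hinit j).1)]; exact (hinit j).2) hF.cont hGlim
  have hφlim := hφ.tendsto_atTop
  have hev : ∀ t : ℝ, 0 ≤ t → ∀ᶠ j in atTop, t ∈ Icc 0 (|T₁| + ((φ j : ℕ) + 1 : ℝ)) := fun t ht =>
    ((hTlim.comp hφlim).eventually (eventually_ge_atTop t)).mono fun j hj => ⟨ht, hj⟩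
  refine ⟨V', U', hsol', ?_, fun t ht => ?_, fun t ht => ?_⟩
  · exact isClosed_Icc.mem_of_tendsto (hlim 0 le_rfl).1 (Eventually.of_forall fun j => hinit (φ j))
  · exact ge_of_tendsto (hlim t ht).1 ((hev t ht).mono fun j hj => hV (φ j) t hj)
  · have hGlim' : TendstoUniformly (fun j => G (φ j)) F atTop := fun u hu =>
      hφlim.eventually (hGlim u hu)
    exact ge_of_tendsto (tendsto_hamiltonian (fun j => hGcont (φ j)) hF.cont hGlim'
      tendsto_const_nhds tendsto_const_nhds (hlim t ht).1 (hlim t ht).2)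
      ((hev t ht).mono fun j hj => hH (φ j) t hj)

section EmdenFowler

variable {d : ℕ} {V U : ℝ → ℝ}

theorem not_log_decay {δ t₀ : ℝ} (hδ : 0 < δ) (ht₀ : 0 < t₀)
    (hd : ∀ t, 0 < t → HasDerivAt V (-U t) t) (hV : ∀ t, 0 < t → 0 ≤ V t)
    (hU : ∀ t, t₀ ≤ t → δ ≤ t * U t) : False := by
  have hanti : AntitoneOn (fun t => V t + δ * Real.log t) (Ici t₀) := by
    have hder : ∀ t, 0 < t → HasDerivAt (fun t => V t + δ * Real.log t) (-U t + δ * t⁻¹) t :=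
      fun t ht => (hd t ht).add ((Real.hasDerivAt_log ht.ne').const_mul δ)
    refine antitoneOn_of_deriv_nonpos (convex_Ici t₀)
      (fun t ht => (hder t (ht₀.trans_le ht)).continuousAt.continuousWithinAt) ?_ ?_
    · rw [interior_Ici]
      exact fun t ht => (hder t (ht₀.trans ht)).differentiableAt.differentiableWithinAt
    · rw [interior_Ici]
      intro t ht
      have ht0 : 0 < t := ht₀.trans ht
      rw [(hder t ht0).deriv]
      have h1 := hU t (le_of_lt ht)
      have h2 : δ * t⁻¹ ≤ U t := by
        rw [← div_eq_mul_inv, div_le_iff₀ ht0]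
        linarith
      linarith
  have hlim : Tendsto (fun t => δ * Real.log t) atTop atTop :=
    Real.tendsto_log_atTop.const_mul_atTop hδ
  obtain ⟨t, ht1, ht2⟩ := ((hlim.eventually (eventually_gt_atTop (V t₀ + δ * Real.log t₀))).and
    (eventually_ge_atTop t₀)).exists
  have h1 := hanti self_mem_Ici ht2 ht2
  have h2 := hV t (ht₀.trans_le ht2)
  simp only at h1
  linarith

/-- A radial solution vanishing at an interior time keeps no constant sign. -/
theorem IsRadialSol.pos_of_nonneg {h e μ C : ℝ} {F : ℝ → ℝ}
    (hS : ∀ T, IsRadialSol d h e μ F T V U) (hh : 0 ≤ h)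
    (hF0 : ∀ s, 0 ≤ F s) (hFC : ∀ s, F s ≤ C) (he : 0 ≤ e) (heC : e * C ≤ 1 / 2)
    (hμ0 : 0 ≤ μ) (hμ1 : μ ≤ 1) (h0 : 0 < V 0) (hV : ∀ t, 0 ≤ t → 0 ≤ V t) :
    ∀ t, 0 ≤ t → 0 < V t := by
  intro t ht
  rcases ht.eq_or_lt with rfl | ht
  · exact h0
  refine lt_of_le_of_ne (hV t ht.le) fun hzero => ?_
  have hmin : IsLocalMin V t := by
    filter_upwards [lt_mem_nhds ht] with s hs
    rw [← hzero]
    exact hV s hs.le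
  have hd := hmin.hasDerivAt_eq_zero ((hS (t + 1)).derivV t ⟨ht, lt_add_one t⟩)
  have h1 : e * F (V t ^ 2 - e * U t ^ 2) ≤ 1 / 2 :=
    (mul_le_mul_of_nonneg_left (hFC _) he).trans heC
  rcases mul_eq_zero.1 (neg_eq_zero.1 hd) with h2 | h2
  · linarith
  · exact h0.ne' ((hS t).init_eq_zero_of_zero hh hF0 hFC he (by linarith) hμ0 hμ1 ht le_rfl
      hzero.symm h2)

theorem le_of_radial_source {h T c : ℝ} {g : ℝ → ℝ} (hh : 0 ≤ h)
    (hc : ContinuousOn U (Icc 0 T)) (h0 : U 0 = 0)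
    (hd : ∀ t ∈ Ioo 0 T, HasDerivAt U (g t - d / (t + h) * U t) t) (hc0 : 0 ≤ c)
    (hg : ∀ t ∈ Ioo 0 T, c ≤ g t) : ∀ t ∈ Icc 0 T, c * t / (d + 1) ≤ U t := by
  intro t ht
  have hd1 : (0 : ℝ) < d + 1 := by positivity
  have key := nonneg_of_radial_source (d := d) (U := fun t => U t - c * t / (d + 1))
    (g := fun t => g t - c / (d + 1) - d / (t + h) * (c * t / (d + 1))) hh (by fun_prop)
    (by simp [h0]) (fun t ht => ?_) (fun t ht => ?_) t ht
  · linarith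
  · have h1 : HasDerivAt (fun t => c * t / (d + 1)) (c / (d + 1)) t := by
      simpa using ((hasDerivAt_id t).const_mul c).div_const ((d : ℝ) + 1)
    refine ((hd t ht).sub h1).congr_deriv ?_
    ring
  · have ht0 : 0 < t + h := by linarith [ht.1]
    have h1 : d / (t + h) * (c * t / (d + 1)) ≤ d * (c / (d + 1)) := by
      have : t / (t + h) ≤ 1 := (div_le_one ht0).2 (by linarith)
      calc d / (t + h) * (c * t / (d + 1)) = d * (c / (d + 1)) * (t / (t + h)) := by
            field_simp
        _ ≤ d * (c / (d + 1)) * 1 := mul_le_mul_of_nonneg_left this (by positivity)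
        _ = _ := mul_one _
    have h2 : c / (d + 1) + d * (c / (d + 1)) = c := by field_simp; ring
    have := hg t ht
    linarith

theorem not_nonneg_emdenFowler {k : ℝ} (hk : 0 < k) (hkd : 2 ≤ d → k < 2 / ((d : ℝ) - 1))
    (hS : ∀ T, IsRadialSol d 0 0 0 (plateau k 1) T V U) (h0 : V 0 = 1)
    (hV : ∀ t, 0 ≤ t → 0 ≤ V t) : False := by
  have hp0 : ∀ s, 0 ≤ plateau k 1 s := plateau_nonneg zero_le_one
  have hp1 : ∀ s, plateau k 1 s ≤ 1 := fun s => by simpa using plateau_le hk zero_le_one s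
  have hVpos : ∀ t, 0 ≤ t → 0 < V t := IsRadialSol.pos_of_nonneg hS le_rfl hp0 hp1 le_rfl
    (by norm_num) le_rfl zero_le_one (by rw [h0]; exact one_pos) hV
  have hdV : ∀ t, 0 < t → HasDerivAt V (-U t) t := fun t ht => by
    simpa using (hS (t + 1)).derivV t ⟨ht, lt_add_one t⟩
  have hdU' : ∀ t, 0 < t →
      HasDerivAt U (plateau k 1 (V t ^ 2) * V t - d / (t + 0) * U t) t := fun t ht => by
    simpa using (hS (t + 1)).derivU t ⟨ht, lt_add_one t⟩
  have hcU : ∀ T, ContinuousOn U (Icc 0 T) := fun T => (hS T).contU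
  have hcV : ∀ T, ContinuousOn V (Icc 0 T) := fun T => (hS T).contV
  have hU0 : U 0 = 0 := (hS 0).init
  have hUnn : ∀ t, 0 ≤ t → 0 ≤ U t := fun t ht =>
    nonneg_of_radial_source le_rfl (hcU t) hU0 (fun s hs => hdU' s hs.1)
      (fun s hs => mul_nonneg (hp0 _) (hV s hs.1.le)) t ⟨ht, le_rfl⟩
  have hVanti : ∀ s t, 0 ≤ s → s ≤ t → V t ≤ V s := fun s t hs hst =>
    antitoneOn_Icc_of_hasDerivAt (hcV t) (fun x hx => hdV x hx.1)
      (fun x hx => neg_nonpos.2 (hUnn x hx.1.le)) ⟨hs, hst⟩ ⟨hs.trans hst, le_rfl⟩ hst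
  have hV1 : ∀ t, 0 ≤ t → V t ≤ 1 := fun t ht => h0 ▸ hVanti 0 t le_rfl ht
  have hpw : ∀ t, 0 ≤ t → plateau k 1 (V t ^ 2) = (V t ^ 2) ^ k := fun t ht =>
    plateau_of_mem ⟨sq_nonneg _, pow_le_one₀ (hV t ht) (hV1 t ht)⟩
  have hdU : ∀ t, 0 < t → HasDerivAt U ((V t ^ 2) ^ k * V t - d / t * U t) t := fun t ht => by
    simpa [hpw t ht.le] using hdU' t ht
  have hUlow : ∀ t, 0 ≤ t → (V t ^ 2) ^ k * V t * t / (d + 1) ≤ U t := by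
    intro t ht
    refine le_of_radial_source le_rfl (hcU t) hU0 (fun s hs => hdU' s hs.1)
      (mul_nonneg (Real.rpow_nonneg (sq_nonneg _) _) (hV t ht)) (fun s hs => ?_) t ⟨ht, le_rfl⟩
    rw [hpw s hs.1.le]
    have h1 := hVanti s t hs.1.le hs.2.le
    have h2 := hV t ht
    gcongr
  have hUpos : ∀ t, 0 < t → 0 < U t := fun t ht =>
    lt_of_lt_of_le (by have := hVpos t ht.le; positivity) (hUlow t ht.le)
  rcases Nat.lt_or_ge d 2 with hd | hd
  · refine not_log_decay (hUpos 1 one_pos) one_pos hdV (fun t ht => hV t ht.le) fun t ht => ?_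
    have hmono : MonotoneOn (fun t => t ^ d * U t) (Icc 0 t) := by
      have := hcU t
      refine monotoneOn_Icc_of_hasDerivAt (f' := fun t => t ^ d * ((V t ^ 2) ^ k * V t))
        (by fun_prop) (fun s hs => ?_) (fun s hs => ?_)
      · have hs0 := hs.1
        refine ((hasDerivAt_pow d s).mul (hdU s hs0)).congr_deriv ?_
        rcases d with _ | d
        · simp
        · simp only [Nat.cast_add, Nat.cast_one, Nat.add_sub_cancel, pow_succ]
          field_simp
          ring
      · have := hV s hs.1.le
        have := hs.1
        positivity
    have h1 := hmono (show (1 : ℝ) ∈ Icc 0 t from ⟨zero_le_one, ht⟩)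
      (show t ∈ Icc 0 t from ⟨by linarith, le_rfl⟩) ht
    simp only [one_pow, one_mul] at h1
    refine h1.trans (mul_le_mul_of_nonneg_right ?_ (hUnn t (by linarith)))
    calc t ^ d ≤ t ^ 1 := pow_le_pow_right₀ ht (by omega)
      _ = t := pow_one t
  have hdR : (2 : ℝ) ≤ d := by exact_mod_cast hd
  have hsub : k * (d - 1) < 2 := by
    have := hkd hd
    rwa [lt_div_iff₀ (by linarith)] at this
  -- the quantity `(d - 1) V - t U` is nonincreasing, hence nonnegative
  have hz : ∀ t, 0 < t → t * U t ≤ (d - 1) * V t := by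
    intro t₀ ht₀
    by_contra hneg
    push Not at hneg
    have hanti : ∀ t, t₀ ≤ t → (d - 1) * V t - t * U t ≤ (d - 1) * V t₀ - t₀ * U t₀ := by
      intro t ht
      have := hcU t
      have := hcV t
      refine antitoneOn_Icc_of_hasDerivAt (f := fun t => (d - 1) * V t - t * U t)
        (f' := fun t => -(t * ((V t ^ 2) ^ k * V t))) (a := 0) (b := t) (by fun_prop)
        (fun s hs => ?_) (fun s hs => ?_) ⟨ht₀.le, ht⟩ ⟨ht₀.le.trans ht, le_rfl⟩ ht
      · have hs0 := hs.1
        refine (((hdV s hs0).const_mul _).sub ((hasDerivAt_id s).mul (hdU s hs0))).congr_deriv ?_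
        simp only [id]
        field_simp
        ring
      · have := hV s hs.1.le
        have := hs.1
        rw [neg_nonpos]
        positivity
    refine not_log_decay (δ := t₀ * U t₀ - (d - 1) * V t₀) (by linarith) ht₀ hdV
      (fun t ht => hV t ht.le) fun t ht => ?_
    have h1 := hanti t ht
    have h2 : 0 ≤ ((d : ℝ) - 1) * V t := mul_nonneg (by linarith) (hV t (ht₀.le.trans ht))
    linarith
  -- Pohozaev functional
  set E : ℝ → ℝ := fun t => (V t ^ 2) ^ (k + 1) / (2 * (k + 1)) with hE
  have hsq : ∀ t, 0 < t → HasDerivAt (fun t => V t ^ 2) (2 * V t * -U t) t := fun t ht =>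
    ((hdV t ht).pow 2).congr_deriv (by simp)
  have hsplit : ∀ t, 0 ≤ t → (V t ^ 2) ^ (k + 1) = (V t ^ 2) ^ k * V t ^ 2 := fun t ht => by
    have := hVpos t ht
    rw [Real.rpow_add (by positivity), Real.rpow_one]
  have hdE : ∀ t, 0 < t → HasDerivAt E (-((V t ^ 2) ^ k * V t * U t)) t := by
    intro t ht
    have hp := hVpos t ht.le
    have h1 := ((hsq t ht).rpow_const (p := k + 1) (Or.inl (by positivity))).div_const
      (2 * (k + 1))
    refine h1.congr_deriv ?_
    have : k + 1 - 1 = k := by ring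
    rw [this]
    field_simp
  set Q : ℝ → ℝ := fun t => t ^ (d + 1) * (U t ^ 2 / 2 + E t) - (d - 1) / 2 * (t ^ d * (V t * U t))
    with hQ
  have hdQ : ∀ t, 0 < t → HasDerivAt Q
      (t ^ d * ((V t ^ 2) ^ k * V t ^ 2 * ((d + 1) / (2 * (k + 1)) - (d - 1) / 2))) t := by
    intro t ht
    have h1 := ((hasDerivAt_pow (d + 1) t).mul
      ((((hdU t ht).pow 2).div_const 2).add (hdE t ht))).sub
      (((hasDerivAt_pow d t).mul ((hdV t ht).mul (hdU t ht))).const_mul (((d : ℝ) - 1) / 2))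
    refine h1.congr_deriv ?_
    have hEt : E t = (V t ^ 2) ^ k * V t ^ 2 / (2 * (k + 1)) := by rw [← hsplit t ht.le]
    obtain ⟨c, rfl⟩ : ∃ c, d = c + 1 := ⟨d - 1, by omega⟩
    simp only [Nat.cast_add, Nat.cast_one, Nat.add_sub_cancel, pow_succ, Nat.cast_ofNat,
      Pi.pow_apply, Pi.add_apply, Pi.mul_apply, hEt]
    generalize (V t * V t) ^ k = W
    field_simp
    ring
  have hcoef : 0 < ((d : ℝ) + 1) / (2 * (k + 1)) - (d - 1) / 2 := by
    rw [sub_pos, div_lt_div_iff₀ (by norm_num) (by positivity)]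
    nlinarith
  have hcE : ∀ T, ContinuousOn E (Icc 0 T) := fun T =>
    (((hcV T).pow 2).rpow_const fun x _ => Or.inr (by positivity)).div_const _
  have hQ0 : Q 0 = 0 := by
    have : d ≠ 0 := by omega
    simp [hQ, this]
  have hQpos : 0 < Q 1 := by
    have hst : StrictMonoOn Q (Icc 0 1) := by
      have := hcU 1
      have := hcV 1
      have := hcE 1
      refine strictMonoOn_of_deriv_pos (convex_Icc 0 1) (by fun_prop) ?_
      rw [interior_Icc]
      intro t ht
      rw [(hdQ t ht.1).deriv]
      have := hVpos t ht.1.le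
      have := ht.1
      positivity
    rw [← hQ0]
    exact hst (by simp) (by simp) one_pos
  have hQmono : ∀ t, 1 ≤ t → Q 1 ≤ Q t := by
    intro t ht
    have := hcU t
    have := hcV t
    have := hcE t
    refine monotoneOn_Icc_of_hasDerivAt (f := Q) (a := 0) (b := t) (by fun_prop)
      (fun s hs => hdQ s hs.1) (fun s hs => ?_) ⟨zero_le_one, ht⟩ ⟨by linarith, le_rfl⟩ ht
    have := hs.1
    positivity
  have hQE : ∀ t, 1 ≤ t → Q 1 ≤ t ^ (d + 1) * E t := by
    intro t ht
    have ht0 : 0 < t := by linarith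
    refine (hQmono t ht).trans ?_
    have h1 : Q t = t ^ (d + 1) * E t + t ^ d * (U t / 2) * (t * U t - (d - 1) * V t) := by
      simp only [hQ, pow_succ]; ring
    have h2 : t ^ d * (U t / 2) * (t * U t - (d - 1) * V t) ≤ 0 :=
      mul_nonpos_of_nonneg_of_nonpos (by have := hUnn t ht0.le; positivity)
        (sub_nonpos.2 (hz t ht0))
    linarith
  -- decay of `V`
  have hdecay : ∀ t, 0 < t → (V t ^ 2) ^ k ≤ (d + 1) / (k * t ^ 2) := by
    intro t ht
    have hcy : ContinuousOn (fun t => (V t ^ 2) ^ (-k)) (Icc 0 t) :=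
      ((hcV t).pow 2).rpow_const fun x hx => Or.inl (pow_pos (hVpos x hx.1) 2).ne'
    have hmono : MonotoneOn (fun t => (V t ^ 2) ^ (-k) - k * t ^ 2 / (d + 1)) (Icc 0 t) := by
      refine monotoneOn_Icc_of_hasDerivAt
        (f' := fun t => 2 * k * (V t ^ 2) ^ (-k - 1) * V t * U t - 2 * k * t / (d + 1))
        (by fun_prop) (fun s hs => ?_) (fun s hs => ?_)
      · have hp := hVpos s hs.1.le
        have h1 := ((hsq s hs.1).rpow_const (p := -k) (Or.inl (by positivity))).sub
          (((hasDerivAt_pow 2 s).const_mul k).div_const ((d : ℝ) + 1))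
        refine h1.congr_deriv ?_
        simp only [Nat.cast_ofNat, Nat.add_one_sub_one, pow_one]
        ring
      · have hp := hVpos s hs.1.le
        have hp2 : 0 < V s ^ 2 := by positivity
        have h1 := mul_le_mul_of_nonneg_left (hUlow s hs.1.le)
          (show 0 ≤ 2 * k * (V s ^ 2) ^ (-k - 1) * V s by positivity)
        have h2 : (V s ^ 2) ^ (-k - 1) * (V s ^ 2) ^ k * V s ^ 2 = 1 := by
          rw [← Real.rpow_add hp2, ← Real.rpow_add_one hp2.ne']
          ring_nf
          exact Real.rpow_zero _
        have h3 : 2 * k * (V s ^ 2) ^ (-k - 1) * V s * ((V s ^ 2) ^ k * V s * s / (d + 1))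
            = 2 * k * s / (d + 1) := by
          calc _ = 2 * k * s / (d + 1) * ((V s ^ 2) ^ (-k - 1) * (V s ^ 2) ^ k * V s ^ 2) := by ring
            _ = _ := by rw [h2, mul_one]
        linarith
    have h1 := hmono (show (0 : ℝ) ∈ Icc 0 t from ⟨le_rfl, ht.le⟩)
      (show t ∈ Icc 0 t from ⟨ht.le, le_rfl⟩) ht.le
    simp only [h0] at h1
    norm_num at h1
    have hp := hVpos t ht.le
    have hp2 : 0 < V t ^ 2 := by positivity
    have h2 : k * t ^ 2 / (d + 1) ≤ ((V t ^ 2) ^ k)⁻¹ := by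
      rw [← Real.rpow_neg hp2.le]
      linarith
    have h3 := inv_anti₀ (by positivity) h2
    rwa [inv_inv, inv_div] at h3
  have hfin : ∀ t, 1 ≤ t → Q 1 ≤ (((d : ℝ) + 1) / k) ^ ((k + 1) / k) / (2 * (k + 1))
      * t ^ (-(2 / k - (d - 1))) := by
    intro t ht
    have ht0 : 0 < t := by linarith
    refine (hQE t ht).trans ?_
    have hp := hVpos t ht0.le
    have h1 : (V t ^ 2) ^ (k + 1) ≤ ((d + 1) / k * t ^ (-2 : ℝ)) ^ ((k + 1) / k) := by
      have h2 : (V t ^ 2) ^ (k + 1) = ((V t ^ 2) ^ k) ^ ((k + 1) / k) := by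
        rw [← Real.rpow_mul (by positivity)]
        congr 1
        field_simp
      rw [h2]
      refine Real.rpow_le_rpow (by positivity) ((hdecay t ht0).trans_eq ?_) (by positivity)
      rw [Real.rpow_neg ht0.le, Real.rpow_ofNat]
      field_simp
    rw [Real.mul_rpow (by positivity) (by positivity), ← Real.rpow_mul ht0.le] at h1
    calc t ^ (d + 1) * E t ≤ t ^ (d + 1) * ((((d : ℝ) + 1) / k) ^ ((k + 1) / k)
            * t ^ (-2 * ((k + 1) / k)) / (2 * (k + 1))) := by
          simp only [hE]; gcongr
      _ = (((d : ℝ) + 1) / k) ^ ((k + 1) / k) / (2 * (k + 1))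
            * (t ^ ((d + 1 : ℕ) : ℝ) * t ^ (-2 * ((k + 1) / k))) := by
          rw [Real.rpow_natCast]; ring
      _ = _ := by
          rw [← Real.rpow_add ht0]
          congr 2
          push_cast
          field_simp
          ring
  have hexp : 0 < 2 / k - ((d : ℝ) - 1) := by
    rw [sub_pos, lt_div_iff₀ hk]
    linarith
  have hlim := (tendsto_rpow_neg_atTop hexp).const_mul
    ((((d : ℝ) + 1) / k) ^ ((k + 1) / k) / (2 * (k + 1)))
  rw [mul_zero] at hlim
  have := ge_of_tendsto hlim ((eventually_ge_atTop 1).mono hfin)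
  linarith

end EmdenFowler

theorem IsRadialSol.rescale {d : ℕ} {h e μ T a b : ℝ} {F V U : ℝ → ℝ} (ha : 0 < a) (hb : 0 < b)
    (hS : IsRadialSol d h e μ F T V U) :
    IsRadialSol d (h * a) (e * a ^ 2) (μ / a ^ 2) (fun s => F (b ^ 2 * s) / a ^ 2) (T * a)
      (fun τ => V (τ / a) / b) (fun τ => U (τ / a) / (a * b)) := by
  have hmaps : MapsTo (fun τ => τ / a) (Icc 0 (T * a)) (Icc 0 T) := fun τ hτ =>
    ⟨div_nonneg hτ.1 ha.le, (div_le_iff₀ ha).2 hτ.2⟩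
  have hmaps' : MapsTo (fun τ => τ / a) (Ioo 0 (T * a)) (Ioo 0 T) := fun τ hτ =>
    ⟨div_pos hτ.1 ha, (div_lt_iff₀ ha).2 hτ.2⟩
  have hdiv : ∀ τ, HasDerivAt (fun τ : ℝ => τ / a) (1 / a) τ := fun τ =>
    (hasDerivAt_id τ).div_const a
  have harg : ∀ x y : ℝ, b ^ 2 * ((x / b) ^ 2 - e * a ^ 2 * (y / (a * b)) ^ 2)
      = x ^ 2 - e * y ^ 2 := fun x y => by field_simp
  refine ⟨(hS.contV.comp (by fun_prop) hmaps).div_const b,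
    (hS.contU.comp (by fun_prop) hmaps).div_const _, by simp [hS.init], fun τ hτ => ?_,
    fun τ hτ => ?_⟩
  · refine (((hS.derivV _ (hmaps' hτ)).comp τ (hdiv τ)).div_const b).congr_deriv ?_
    rw [harg]
    field_simp
  · refine (((hS.derivU _ (hmaps' hτ)).comp τ (hdiv τ)).div_const (a * b)).congr_deriv ?_
    rw [harg]
    have h1 : τ / a + h = (τ + h * a) / a := by field_simp
    rw [h1]
    field_simp

theorem plateau_sq_mul {k b : ℝ} (hb : 0 < b) (s : ℝ) :
    plateau k (b ^ 2) (b ^ 2 * s) = (b ^ k) ^ 2 * plateau k 1 s := by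
  have hb2 : 0 < b ^ 2 := by positivity
  have h1 : min (max (b ^ 2 * s) 0) (b ^ 2) = b ^ 2 * min (max s 0) 1 := by
    rw [mul_min_of_nonneg _ _ hb2.le, mul_max_of_nonneg _ _ hb2.le, mul_zero, mul_one]
  rw [plateau, h1, Real.mul_rpow hb2.le (le_min (le_max_right _ _) zero_le_one), plateau]
  congr 1
  rw [← Real.rpow_natCast, ← Real.rpow_natCast, ← Real.rpow_mul hb.le, ← Real.rpow_mul hb.le,
    mul_comm]

theorem exists_crossing {d : ℕ} {k : ℝ} (hk : 0 < k) (hkd : 2 ≤ d → k < 2 / ((d : ℝ) - 1))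
    (b₀ : ℝ) : ∃ b, b₀ ≤ b ∧ 1 ≤ b ∧ ∃ e₁ > 0, ∃ h₁ > 0, ∃ T₁ : ℝ, ∀ e ∈ Icc 0 e₁,
      ∀ h ∈ Ioc 0 h₁, ∀ F, IsAdm k 1 (b ^ 2) F → ∀ V U, IsRadialSol d h e 1 F T₁ V U →
        V 0 = b → ∃ t ∈ Icc 0 T₁, V t < 0 := by
  by_contra hcon
  push Not at hcon
  set b : ℕ → ℝ := fun j => |b₀| + (j + 1) with hbdef
  have hb1 : ∀ j, 1 ≤ b j := fun j => by
    have := abs_nonneg b₀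
    have := Nat.cast_nonneg (α := ℝ) j
    simp only [hbdef]
    linarith
  have hbpos : ∀ j, 0 < b j := fun j => by linarith [hb1 j]
  have hb0 : ∀ j, b₀ ≤ b j := fun j => by
    have := le_abs_self b₀
    have := Nat.cast_nonneg (α := ℝ) j
    simp only [hbdef]
    linarith
  set a : ℕ → ℝ := fun j => b j ^ k with hadef
  have ha1 : ∀ j, 1 ≤ a j := fun j => Real.one_le_rpow (hb1 j) hk.le
  have hapos : ∀ j, 0 < a j := fun j => by linarith [ha1 j]
  have hblim : Tendsto b atTop atTop := tendsto_atTop_add_const_left _ _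
    (tendsto_atTop_add_const_right _ _ tendsto_natCast_atTop_atTop)
  have halim : Tendsto a atTop atTop := (tendsto_rpow_atTop hk).comp hblim
  have hj : ∀ j : ℕ, (0 : ℝ) < j + 1 := fun j => by positivity
  choose e he h hh F hF V U hS hV0 hV using fun j : ℕ =>
    hcon (b j) (hb0 j) (hb1 j) (1 / (2 * (j + 1) * a j ^ 2))
      (by have := hapos j; have := hj j; positivity)
      (1 / ((j + 1) * a j)) (by have := hapos j; have := hj j; positivity) (j + 1)
  have hinv : Tendsto (fun j => 1 / a j ^ 2) atTop (𝓝 0) :=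
    tendsto_const_nhds.div_atTop ((tendsto_pow_atTop two_ne_zero).comp halim)
  have hone : Tendsto (fun j : ℕ => 1 / (j + 1 : ℝ)) atTop (𝓝 0) :=
    tendsto_one_div_add_atTop_nhds_zero_nat
  have hinv1 : ∀ j, 1 / a j ^ 2 ≤ 1 := fun j => by
    rw [div_le_one (by have := hapos j; positivity)]
    exact one_le_pow₀ (ha1 j)
  have hh' : ∀ j, h j * a j ≤ 1 / (j + 1) := fun j => by
    have := hapos j
    have := hj j
    calc h j * a j ≤ 1 / ((j + 1) * a j) * a j :=
          mul_le_mul_of_nonneg_right (hh j).2 (hapos j).le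
      _ = _ := by field_simp
  have he' : ∀ j, e j * a j ^ 2 ≤ 1 / 2 * (1 / (j + 1)) := fun j => by
    have := hapos j
    have := hj j
    calc e j * a j ^ 2 ≤ 1 / (2 * (j + 1) * a j ^ 2) * a j ^ 2 :=
          mul_le_mul_of_nonneg_right (he j).2 (by positivity)
      _ = _ := by field_simp
  have hnear : ∀ j s, |F j (b j ^ 2 * s) / a j ^ 2 - plateau k 1 s| ≤ 1 / a j ^ 2 := by
    intro j s
    have h1 := (hF j).near (b j ^ 2 * s)
    rw [plateau_sq_mul (hbpos j)] at h1
    have ha2 : 0 < a j ^ 2 := by have := hapos j; positivity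
    have h2 : F j (b j ^ 2 * s) / a j ^ 2 - plateau k 1 s
        = (F j (b j ^ 2 * s) - a j ^ 2 * plateau k 1 s) / a j ^ 2 := by
      rw [sub_div, mul_div_cancel_left₀ _ ha2.ne']
    rw [h2, abs_div, abs_of_pos ha2]
    gcongr
  have hp1 : ∀ s, plateau k 1 s ≤ 1 := fun s => by simpa using plateau_le hk zero_le_one s
  obtain ⟨φ, hφ, V', U', hsol, hlim⟩ := exists_limit_sol (d := d) (C := 2) (A := 1) (e' := 0)
    (μ' := 0) (F' := plateau k 1) (fun j => (hS j).rescale (hapos j) (hbpos j))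
    (fun j => mul_nonneg (hh j).1.le (hapos j).le)
    (squeeze_zero (fun j => mul_nonneg (hh j).1.le (hapos j).le) hh' hone)
    (fun j => ((hF j).cont.comp (by fun_prop)).div_const _)
    (fun j s => div_nonneg ((hF j).nonneg _) (by positivity))
    (fun j s => by linarith [(abs_le.1 (hnear j s)).2, hp1 s, hinv1 j])
    (fun j => mul_nonneg (he j).1 (by positivity))
    (fun j => by
      have h1 : 1 / (j + 1 : ℝ) ≤ 1 := by
        rw [div_le_one (hj j)]
        linarith [Nat.cast_nonneg (α := ℝ) j]
      linarith [he' j])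
    (squeeze_zero (fun j => mul_nonneg (he j).1 (by positivity)) he'
      (by have := hone.const_mul (1 / 2); rwa [mul_zero] at this))
    (fun j => by positivity) hinv1 hinv
    (fun j => mul_nonneg (hj j).le (hapos j).le)
    (tendsto_atTop_mono (fun j : ℕ => show (j : ℝ) ≤ (j + 1) * a j by
      nlinarith [ha1 j, hj j]) tendsto_natCast_atTop_atTop)
    (fun j => by simp [hV0, (hbpos j).ne'])
    (continuous_plateau hk 1)
    (by
      rw [Metric.tendstoUniformly_iff]
      intro r hr
      filter_upwards [hinv.eventually (gt_mem_nhds hr)] with j hjr s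
      rw [dist_comm, Real.dist_eq]
      exact (hnear j s).trans_lt hjr)
  refine not_nonneg_emdenFowler hk hkd hsol ?_ fun t ht => ?_
  · refine tendsto_nhds_unique (hlim 0 le_rfl).1 ?_
    have : (fun j => V (φ j) (0 / a (φ j)) / b (φ j)) = fun _ => (1 : ℝ) := by
      ext j
      simp [hV0, (hbpos _).ne']
    rw [this]
    exact tendsto_const_nhds
  · refine ge_of_tendsto (hlim t ht).1 ?_
    filter_upwards [(tendsto_natCast_atTop_atTop (R := ℝ)).comp hφ.tendsto_atTop
      |>.eventually (eventually_ge_atTop t)] with j hjt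
    refine div_nonneg (hV (φ j) _ ⟨div_nonneg ht (hapos _).le, ?_⟩) (hbpos _).le
    simp only [Function.comp] at hjt
    calc t / a (φ j) ≤ t := div_le_self ht (ha1 _)
      _ ≤ (φ j : ℝ) + 1 := by linarith

theorem primitive_plateau {k R s : ℝ} (hk : 0 < k) (hs : s ∈ Icc 0 R) :
    primitive (plateau k R) s = s ^ (k + 1) / (k + 1) := by
  unfold primitive
  rw [intervalIntegral.integral_congr (g := fun x => x ^ k)]
  · rw [integral_rpow (Or.inl (by linarith)), Real.zero_rpow (by linarith), sub_zero]
  · intro x hx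
    rw [uIcc_of_le hs.1] at hx
    exact plateau_of_mem ⟨hx.1, hx.2.trans hs.2⟩

namespace IsAdm

variable {k η R : ℝ} {F : ℝ → ℝ}

theorem primitive_le (hF : IsAdm k η R F) (hk : 0 < k) {s : ℝ} (hs : s ∈ Icc 0 R) :
    primitive F s ≤ s ^ (k + 1) / (k + 1) + η * s := by
  have h1 := abs_primitive_sub_le hF.cont (continuous_plateau hk R) hF.near s
  rw [primitive_plateau hk hs, abs_of_nonneg hs.1] at h1
  linarith [(abs_le.1 h1).2]

theorem subcritical (hF : IsAdm k η R F) (hk : 0 < k) (hη : η < 1 / 2) {s : ℝ} (hs : s ∈ Ioc 0 R)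
    (hsk : s ^ k = 1 / 2) : primitive F s < s := by
  have h1 := hF.primitive_le hk ⟨hs.1.le, hs.2⟩
  have h2 : s ^ (k + 1) / (k + 1) ≤ 1 / 2 * s := by
    rw [Real.rpow_add_one hs.1.ne', hsk]
    exact div_le_self (by linarith [hs.1]) (by linarith)
  nlinarith [hs.1]

theorem one_lt_of_le_primitive (hF : IsAdm k η R F) (hk : 0 < k) (hη : η * (k + 2) < k)
    (hR0 : 0 ≤ R) (hR : 2 ≤ R ^ k) {s : ℝ} (hs : 0 < s) (h : s ≤ primitive F s) : 1 < F s := by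
  have hnear := (abs_le.1 (hF.near s)).1
  rcases le_total s R with hsR | hsR
  · rw [plateau_of_mem ⟨hs.le, hsR⟩] at hnear
    have h1 := hF.primitive_le hk ⟨hs.le, hsR⟩
    rw [Real.rpow_add_one hs.ne'] at h1
    have h2 : s * (1 - η) ≤ s * (s ^ k / (k + 1)) := by
      have : s ^ k * s / (k + 1) = s * (s ^ k / (k + 1)) := by ring
      linarith
    have h3 := le_of_mul_le_mul_left h2 hs
    rw [le_div_iff₀ (by linarith)] at h3
    nlinarith
  · rw [plateau_of_le hR0 hsR] at hnear
    have : η < 1 := by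
      by_contra hcon
      push Not at hcon
      nlinarith
    linarith

end IsAdm

/-- A nonnegative global solution with nonnegative Hamiltonian. -/
structure IsProfile (d : ℕ) (k η a b e : ℝ) (F V U : ℝ → ℝ) : Prop where
  adm : IsAdm k η (b ^ 2) F
  small : η * (k + 2) < k
  enn : 0 ≤ e
  ele : e * ((b ^ 2) ^ k + 1) ≤ 1 / 2
  sol : ∀ T, IsRadialSol d 0 e 1 F T V U
  init : V 0 ∈ Icc a b
  nonneg : ∀ t, 0 ≤ t → 0 ≤ V t
  ham : ∀ t, 0 ≤ t → 0 ≤ hamiltonian e 1 F (V t) (U t)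

namespace IsProfile

variable {d : ℕ} {k η a b e : ℝ} {F V U : ℝ → ℝ}

theorem F_le (hP : IsProfile d k η a b e F V U) (hk : 0 < k) (s : ℝ) :
    F s ≤ (b ^ 2) ^ k + 1 := by
  have h1 := hP.adm.le hk (sq_nonneg b) s
  have h2 := hP.small
  have : η < 1 := by
    by_contra hcon
    push Not at hcon
    nlinarith
  linarith

theorem eF_le (hP : IsProfile d k η a b e F V U) (hk : 0 < k) (s : ℝ) : e * F s ≤ 1 / 2 :=
  (mul_le_mul_of_nonneg_left (hP.F_le hk s) hP.enn).trans hP.ele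

theorem V_pos (hP : IsProfile d k η a b e F V U) (hk : 0 < k) (ha : 0 < a) :
    ∀ t, 0 ≤ t → 0 < V t :=
  IsRadialSol.pos_of_nonneg hP.sol le_rfl hP.adm.nonneg (hP.F_le hk) hP.enn hP.ele zero_le_one
    le_rfl (ha.trans_le hP.init.1) hP.nonneg

theorem hasDerivAt_V (hP : IsProfile d k η a b e F V U) {t : ℝ} (ht : 0 < t) :
    HasDerivAt V (-((1 - e * F (V t ^ 2 - e * U t ^ 2)) * U t)) t :=
  (hP.sol (t + 1)).derivV t ⟨ht, lt_add_one t⟩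

theorem hasDerivAt_U (hP : IsProfile d k η a b e F V U) {t : ℝ} (ht : 0 < t) :
    HasDerivAt U ((F (V t ^ 2 - e * U t ^ 2) - 1) * V t - d / t * U t) t := by
  simpa using (hP.sol (t + 1)).derivU t ⟨ht, lt_add_one t⟩

theorem one_lt_of_U_eq_zero (hP : IsProfile d k η a b e F V U) (hk : 0 < k) (ha : 0 < a)
    (hR : 2 ≤ (b ^ 2) ^ k) {t : ℝ} (ht : 0 ≤ t) (hU : U t = 0) : 1 < F (V t ^ 2) := by
  have hV := hP.V_pos hk ha t ht
  refine hP.adm.one_lt_of_le_primitive hk hP.small (sq_nonneg b) hR (by positivity) ?_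
  have h1 := hP.ham t ht
  unfold hamiltonian at h1
  rw [hU] at h1
  norm_num at h1
  exact h1

theorem U_pos (hP : IsProfile d k η a b e F V U) (hk : 0 < k) (ha : 0 < a)
    (hR : 2 ≤ (b ^ 2) ^ k) : ∀ t, 0 < t → 0 < U t := by
  have hU0 : U 0 = 0 := (hP.sol 0).init
  have hder : ∀ t, 0 < t → U t = 0 → 0 < (F (V t ^ 2 - e * U t ^ 2) - 1) * V t - d / t * U t := by
    intro t ht h0
    have h1 := hP.one_lt_of_U_eq_zero hk ha hR ht.le h0
    have h2 := hP.V_pos hk ha t ht.le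
    simp only [h0]
    norm_num
    exact mul_pos (sub_pos.2 h1) h2
  obtain ⟨τ, hτ, hstart⟩ : ∃ τ > 0, ∀ t ∈ Ioc 0 τ, 0 < U t := by
    have hcV := (hP.sol 1).contV
    have hcU := (hP.sol 1).contU
    have hg : ContinuousOn (fun t => (F (V t ^ 2 - e * U t ^ 2) - 1) * V t) (Icc 0 1) :=
      ((hP.adm.cont.comp_continuousOn (by fun_prop)).sub continuousOn_const).mul hcV
    set g₀ := (F (V 0 ^ 2) - 1) * V 0 with hg₀
    have hg₀pos : 0 < g₀ := mul_pos
      (sub_pos.2 (hP.one_lt_of_U_eq_zero hk ha hR le_rfl hU0)) (hP.V_pos hk ha 0 le_rfl)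
    have hlim : Tendsto (fun t => (F (V t ^ 2 - e * U t ^ 2) - 1) * V t) (𝓝[Icc 0 1] 0)
        (𝓝 g₀) := by
      have := hg 0 ⟨le_rfl, zero_le_one⟩
      unfold ContinuousWithinAt at this
      simpa [hU0] using this
    have hev := hlim.eventually (lt_mem_nhds (half_lt_self hg₀pos))
    obtain ⟨ρ, hρ, hρb⟩ := Metric.mem_nhdsWithin_iff.1 hev
    refine ⟨min (ρ / 2) 1, by positivity, fun t ht => ?_⟩
    have hlow := le_of_radial_source (d := d) (c := g₀ / 2) (T := t) le_rfl (hP.sol t).contU hU0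
      (fun s hs => (hP.sol t).derivU s hs) (half_pos hg₀pos).le (fun s hs => ?_) t ⟨ht.1.le, le_rfl⟩
    · refine lt_of_lt_of_le ?_ hlow
      have := ht.1
      positivity
    · have h1 : t ≤ ρ / 2 := ht.2.trans (min_le_left _ _)
      have h2 : t ≤ 1 := ht.2.trans (min_le_right _ _)
      have hmem : s ∈ Metric.ball (0 : ℝ) ρ ∩ Icc 0 1 := by
        refine ⟨?_, hs.1.le, hs.2.le.trans h2⟩
        rw [Metric.mem_ball, Real.dist_eq, sub_zero, abs_of_pos hs.1]
        linarith [hs.2]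
      exact le_of_lt (hρb hmem)
  have hnn : ∀ t, τ ≤ t → 0 ≤ U t := by
    intro t ht
    have := image_le_of_deriv_right_lt_deriv_boundary' (f := fun t => -U t)
      (f' := fun t => -((F (V t ^ 2 - e * U t ^ 2) - 1) * V t - d / t * U t)) (a := τ) (b := t)
      (((hP.sol t).contU.mono (Icc_subset_Icc_left hτ.le)).neg)
      (fun x hx => (hP.hasDerivAt_U (hτ.trans_le hx.1)).neg.hasDerivWithinAt)
      (B := fun _ => 0) (B' := fun _ => 0) (by linarith [hstart τ ⟨hτ, le_rfl⟩])
      continuousOn_const (fun x _ => hasDerivWithinAt_const _ _ _)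
      (fun x hx h0 => neg_neg_iff_pos.2 (hder x (hτ.trans_le hx.1) (neg_eq_zero.1 h0)))
      (x := t) ⟨ht, le_rfl⟩
    linarith
  intro t ht
  rcases le_or_gt t τ with htτ | htτ
  · exact hstart t ⟨ht, htτ⟩
  · refine lt_of_le_of_ne (hnn t htτ.le) fun h0 => ?_
    have hmin : IsLocalMin U t := by
      filter_upwards [lt_mem_nhds htτ] with s hs
      rw [← h0]
      exact hnn s hs.le
    have h1 := hmin.hasDerivAt_eq_zero (hP.hasDerivAt_U ht)
    exact (hder t ht h0.symm).ne' h1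

theorem U_nonneg (hP : IsProfile d k η a b e F V U) (hk : 0 < k) (ha : 0 < a)
    (hR : 2 ≤ (b ^ 2) ^ k) (t : ℝ) (ht : 0 ≤ t) : 0 ≤ U t := by
  rcases ht.eq_or_lt with rfl | h
  · exact (hP.sol 0).init.ge
  · exact (hP.U_pos hk ha hR t h).le

theorem V_anti (hP : IsProfile d k η a b e F V U) (hk : 0 < k) (ha : 0 < a)
    (hR : 2 ≤ (b ^ 2) ^ k) {s t : ℝ} (hs : 0 ≤ s) (hst : s ≤ t) : V t ≤ V s := by
  refine antitoneOn_Icc_of_hasDerivAt (hP.sol t).contV (fun x hx => hP.hasDerivAt_V hx.1)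
    (fun x hx => ?_) ⟨hs, hst⟩ ⟨hs.trans hst, le_rfl⟩ hst
  have h1 := hP.eF_le hk (V x ^ 2 - e * U x ^ 2)
  have h2 := hP.U_nonneg hk ha hR x hx.1.le
  rw [neg_nonpos]
  exact mul_nonneg (by linarith) h2

theorem V_le (hP : IsProfile d k η a b e F V U) (hk : 0 < k) (ha : 0 < a)
    (hR : 2 ≤ (b ^ 2) ^ k) (t : ℝ) (ht : 0 ≤ t) : V t ≤ b :=
  (hP.V_anti hk ha hR le_rfl ht).trans hP.init.2

theorem U_sq_le (hP : IsProfile d k η a b e F V U) (hk : 0 < k) (ha : 0 < a)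
    (hR : 2 ≤ (b ^ 2) ^ k) (t : ℝ) (ht : 0 ≤ t) : U t ^ 2 ≤ ((b ^ 2) ^ k + 2) * b ^ 2 := by
  have h1 := (hP.sol t).antitoneOn_hamiltonian le_rfl hP.adm.cont
    (fun s => (hP.eF_le hk s).trans (by norm_num)) ⟨le_rfl, ht⟩ ⟨ht, le_rfl⟩ ht
  simp only [hamiltonian, (hP.sol t).init] at h1
  have h2 := primitive_nonneg hP.adm.nonneg hP.adm.zero (V t ^ 2 - e * U t ^ 2)
  have h3 := hP.V_le hk ha hR t ht
  have h4 := hP.nonneg t ht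
  have h5 : primitive F (V 0 ^ 2) ≤ ((b ^ 2) ^ k + 1) * V 0 ^ 2 := by
    have := abs_primitive_sub_primitive_le hP.adm.cont
      (fun s => (abs_of_nonneg (hP.adm.nonneg s)).trans_le (hP.F_le hk s)) (V 0 ^ 2) 0
    rw [primitive_eq_zero hP.adm.zero le_rfl, sub_zero, sub_zero,
      abs_of_nonneg (sq_nonneg (V 0))] at this
    exact (le_abs_self _).trans this
  have h6 := hP.init
  have h7 : V 0 ^ 2 ≤ b ^ 2 := by nlinarith [h6.1, h6.2]
  have h8 : V t ^ 2 ≤ b ^ 2 := by nlinarith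
  have h9 : ((b ^ 2) ^ k + 1) * V 0 ^ 2 ≤ ((b ^ 2) ^ k + 1) * b ^ 2 :=
    mul_le_mul_of_nonneg_left h7 (by linarith)
  norm_num at h1
  nlinarith [sq_nonneg (V 0)]

end IsProfile

/-- Bounds on profiles that do not depend on the parameter nor on the nonlinearity. -/
theorem exists_profile_bounds (d : ℕ) {k a b : ℝ} (hk : 0 < k) (ha : 0 < a) (hab : a ≤ b)
    (hR : 2 ≤ (b ^ 2) ^ k) : ∃ B > 0, ∃ M ≥ 1, ∀ η e F V U, IsProfile d k η a b e F V U →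
      ∀ t, 0 ≤ t → U t ≤ B ∧ U t ≤ M * V t := by
  have hb : 0 < b := ha.trans_le hab
  set B := Real.sqrt (((b ^ 2) ^ k + 2) * b ^ 2) with hB
  have hBpos : 0 < B := Real.sqrt_pos.2 (by positivity)
  set t₁ := a / (2 * B) with ht₁
  have ht₁pos : 0 < t₁ := by positivity
  set M := max (2 * B / a) (2 * (d / t₁ + 2)) with hM
  have hM1 : 2 * (d / t₁ + 2) ≤ M := le_max_right _ _
  have hd0 : 0 ≤ d / t₁ := by positivity
  have hMpos : 1 ≤ M := by linarith
  refine ⟨B, hBpos, M, hMpos, fun η e F V U hP => ?_⟩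
  have hUB : ∀ t, 0 ≤ t → U t ≤ B := fun t ht => Real.le_sqrt_of_sq_le (hP.U_sq_le hk ha hR t ht)
  have hUM : ∀ t ∈ Icc 0 t₁, U t ≤ M * V t := by
    intro t ht
    have h1 := abs_sub_le_of_hasDerivAt (K := B) (hP.sol t).contV
      (fun s hs => hP.hasDerivAt_V hs.1) (fun s hs => by
        have h1 := hP.eF_le hk (V s ^ 2 - e * U s ^ 2)
        have h2 := hP.U_nonneg hk ha hR s hs.1.le
        have h3 : 0 ≤ e * F (V s ^ 2 - e * U s ^ 2) := mul_nonneg hP.enn (hP.adm.nonneg _)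
        rw [abs_neg, abs_of_nonneg (mul_nonneg (by linarith) h2)]
        nlinarith [hUB s hs.1.le]) 0 ⟨le_rfl, ht.1⟩ t ⟨ht.1, le_rfl⟩
    rw [zero_sub, abs_neg, abs_of_nonneg ht.1] at h1
    have h2 : B * t ≤ a / 2 := by
      calc B * t ≤ B * t₁ := mul_le_mul_of_nonneg_left ht.2 hBpos.le
        _ = a / 2 := by rw [ht₁]; field_simp
    have h3 : a / 2 ≤ V t := by linarith [le_abs_self (V 0 - V t), hP.init.1]
    calc U t ≤ B := hUB t ht.1
      _ = 2 * B / a * (a / 2) := by field_simp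
      _ ≤ M * V t := mul_le_mul (le_max_left _ _) h3 (by positivity) (by linarith)
  refine fun t ht => ⟨hUB t ht, ?_⟩
  rcases le_or_gt t t₁ with htt | htt
  · exact hUM t ⟨ht, htt⟩
  · have := nonpos_of_unstable (z := fun t => U t - M * V t) (a := t₁) (c := 1) (B := B) one_pos
      (fun s hs => (hP.hasDerivAt_U (ht₁pos.trans hs)).sub
        ((hP.hasDerivAt_V (ht₁pos.trans hs)).const_mul M)) (fun s hs hz => ?_) (fun s hs => ?_) t htt
    · linarith
    · have hs0 : 0 < s := ht₁pos.trans hs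
      have h1 := hP.eF_le hk (V s ^ 2 - e * U s ^ 2)
      have h2 := hP.U_nonneg hk ha hR s hs0.le
      have h3 := hP.nonneg s hs0.le
      have h4 := hP.adm.nonneg (V s ^ 2 - e * U s ^ 2)
      have h5 : d / s ≤ d / t₁ := by gcongr
      have h6 : M * (1 / 2 * U s) ≤ M * ((1 - e * F (V s ^ 2 - e * U s ^ 2)) * U s) :=
        mul_le_mul_of_nonneg_left (mul_le_mul_of_nonneg_right (by linarith) h2) (by linarith)
      have h7 : d / s * U s ≤ d / t₁ * U s := mul_le_mul_of_nonneg_right h5 h2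
      have h8 : -V s ≤ (F (V s ^ 2 - e * U s ^ 2) - 1) * V s := by nlinarith
      have h9 : V s ≤ M * V s := le_mul_of_one_le_left h3 hMpos
      have h10 : 2 * (d / t₁ + 2) * U s ≤ M * U s := mul_le_mul_of_nonneg_right hM1 h2
      linarith
    · have h3 := hP.nonneg s (ht₁pos.trans hs).le
      have := hUB s (ht₁pos.trans hs).le
      have : 0 ≤ M * V s := mul_nonneg (by linarith) h3
      linarith

theorem plateau_mono {k R : ℝ} (hk : 0 < k) (hR : 0 ≤ R) : Monotone (plateau k R) := fun _ _ h =>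
  Real.rpow_le_rpow (le_min (le_max_right _ _) hR) (min_le_min_right _ (max_le_max_right _ h)) hk.le

theorem IsProfile.not_bounded_below {d : ℕ} {k a b δ : ℝ} {V U : ℝ → ℝ} (hk : 0 < k) (ha : 0 < a)
    (hab : a ≤ b) (hR : 2 ≤ (b ^ 2) ^ k) (hδ : 0 < δ)
    (hP : IsProfile d k 0 a b 0 (plateau k (b ^ 2)) V U) (hV : ∀ t, 0 ≤ t → δ ≤ V t) : False := by
  set F := plateau k (b ^ 2)
  obtain ⟨B, hB, M, hM, hbd⟩ := exists_profile_bounds d hk ha hab hR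
  have hUB : ∀ t, 0 ≤ t → U t ≤ B := fun t ht => (hbd _ _ _ _ _ hP t ht).1
  set L := sInf (V '' Ici 0) with hL
  have hbdd : BddBelow (V '' Ici 0) := ⟨δ, by rintro _ ⟨t, ht, rfl⟩; exact hV t ht⟩
  have hne : (V '' Ici 0).Nonempty := ⟨V 0, 0, self_mem_Ici, rfl⟩
  have hLle : ∀ t, 0 ≤ t → L ≤ V t := fun t ht => csInf_le hbdd ⟨t, ht, rfl⟩
  have hLpos : 0 < L := hδ.trans_le (le_csInf hne (by rintro _ ⟨t, ht, rfl⟩; exact hV t ht))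
  rcases lt_or_ge 1 (F (L ^ 2)) with hF | hF
  · have hc : 0 < (F (L ^ 2) - 1) * L := mul_pos (sub_pos.2 hF) hLpos
    set t := (B + 1) * (d + 1) / ((F (L ^ 2) - 1) * L) with ht
    have ht0 : 0 < t := by positivity
    have h1 := le_of_radial_source (d := d) (c := (F (L ^ 2) - 1) * L) (T := t) le_rfl
      (hP.sol t).contU (hP.sol t).init (fun s hs => (hP.sol t).derivU s hs) hc.le (fun s hs => ?_)
      t ⟨ht0.le, le_rfl⟩
    · have h2 : (F (L ^ 2) - 1) * L * t / (d + 1) = B + 1 := by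
        rw [ht]; field_simp
      linarith [hUB t ht0.le]
    · have h1 := hLle s hs.1.le
      have h2 : F (L ^ 2) ≤ F (V s ^ 2 - 0 * U s ^ 2) :=
        plateau_mono hk (sq_nonneg b) (by nlinarith)
      exact mul_le_mul (by linarith) h1 hLpos.le (by linarith)
  · have hsub : primitive F (L ^ 2) < L ^ 2 := by
      by_contra hcon
      push Not at hcon
      linarith [hP.adm.one_lt_of_le_primitive hk hP.small (sq_nonneg b) hR (by positivity) hcon]
    set c := (L ^ 2 - primitive F (L ^ 2)) / 2 with hc
    have hcpos : 0 < c := by linarith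
    have hcont : Continuous fun v => v ^ 2 - primitive F (v ^ 2) :=
      (continuous_pow 2).sub ((continuous_primitive hP.adm.cont).comp (continuous_pow 2))
    have hev : ∀ᶠ v in 𝓝 L, c < v ^ 2 - primitive F (v ^ 2) :=
      (hcont.tendsto L).eventually (lt_mem_nhds (by linarith))
    obtain ⟨ρ, hρ, hρb⟩ := Metric.eventually_nhds_iff.1 hev
    obtain ⟨_, ⟨t₂, ht₂, rfl⟩, hVt₂⟩ := exists_lt_of_csInf_lt hne (lt_add_of_pos_right L hρ)
    have ht₂' : 0 ≤ t₂ := ht₂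
    have hUlow : ∀ t, t₂ ≤ t → Real.sqrt c ≤ U t := by
      intro t ht
      have ht0 : 0 ≤ t := ht₂'.trans ht
      refine Real.sqrt_le_iff.2 ⟨hP.U_nonneg hk ha hR t ht0, ?_⟩
      have h1 := hP.V_anti hk ha hR ht₂' ht
      have h2 := hLle t ht0
      have h3 := hρb (show dist (V t) L < ρ by
        rw [Real.dist_eq, abs_of_nonneg (by linarith)]; linarith)
      have h4 := hP.ham t ht0
      unfold hamiltonian at h4
      norm_num at h4
      linarith
    have hs : 0 < Real.sqrt c := Real.sqrt_pos.2 hcpos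
    set t := t₂ + (V t₂ + 1) / Real.sqrt c with ht
    have hV0 := hP.nonneg t₂ ht₂'
    have htt : t₂ < t := by
      have : 0 < (V t₂ + 1) / Real.sqrt c := by positivity
      linarith
    have hanti : AntitoneOn (fun s => V s + Real.sqrt c * s) (Icc t₂ t) := by
      have := (hP.sol t).contV.mono (Icc_subset_Icc_left ht₂')
      refine antitoneOn_Icc_of_hasDerivAt (f' := fun s => -U s + Real.sqrt c) (by fun_prop)
        (fun s hs => ?_) (fun s hs => ?_)
      · refine ((hP.hasDerivAt_V (ht₂'.trans_lt hs.1)).add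
          ((hasDerivAt_id s).const_mul _)).congr_deriv ?_
        ring
      · linarith [hUlow s hs.1.le]
    have h1 := hanti ⟨le_rfl, htt.le⟩ ⟨htt.le, le_rfl⟩ htt.le
    have h2 : Real.sqrt c * t = Real.sqrt c * t₂ + (V t₂ + 1) := by
      rw [ht]; field_simp
    have h3 := hP.nonneg t (ht₂'.trans htt.le)
    simp only at h1
    linarith

theorem exists_uniform_small (d : ℕ) {k a b : ℝ} (hk : 0 < k) (ha : 0 < a) (hab : a ≤ b)
    (hR : 2 ≤ (b ^ 2) ^ k) {δ : ℝ} (hδ : 0 < δ) : ∃ η₁ > 0, ∃ e₁ > 0, ∃ T₀ ≥ 0,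
      ∀ η ≤ η₁, ∀ e ≤ e₁, ∀ F V U, IsProfile d k η a b e F V U → ∀ t, T₀ ≤ t → V t ≤ δ := by
  by_contra hcon
  push Not at hcon
  have hj : ∀ j : ℕ, (0 : ℝ) < 1 / (j + 1) := fun j => by positivity
  choose η hη e he F V U hP t ht hV using fun j : ℕ =>
    hcon (1 / (j + 1)) (hj j) (1 / (j + 1)) (hj j) j (Nat.cast_nonneg j)
  have hone : Tendsto (fun j : ℕ => 1 / (j + 1 : ℝ)) atTop (𝓝 0) :=
    tendsto_one_div_add_atTop_nhds_zero_nat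
  have hFlim : TendstoUniformly F (plateau k (b ^ 2)) atTop := by
    rw [Metric.tendstoUniformly_iff]
    intro r hr
    filter_upwards [hone.eventually (gt_mem_nhds hr)] with j hjr s
    rw [dist_comm, Real.dist_eq]
    exact (((hP j).adm.near s).trans (hη j)).trans_lt hjr
  have helim : Tendsto e atTop (𝓝 0) := squeeze_zero (fun j => (hP j).enn) he hone
  obtain ⟨φ, hφ, V', U', hsol, hlim⟩ := exists_limit_sol (d := d) (h := fun _ => 0) (e' := 0)
    (A := b) (μ := fun _ => 1) (T := fun j : ℕ => (j : ℝ)) (fun j => (hP j).sol j)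
    (fun _ => le_rfl) tendsto_const_nhds (fun j => (hP j).adm.cont) (fun j => (hP j).adm.nonneg)
    (fun j => (hP j).F_le hk) (fun j => (hP j).enn) (fun j => (hP j).ele.trans (by norm_num)) helim
    (fun _ => zero_le_one) (fun _ => le_rfl) tendsto_const_nhds (fun j => Nat.cast_nonneg j)
    tendsto_natCast_atTop_atTop (fun j => by
      rw [abs_of_nonneg (ha.le.trans (hP j).init.1)]; exact (hP j).init.2)
    (continuous_plateau hk _) hFlim
  have hFlim' : TendstoUniformly (fun j => F (φ j)) (plateau k (b ^ 2)) atTop := fun u hu =>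
    hφ.tendsto_atTop.eventually (hFlim u hu)
  have hbelow : ∀ s, 0 ≤ s → δ ≤ V' s := by
    intro s hs
    refine ge_of_tendsto (hlim s hs).1 ?_
    filter_upwards [((tendsto_natCast_atTop_atTop (R := ℝ)).comp hφ.tendsto_atTop).eventually
      (eventually_ge_atTop s)] with j hjs
    exact (hV (φ j)).le.trans ((hP (φ j)).V_anti hk ha hR hs (le_trans hjs (ht (φ j))))
  refine IsProfile.not_bounded_below hk ha hab hR hδ (V := V') (U := U') ⟨?_, by linarith, le_rfl,
    by norm_num, hsol, ?_, fun s hs => hδ.le.trans (hbelow s hs), fun s hs => ?_⟩ hbelow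
  · exact isAdm_plateau hk le_rfl (sq_nonneg b)
  · exact isClosed_Icc.mem_of_tendsto (hlim 0 le_rfl).1
      (Eventually.of_forall fun j => (hP (φ j)).init)
  · exact ge_of_tendsto (tendsto_hamiltonian (fun j => (hP (φ j)).adm.cont)
      (continuous_plateau hk _) hFlim' (helim.comp hφ.tendsto_atTop) tendsto_const_nhds
      (hlim s hs).1 (hlim s hs).2) (Eventually.of_forall fun j => (hP (φ j)).ham s hs)

namespace IsProfile

variable {d : ℕ} {k η a b e δ T₀ T₁ κ : ℝ} {F V U : ℝ → ℝ}

theorem F_le_rpow (hP : IsProfile d k η a b e F V U) (hk : 0 < k)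
    (hF2 : ∀ s, 0 ≤ s → F s ≤ 2 * s ^ k) (t : ℝ) :
    F (V t ^ 2 - e * U t ^ 2) ≤ 2 * (V t ^ 2) ^ k := by
  have he := mul_nonneg hP.enn (sq_nonneg (U t))
  rcases le_total 0 (V t ^ 2 - e * U t ^ 2) with hs | hs
  · refine (hF2 _ hs).trans (mul_le_mul_of_nonneg_left ?_ zero_le_two)
    exact Real.rpow_le_rpow hs (by linarith) hk.le
  · rw [hP.adm.zero _ hs]
    positivity

theorem V_le_exp (hP : IsProfile d k η a b e F V U) (hk : 0 < k) (ha : 0 < a)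
    (hR : 2 ≤ (b ^ 2) ^ k) (hF2 : ∀ s, 0 ≤ s → F s ≤ 2 * s ^ k)
    (hδk : 2 * (δ ^ 2) ^ k ≤ 1 / 4) (hT₀ : 0 ≤ T₀) (hV : ∀ t, T₀ ≤ t → V t ≤ δ) :
    ∀ t, T₀ ≤ t → V t ≤ δ * Real.exp (-((t - T₀) / 4)) := by
  have hF : ∀ t, T₀ ≤ t → F (V t ^ 2 - e * U t ^ 2) ≤ 1 / 4 := by
    intro t ht
    refine (hP.F_le_rpow hk hF2 t).trans (le_trans ?_ hδk)
    have h1 := hV t ht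
    have h2 := hP.nonneg t (hT₀.trans ht)
    gcongr
  have hVU : ∀ t, T₀ < t → V t - 2 * U t ≤ 0 := by
    refine nonpos_of_unstable (c := 1) (B := b) one_pos
      (fun s hs => (hP.hasDerivAt_V (hT₀.trans_lt hs)).sub
        ((hP.hasDerivAt_U (hT₀.trans_lt hs)).const_mul 2)) (fun s hs hz => ?_) (fun s hs => ?_)
    · have hs0 : 0 < s := hT₀.trans_lt hs
      have h1 := hF s hs.le
      have h2 := hP.U_nonneg hk ha hR s hs0.le
      have h3 := hP.nonneg s hs0.le
      have h4 := mul_nonneg hP.enn (hP.adm.nonneg (V s ^ 2 - e * U s ^ 2))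
      have h5 : 0 ≤ d / s * U s := by positivity
      have h6 : (1 - e * F (V s ^ 2 - e * U s ^ 2)) * U s ≤ 1 * U s :=
        mul_le_mul_of_nonneg_right (by linarith) h2
      have h7 : (F (V s ^ 2 - e * U s ^ 2) - 1) * V s ≤ (1 / 4 - 1) * V s :=
        mul_le_mul_of_nonneg_right (by linarith) h3
      linarith
    · have := hP.V_le hk ha hR s (hT₀.trans hs.le)
      have := hP.U_nonneg hk ha hR s (hT₀.trans hs.le)
      linarith
  intro t ht
  have hanti : AntitoneOn (fun s => Real.exp (s / 4) * V s) (Icc T₀ t) := by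
    have := (hP.sol t).contV.mono (Icc_subset_Icc_left hT₀)
    refine antitoneOn_Icc_of_hasDerivAt (by fun_prop) (fun s hs =>
      (((hasDerivAt_id s).div_const 4).exp).mul (hP.hasDerivAt_V (hT₀.trans_lt hs.1)))
      (fun s hs => ?_)
    have h1 := hVU s hs.1
    have h2 := hP.U_nonneg hk ha hR s (hT₀.trans hs.1.le)
    have h4 := hP.eF_le hk (V s ^ 2 - e * U s ^ 2)
    have h6 : 1 / 2 * U s ≤ (1 - e * F (V s ^ 2 - e * U s ^ 2)) * U s :=
      mul_le_mul_of_nonneg_right (by linarith) h2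
    have h7 := Real.exp_pos (s / 4)
    simp only [id]
    nlinarith
  have h1 := hanti ⟨le_rfl, ht⟩ ⟨ht, le_rfl⟩ ht
  simp only at h1
  have h2 := hV T₀ le_rfl
  have h3 : Real.exp (-((t - T₀) / 4)) = Real.exp (T₀ / 4) / Real.exp (t / 4) := by
    rw [← Real.exp_sub]; ring_nf
  rw [h3, mul_div_assoc', le_div_iff₀ (Real.exp_pos _)]
  calc V t * Real.exp (t / 4) = Real.exp (t / 4) * V t := mul_comm _ _
    _ ≤ Real.exp (T₀ / 4) * V T₀ := h1
    _ ≤ Real.exp (T₀ / 4) * δ := mul_le_mul_of_nonneg_left h2 (Real.exp_pos _).le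
    _ = _ := mul_comm _ _

theorem V_le_U (hP : IsProfile d k η a b e F V U) (hk : 0 < k) (ha : 0 < a)
    (hR : 2 ≤ (b ^ 2) ^ k) (hd : 1 ≤ d) (hT₁ : 1 ≤ T₁)
    (hF : ∀ t, T₁ ≤ t → F (V t ^ 2 - e * U t ^ 2) ≤ 1 / 4)
    (hFt : ∀ t, T₁ ≤ t → F (V t ^ 2 - e * U t ^ 2) ≤ 1 / t) :
    ∀ t, T₁ < t → V t - U t ≤ 0 := by
  refine nonpos_of_unstable (c := 1 / 2) (B := b) (by norm_num)
    (fun s hs => (hP.hasDerivAt_V (by linarith)).sub (hP.hasDerivAt_U (by linarith)))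
    (fun s hs hz => ?_) (fun s hs => ?_)
  · have hs0 : 0 < s := by linarith
    have h1 := hF s hs.le
    have h2 := hP.U_nonneg hk ha hR s hs0.le
    have h3 := hFt s hs.le
    have h4 := mul_nonneg (mul_nonneg hP.enn (hP.adm.nonneg (V s ^ 2 - e * U s ^ 2))) h2
    have hd' : (1 : ℝ) ≤ d := by exact_mod_cast hd
    have h5 : 1 / s * U s ≤ d / s * U s := by gcongr
    have h6 : F (V s ^ 2 - e * U s ^ 2) * U s ≤ 1 / s * U s := mul_le_mul_of_nonneg_right h3 h2
    have h7 : F (V s ^ 2 - e * U s ^ 2) * (V s - U s) ≤ 1 / 4 * (V s - U s) :=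
      mul_le_mul_of_nonneg_right h1 hz.le
    nlinarith
  · have := hP.V_le hk ha hR s (by linarith)
    have := hP.U_nonneg hk ha hR s (by linarith)
    linarith

end IsProfile

theorem antitoneOn_weighted {d : ℕ} {κ T₀ T₁ t : ℝ} {A A' : ℝ → ℝ} (hκ : 0 < κ) (hT₁ : 0 < T₁)
    (hc : ContinuousOn A (Icc T₁ t)) (hd : ∀ s ∈ Ioo T₁ t, HasDerivAt A (A' s) s)
    (hA : ∀ s ∈ Ioo T₁ t, 0 ≤ A s)
    (hA' : ∀ s ∈ Ioo T₁ t, A' s ≤ (Real.exp (-(κ * (s - T₀))) / 4 - 1 - d / (2 * s)) * A s) :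
    AntitoneOn (fun s => A s * ((1 + s ^ 2) ^ ((d : ℝ) / 4)
      * Real.exp (s + Real.exp (-(κ * (s - T₀))) / (4 * κ)))) (Icc T₁ t) := by
  have h1s : ∀ s : ℝ, 0 < 1 + s ^ 2 := fun s => by positivity
  refine antitoneOn_Icc_of_hasDerivAt (f' := fun s => ((A' s + A s * ((d : ℝ) * s / (2 * (1 + s ^ 2))
      + 1 - Real.exp (-(κ * (s - T₀))) / 4)) * ((1 + s ^ 2) ^ ((d : ℝ) / 4)
      * Real.exp (s + Real.exp (-(κ * (s - T₀))) / (4 * κ))))) ?_ (fun s hs => ?_) (fun s hs => ?_)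
  · refine hc.mul (ContinuousOn.mul ?_ (by fun_prop))
    exact ContinuousOn.rpow_const (by fun_prop) fun x _ => Or.inl (h1s x).ne'
  · have h1 : HasDerivAt (fun s : ℝ => 1 + s ^ 2) (2 * s) s := by
      simpa using (hasDerivAt_pow 2 s).const_add 1
    have h2 := h1.rpow_const (p := (d : ℝ) / 4) (Or.inl (h1s s).ne')
    have h3 : HasDerivAt (fun s => Real.exp (-(κ * (s - T₀))))
        (Real.exp (-(κ * (s - T₀))) * -κ) s := by
      simpa using (((hasDerivAt_id s).sub_const T₀).const_mul κ).neg.exp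
    have h4 := ((hasDerivAt_id s).add (h3.div_const (4 * κ))).exp
    refine ((hd s hs).mul (h2.mul h4)).congr_deriv ?_
    rw [Real.rpow_sub_one (h1s s).ne']
    have := (h1s s).ne'
    simp only [id, Pi.add_apply, Pi.mul_apply]
    field_simp
    ring
  · have hs0 : 0 < s := hT₁.trans hs.1
    refine mul_nonpos_of_nonpos_of_nonneg ?_ (by positivity)
    have h1 : (d : ℝ) * s / (2 * (1 + s ^ 2)) ≤ d / (2 * s) := by
      rw [div_le_div_iff₀ (by positivity) (by positivity)]
      nlinarith [Nat.cast_nonneg (α := ℝ) d]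
    have h2 := mul_le_mul_of_nonneg_left h1 (hA s hs)
    have h3 := hA' s hs
    nlinarith

theorem exists_uniform_decay (d : ℕ) {k a b : ℝ} (hk : 0 < k) (ha : 0 < a) (hab : a ≤ b)
    (hR : 2 ≤ (b ^ 2) ^ k) : ∃ η₁ > 0, ∃ e₁ > 0, ∃ K > 0, ∀ η ≤ η₁, ∀ e ≤ e₁, ∀ F V U,
      IsProfile d k η a b e F V U → (∀ s, 0 ≤ s → F s ≤ 2 * s ^ k) →
      ∀ t, 0 ≤ t → V t + U t ≤ K * ((1 + t ^ 2) ^ (-((d : ℝ) / 4)) * Real.exp (-t)) := by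
  have hb : 0 < b := ha.trans_le hab
  obtain ⟨δ, hδ, hδk⟩ : ∃ δ : ℝ, 0 < δ ∧ 2 * (δ ^ 2) ^ k ≤ 1 / 4 := by
    refine ⟨Real.sqrt ((1 / 8) ^ (1 / k)), by positivity, ?_⟩
    rw [Real.sq_sqrt (by positivity), ← Real.rpow_mul (by norm_num), one_div_mul_cancel hk.ne',
      Real.rpow_one]
    norm_num
  obtain ⟨η₁, hη₁, e₁, he₁, T₀, hT₀, hsmall⟩ := exists_uniform_small d hk ha hab hR hδ
  obtain ⟨B, hB, M, hM, hbd⟩ := exists_profile_bounds d hk ha hab hR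
  set κ := k / 2 with hκdef
  have hκ : 0 < κ := half_pos hk
  obtain ⟨T₁, hT₁, hT₁T₀, hT₁F⟩ : ∃ T₁, 1 ≤ T₁ ∧ T₀ ≤ T₁ ∧
      ∀ t, T₁ ≤ t → Real.exp (-(κ * (t - T₀))) / 4 ≤ 1 / t := by
    have hlim : Tendsto (fun t => t ^ (1 : ℝ) * Real.exp (-κ * t)) atTop (𝓝 0) :=
      tendsto_rpow_mul_exp_neg_mul_atTop_nhds_zero 1 κ hκ
    have hev := hlim.eventually (gt_mem_nhds (Real.exp_pos (-(κ * T₀))))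
    obtain ⟨T, hT⟩ := eventually_atTop.1 hev
    refine ⟨max T (max 1 T₀), le_max_of_le_right (le_max_left _ _),
      le_max_of_le_right (le_max_right _ _), fun t ht => ?_⟩
    have h1 := hT t ((le_max_left _ _).trans ht)
    have ht0 : 0 < t := by
      have := ((le_max_left 1 T₀).trans (le_max_right T _)).trans ht
      linarith
    rw [Real.rpow_one] at h1
    rw [le_div_iff₀ ht0]
    have h2 : Real.exp (-(κ * (t - T₀))) = Real.exp (-κ * t) / Real.exp (-(κ * T₀)) := by
      rw [← Real.exp_sub]; ring_nf
    have h3 : t * Real.exp (-κ * t) / Real.exp (-(κ * T₀)) < 1 := by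
      rwa [div_lt_one (Real.exp_pos _)]
    have h4 : Real.exp (-(κ * (t - T₀))) * t < 1 := by
      rw [h2]
      calc _ = t * Real.exp (-κ * t) / Real.exp (-(κ * T₀)) := by ring
        _ < 1 := h3
    have h5 : 0 < Real.exp (-(κ * (t - T₀))) * t := mul_pos (Real.exp_pos _) ht0
    linarith
  set K := (b + B) * ((1 + T₁ ^ 2) ^ ((d : ℝ) / 4) * Real.exp (T₁ + 1 / (4 * κ))) with hK
  have hKpos : 0 < K := by positivity
  refine ⟨η₁, hη₁, e₁, he₁, K, hKpos, fun η hη e he F V U hP hF2 => ?_⟩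
  have hVe := hP.V_le_exp hk ha hR hF2 hδk hT₀ (hsmall η hη e he F V U hP)
  have hFe : ∀ t, T₀ ≤ t → F (V t ^ 2 - e * U t ^ 2) ≤ Real.exp (-(κ * (t - T₀))) / 4 := by
    intro t ht
    have hV0 := hP.nonneg t (hT₀.trans ht)
    calc F (V t ^ 2 - e * U t ^ 2) ≤ 2 * (V t ^ 2) ^ k := hP.F_le_rpow hk hF2 t
      _ ≤ 2 * ((δ * Real.exp (-((t - T₀) / 4))) ^ 2) ^ k := by
          have := hVe t ht
          gcongr
      _ = 2 * (δ ^ 2) ^ k * Real.exp (-(κ * (t - T₀))) := by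
          rw [mul_pow, Real.mul_rpow (by positivity) (by positivity), ← Real.exp_nat_mul,
            ← Real.exp_mul, hκdef]
          ring_nf
      _ ≤ 1 / 4 * Real.exp (-(κ * (t - T₀))) :=
          mul_le_mul_of_nonneg_right hδk (Real.exp_pos _).le
      _ = _ := by ring
  have hexp1 : ∀ t, T₀ ≤ t → Real.exp (-(κ * (t - T₀))) ≤ 1 := fun t ht =>
    Real.exp_le_one_iff.2 (by nlinarith)
  have hF4 : ∀ t, T₁ ≤ t → F (V t ^ 2 - e * U t ^ 2) ≤ 1 / 4 := fun t ht => by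
    linarith [hFe t (hT₁T₀.trans ht), hexp1 t (hT₁T₀.trans ht)]
  have he1 : e ≤ 1 := by
    have := hP.ele
    nlinarith [hP.enn]
  have hsum : ∀ t, 0 ≤ t → 0 ≤ V t + U t ∧ V t + U t ≤ b + B := fun t ht =>
    ⟨add_nonneg (hP.nonneg t ht) (hP.U_nonneg hk ha hR t ht),
      add_le_add (hP.V_le hk ha hR t ht) (hbd _ _ _ _ _ hP t ht).1⟩
  have key : ∀ t, 0 ≤ t → (V t + U t) * ((1 + t ^ 2) ^ ((d : ℝ) / 4) * Real.exp t) ≤ K := by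
    intro t ht
    rcases le_total t T₁ with htT | htT
    · have h1 := hsum t ht
      have h2 : t ≤ T₁ + 1 / (4 * κ) := by
        have : 0 < 1 / (4 * κ) := by positivity
        linarith
      rw [hK]
      refine mul_le_mul h1.2 (by gcongr) (by positivity) (h1.1.trans h1.2)
    · have hanti := antitoneOn_weighted (d := d) (κ := κ) (T₀ := T₀) (T₁ := T₁) (t := t)
        (A := fun s => V s + U s) hκ (by linarith)
        (((hP.sol t).contV.mono (Icc_subset_Icc_left (by linarith))).add
          ((hP.sol t).contU.mono (Icc_subset_Icc_left (by linarith))))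
        (fun s hs => (hP.hasDerivAt_V (by linarith [hs.1])).add
          (hP.hasDerivAt_U (by linarith [hs.1])))
        (fun s hs => (hsum s (by linarith [hs.1])).1) (fun s hs => ?_)
      · have h1 := hanti ⟨le_rfl, htT⟩ ⟨htT, le_rfl⟩ htT
        simp only at h1
        have h2 := hsum t ht
        have h3 := hsum T₁ (by linarith)
        have h4 : (V t + U t) * ((1 + t ^ 2) ^ ((d : ℝ) / 4) * Real.exp t)
            ≤ (V t + U t) * ((1 + t ^ 2) ^ ((d : ℝ) / 4)
              * Real.exp (t + Real.exp (-(κ * (t - T₀))) / (4 * κ))) := by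
          have : 0 ≤ Real.exp (-(κ * (t - T₀))) / (4 * κ) := by positivity
          gcongr
          · exact h2.1
          · linarith
        refine (h4.trans h1).trans ?_
        rw [hK]
        have h5 := hexp1 T₁ hT₁T₀
        have h6 := h3.2
        gcongr
      · have hs0 : 0 < s := by linarith [hs.1]
        have h1 := hFe s (hT₁T₀.trans hs.1.le)
        have h2 := hP.U_nonneg hk ha hR s hs0.le
        have h3 := hP.nonneg s hs0.le
        have h4 := hP.adm.nonneg (V s ^ 2 - e * U s ^ 2)
        have h5 : (d : ℝ) / (2 * s) * (V s - U s) ≤ 0 := by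
          rcases Nat.eq_zero_or_pos d with hd | hd
          · simp [hd]
          · exact mul_nonpos_of_nonneg_of_nonpos (by positivity)
              (hP.V_le_U hk ha hR hd hT₁ hF4
                (fun t ht => (hFe t (hT₁T₀.trans ht)).trans (hT₁F t ht)) s hs.1)
        have h6 : F (V s ^ 2 - e * U s ^ 2) * (V s + e * U s)
            ≤ Real.exp (-(κ * (s - T₀))) / 4 * (V s + U s) :=
          mul_le_mul h1 (by nlinarith) (add_nonneg h3 (mul_nonneg hP.enn h2)) (by positivity)
        have h7 : (d : ℝ) / s * U s = d / (2 * s) * (V s + U s) - d / (2 * s) * (V s - U s) := by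
          field_simp
          ring
        linarith
  intro t ht
  have h1 := key t ht
  have h2 : 0 < 1 + t ^ 2 := by positivity
  rw [Real.rpow_neg h2.le, Real.exp_neg, ← mul_inv, ← div_eq_mul_inv, le_div_iff₀ (by positivity)]
  exact h1

theorem exists_profile (d : ℕ) {k : ℝ} (hk : 0 < k) (hkd : 2 ≤ d → k < 2 / ((d : ℝ) - 1)) :
    ∃ a > 0, ∃ b > 0, ∃ η > 0, ∃ e₀ > 0, ∃ K > 0, ∀ e ∈ Icc 0 e₀, ∀ F, IsAdm k η (b ^ 2) F →
      UniformContinuous F → (∀ s, 0 ≤ s → F s ≤ 2 * s ^ k) →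
      ∃ V U : ℝ → ℝ, (∀ T, IsRadialSol d 0 e 1 F T V U) ∧ a ≤ V 0 ∧ ∀ t, 0 ≤ t →
        0 < V t ∧ V t ≤ b ∧ 0 ≤ U t ∧ 3 * e * U t ^ 2 ≤ V t ^ 2 ∧
        V t + U t ≤ K * ((1 + t ^ 2) ^ (-((d : ℝ) / 4)) * Real.exp (-t)) := by
  set a := Real.sqrt ((1 / 2) ^ (1 / k)) with ha'
  have ha : 0 < a := by positivity
  have hak : (a ^ 2) ^ k = 1 / 2 := by
    rw [ha', Real.sq_sqrt (by positivity), ← Real.rpow_mul (by norm_num),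
      one_div_mul_cancel hk.ne', Real.rpow_one]
  obtain ⟨b, hb₀, hb1, e₁, he₁, h₁, hh₁, T₁, hcross⟩ :=
    exists_crossing hk hkd (max a (Real.sqrt (2 ^ (1 / k))))
  have hab : a ≤ b := (le_max_left _ _).trans hb₀
  have hb : 0 < b := ha.trans_le hab
  have hR : 2 ≤ (b ^ 2) ^ k := by
    have h1 : (Real.sqrt (2 ^ (1 / k)) ^ 2) ^ k ≤ (b ^ 2) ^ k := by
      have := (le_max_right _ _).trans hb₀
      gcongr
    rwa [Real.sq_sqrt (by positivity), ← Real.rpow_mul (by norm_num),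
      one_div_mul_cancel hk.ne', Real.rpow_one] at h1
  obtain ⟨B, -, M, hM, hbd⟩ := exists_profile_bounds d hk ha hab hR
  obtain ⟨η₁, hη₁, e₂, he₂, K, hK, hdec⟩ := exists_uniform_decay d hk ha hab hR
  obtain ⟨η, hη, hηle⟩ : ∃ η > 0, η ≤ η₁ ∧ η ≤ 1 / 4 ∧ η ≤ k / (2 * (k + 2)) :=
    ⟨min η₁ (min (1 / 4) (k / (2 * (k + 2)))), by positivity, min_le_left _ _,
      (min_le_right _ _).trans (min_le_left _ _), (min_le_right _ _).trans (min_le_right _ _)⟩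
  obtain ⟨hηη₁, hη4, hηk⟩ := hηle
  have hsmall : η * (k + 2) < k := by
    rw [le_div_iff₀ (by positivity)] at hηk
    nlinarith
  obtain ⟨e₀, he₀, h1, h2, h3, h4⟩ : ∃ e₀ > 0, e₀ ≤ e₁ ∧ e₀ ≤ e₂ ∧
      e₀ ≤ 1 / (2 * ((b ^ 2) ^ k + 1)) ∧ e₀ ≤ 1 / (3 * M ^ 2) := by
    have hM0 : 0 < M := by linarith
    refine ⟨min (min e₁ e₂) (min (1 / (2 * ((b ^ 2) ^ k + 1))) (1 / (3 * M ^ 2))), ?_,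
      (min_le_left _ _).trans (min_le_left _ _), (min_le_left _ _).trans (min_le_right _ _),
      (min_le_right _ _).trans (min_le_left _ _), (min_le_right _ _).trans (min_le_right _ _)⟩
    positivity
  refine ⟨a, ha, b, hb, η, hη, e₀, he₀, K, hK, fun e he F hF hFu hF2 => ?_⟩
  have hele : e * ((b ^ 2) ^ k + 1) ≤ 1 / 2 := by
    have := he.2.trans h3
    rw [le_div_iff₀ (by positivity)] at this
    linarith
  have hsub : primitive F (a ^ 2) < a ^ 2 :=
    hF.subcritical hk (by linarith) ⟨by positivity, by gcongr⟩ hak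
  obtain ⟨V, U, hsol, hinit, hnn, hham⟩ := exists_nonneg_global hk hη (sq_nonneg b) hF hFu he.1
    (le_trans (mul_le_mul_of_nonneg_left (by linarith) he.1) hele) ha hab hsub hh₁
    (fun h hh G hG => hcross e ⟨he.1, he.2.trans h1⟩ h hh G
      ⟨hG.cont, hG.nonneg, hG.zero, fun s => (hG.near s).trans (by linarith)⟩)
  have hP : IsProfile d k η a b e F V U := ⟨hF, hsmall, he.1, hele, hsol, hinit, hnn, hham⟩
  refine ⟨V, U, hsol, hinit.1, fun t ht => ?_⟩
  have hU := hP.U_nonneg hk ha hR t ht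
  refine ⟨hP.V_pos hk ha t ht, hP.V_le hk ha hR t ht, hU, ?_,
    hdec η hηη₁ e (he.2.trans h2) F V U hP hF2 t ht⟩
  have h5 := (hbd _ _ _ _ _ hP t ht).2
  have h6 : U t ^ 2 ≤ M ^ 2 * V t ^ 2 := by
    rw [← mul_pow]
    gcongr
  have h7 : 3 * e * M ^ 2 ≤ 1 := by
    have := he.2.trans h4
    rw [le_div_iff₀ (by positivity)] at this
    linarith
  calc 3 * e * U t ^ 2 ≤ 3 * e * (M ^ 2 * V t ^ 2) :=
        mul_le_mul_of_nonneg_left h6 (by linarith [he.1])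
    _ = 3 * e * M ^ 2 * V t ^ 2 := by ring
    _ ≤ 1 * V t ^ 2 := by gcongr
    _ = V t ^ 2 := one_mul _

theorem HasDerivAt.of_even {f : ℝ → ℝ} {f' t : ℝ} (hf : ∀ t, f (-t) = f t)
    (h : HasDerivAt f f' (-t)) : HasDerivAt f (-f') t := by
  have h1 := h.comp t (hasDerivAt_neg t)
  have h2 : f ∘ Neg.neg = f := funext hf
  rw [h2] at h1
  simpa using h1

theorem HasDerivAt.of_odd {f : ℝ → ℝ} {f' t : ℝ} (hf : ∀ t, f (-t) = -f t)
    (h : HasDerivAt f f' (-t)) : HasDerivAt f f' t := by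
  have h1 := (h.comp t (hasDerivAt_neg t)).neg
  have h2 : -(f ∘ Neg.neg) = f := funext fun t => by simp [hf]
  rw [h2] at h1
  simpa using h1

/-- Near the origin `U(t)/t` converges, which makes radial solutions continuously differentiable
across `t = 0`. -/
theorem IsRadialSol.exists_abs_sub_le {d : ℕ} {e : ℝ} {F V U : ℝ → ℝ} (hF : Continuous F)
    (hS : IsRadialSol d 0 e 1 F 1 V U) {ρ : ℝ} (hρ : 0 < ρ) :
    ∃ T > 0, ∀ t ∈ Icc 0 T, |U t - (F (V 0 ^ 2) - 1) * V 0 / (d + 1) * t| ≤ ρ * t := by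
  set g : ℝ → ℝ := fun t => (F (V t ^ 2 - e * U t ^ 2) - 1) * V t with hg
  have hgc : ContinuousOn g (Icc 0 1) :=
    ((hF.comp_continuousOn ((hS.contV.pow 2).sub (continuousOn_const.mul (hS.contU.pow 2)))).sub
      continuousOn_const).mul hS.contV
  have hg0 : g 0 = (F (V 0 ^ 2) - 1) * V 0 := by simp [hg, hS.init]
  obtain ⟨δ, hδ, hδg⟩ := Metric.continuousOn_iff.1 hgc 0 (by simp) ρ hρ
  refine ⟨min 1 (δ / 2), by positivity, ?_⟩
  set T := min 1 (δ / 2) with hT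
  have hT1 : T ≤ 1 := min_le_left _ _
  have hTδ : T ≤ δ / 2 := min_le_right _ _
  rw [← hg0]
  have hd1 : (0 : ℝ) < d + 1 := by positivity
  refine abs_le_of_radial_source (d := d) (g := fun t => g t - g 0) le_rfl
    ((hS.contU.mono (Icc_subset_Icc_right hT1)).sub (by fun_prop)) (by simp [hS.init])
    (fun t ht => ?_) (fun t ht => ?_)
  · have h1 := (hS.derivU t ⟨ht.1, ht.2.trans_le hT1⟩).sub
      ((hasDerivAt_id t).const_mul (g 0 / (d + 1)))
    refine h1.congr_deriv ?_
    have := ht.1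
    simp only [hg]
    field_simp
    ring
  · have h1 := hδg t ⟨ht.1.le, ht.2.le.trans hT1⟩ (by
      rw [Real.dist_eq, sub_zero, abs_of_pos ht.1]
      linarith [ht.2])
    rw [Real.dist_eq] at h1
    exact h1.le

/-- Even-odd `C¹` extension of a radial solution to the whole line. -/
theorem exists_even_odd_extension {d : ℕ} {e : ℝ} {F V U : ℝ → ℝ} (hF : Continuous F)
    (hS : ∀ T, IsRadialSol d 0 e 1 F T V U) :
    ∃ V' U' W : ℝ → ℝ, Continuous V' ∧ Continuous U' ∧ Continuous W ∧
      (∀ t, V' (-t) = V' t) ∧ (∀ t, U' (-t) = -U' t) ∧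
      (∀ t, 0 ≤ t → V' t = V t ∧ U' t = U t) ∧ (∀ t, t ≠ 0 → W t = U' t / t) ∧
      (∀ t, HasDerivAt V' (-((1 - e * F (V' t ^ 2 - e * U' t ^ 2)) * U' t)) t) ∧
      (∀ t, HasDerivAt U' ((F (V' t ^ 2 - e * U' t ^ 2) - 1) * V' t - d * W t) t) ∧
      HasDerivAt U' (W 0) 0 := by
  have hcont : ∀ Y : ℝ → ℝ, (∀ T, ContinuousOn Y (Icc 0 T)) → ContinuousOn Y (Ici 0) := by
    intro Y hY t ht
    refine (hY (t + 1) t ⟨ht, by linarith⟩).mono_of_mem_nhdsWithin ?_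
    filter_upwards [self_mem_nhdsWithin, mem_nhdsWithin_of_mem_nhds (Iio_mem_nhds (lt_add_one t))]
      with s hs hs' using ⟨hs, hs'.le⟩
  have hVc := hcont V fun T => (hS T).contV
  have hUc := hcont U fun T => (hS T).contU
  have hU0 : U 0 = 0 := (hS 1).init
  obtain ⟨V', hV'⟩ : ∃ V' : ℝ → ℝ, ∀ t, V' t = V |t| := ⟨_, fun _ => rfl⟩
  obtain ⟨U', hU'⟩ : ∃ U' : ℝ → ℝ, ∀ t, U' t = U (max t 0) - U (max (-t) 0) := ⟨_, fun _ => rfl⟩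
  have hV'c : Continuous V' := by
    rw [funext hV']
    exact hVc.comp_continuous continuous_abs fun t => abs_nonneg t
  have hU'c : Continuous U' := by
    rw [funext hU']
    exact (hUc.comp_continuous (by fun_prop) fun t => mem_Ici.2 (le_max_right t 0)).sub
      (hUc.comp_continuous (by fun_prop) fun t => mem_Ici.2 (le_max_right (-t) 0))
  have heven : ∀ t, V' (-t) = V' t := fun t => by rw [hV', hV', abs_neg]
  have hodd : ∀ t, U' (-t) = -U' t := fun t => by rw [hU', hU', neg_neg]; ring
  have heq : ∀ t, 0 ≤ t → V' t = V t ∧ U' t = U t := by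
    intro t ht
    rw [hV', hU', abs_of_nonneg ht, max_eq_left ht, max_eq_right (by linarith), hU0, sub_zero]
    exact ⟨rfl, rfl⟩
  set γ := (F (V 0 ^ 2) - 1) * V 0 / (d + 1) with hγ
  obtain ⟨W, hW⟩ : ∃ W : ℝ → ℝ, ∀ t, W t = if t = 0 then γ else U' t / t := ⟨_, fun _ => rfl⟩
  have hW0 : W 0 = γ := by simp [hW]
  have hWne : ∀ t, t ≠ 0 → W t = U' t / t := fun t ht => by simp [hW, ht]
  have hWc0 : ContinuousAt W 0 := by
    rw [Metric.continuousAt_iff]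
    intro ρ hρ
    obtain ⟨T, hT, hTb⟩ := (hS 1).exists_abs_sub_le hF (half_pos hρ)
    refine ⟨T, hT, fun {t} ht => ?_⟩
    rw [Real.dist_eq, sub_zero] at ht
    rw [Real.dist_eq, hW0]
    rcases eq_or_ne t 0 with rfl | ht0
    · simpa [hW0] using hρ
    have habs : W t = U |t| / |t| := by
      rw [hWne t ht0]
      rcases le_total 0 t with h | h
      · rw [abs_of_nonneg h, (heq t h).2]
      · rw [abs_of_nonpos h, ← (heq (-t) (by linarith)).2, hodd, neg_div_neg_eq]
    have hpos : 0 < |t| := abs_pos.2 ht0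
    have h1 := hTb |t| ⟨hpos.le, ht.le⟩
    have h2 : W t - γ = (U |t| - γ * |t|) / |t| := by
      rw [habs]
      field_simp
    rw [h2, abs_div, abs_abs, div_lt_iff₀ hpos]
    calc _ ≤ ρ / 2 * |t| := h1
      _ < ρ * |t| := by gcongr; linarith
  have hWc : Continuous W := by
    rw [continuous_iff_continuousAt]
    intro t
    rcases eq_or_ne t 0 with rfl | ht0
    · exact hWc0
    · refine (hU'c.continuousAt.div continuousAt_id ht0).congr ?_
      filter_upwards [isOpen_ne.mem_nhds ht0] with s hs using (hWne s hs).symm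
  have hpos : ∀ t, 0 < t →
      HasDerivAt V' (-((1 - e * F (V' t ^ 2 - e * U' t ^ 2)) * U' t)) t ∧
      HasDerivAt U' ((F (V' t ^ 2 - e * U' t ^ 2) - 1) * V' t - d * W t) t := by
    intro t ht
    have hev : ∀ᶠ s in 𝓝 t, V' s = V s ∧ U' s = U s := by
      filter_upwards [Ioi_mem_nhds ht] with s hs using heq s hs.le
    have hm : t ∈ Ioo 0 (t + 1) := ⟨ht, lt_add_one t⟩
    have h1 := ((hS (t + 1)).derivV t hm).congr_of_eventuallyEq (hev.mono fun s hs => hs.1)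
    have h2 := ((hS (t + 1)).derivU t hm).congr_of_eventuallyEq (hev.mono fun s hs => hs.2)
    rw [← (heq t ht.le).1, ← (heq t ht.le).2] at h1 h2
    refine ⟨h1, h2.congr_deriv ?_⟩
    rw [hWne t ht.ne', add_zero]
    ring
  have hne : ∀ t, t ≠ 0 →
      HasDerivAt V' (-((1 - e * F (V' t ^ 2 - e * U' t ^ 2)) * U' t)) t ∧
      HasDerivAt U' ((F (V' t ^ 2 - e * U' t ^ 2) - 1) * V' t - d * W t) t := by
    intro t ht
    rcases ht.lt_or_gt with h | h
    · obtain ⟨h1, h2⟩ := hpos (-t) (by linarith)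
      refine ⟨(h1.of_even heven).congr_deriv ?_, (h2.of_odd hodd).congr_deriv ?_⟩
      · rw [heven, hodd, neg_sq]
        ring
      · rw [heven, hodd, neg_sq, hWne _ ht, hWne _ (neg_ne_zero.2 ht), hodd, neg_div_neg_eq]
    · exact hpos t h
  have hV'd : ∀ t, HasDerivAt V' (-((1 - e * F (V' t ^ 2 - e * U' t ^ 2)) * U' t)) t := by
    intro t
    rcases eq_or_ne t 0 with rfl | ht
    · exact hasDerivAt_of_hasDerivAt_of_ne (g := fun t =>
        -((1 - e * F (V' t ^ 2 - e * U' t ^ 2)) * U' t)) (fun s hs => (hne s hs).1)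
        hV'c.continuousAt (by fun_prop)
    · exact (hne t ht).1
  have hU'd : ∀ t, HasDerivAt U' ((F (V' t ^ 2 - e * U' t ^ 2) - 1) * V' t - d * W t) t := by
    intro t
    rcases eq_or_ne t 0 with rfl | ht
    · exact hasDerivAt_of_hasDerivAt_of_ne (g := fun t =>
        (F (V' t ^ 2 - e * U' t ^ 2) - 1) * V' t - d * W t) (fun s hs => (hne s hs).2)
        hU'c.continuousAt (by fun_prop)
    · exact (hne t ht).2
  refine ⟨V', U', W, hV'c, hU'c, hWc, heven, hodd, heq, hWne, hV'd, hU'd, ?_⟩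
  refine (hU'd 0).congr_deriv ?_
  rw [(heq 0 le_rfl).1, (heq 0 le_rfl).2, hU0, hW0, hγ]
  have : (0 : ℝ) < d + 1 := by positivity
  simp only [ne_eq, OfNat.ofNat_ne_zero, not_false_eq_true, zero_pow, mul_zero, sub_zero]
  field_simp
  ring

theorem exists_even_odd_profile (d : ℕ) {k : ℝ} (hk : 0 < k)
    (hkd : 2 ≤ d → k < 2 / ((d : ℝ) - 1)) :
    ∃ a > 0, ∃ b > 0, ∃ η > 0, ∃ e₀ > 0, ∃ K > 0, ∀ e ∈ Icc 0 e₀, ∀ F, IsAdm k η (b ^ 2) F →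
      UniformContinuous F → (∀ s, 0 ≤ s → F s ≤ 2 * s ^ k) →
      ∃ V U W : ℝ → ℝ, Continuous V ∧ Continuous U ∧ Continuous W ∧
        (∀ t, V (-t) = V t) ∧ (∀ t, U (-t) = -U t) ∧ (∀ t, t ≠ 0 → W t = U t / t) ∧
        (∀ t, HasDerivAt V (-((1 - e * F (V t ^ 2 - e * U t ^ 2)) * U t)) t) ∧
        (∀ t, HasDerivAt U ((F (V t ^ 2 - e * U t ^ 2) - 1) * V t - d * W t) t) ∧
        HasDerivAt U (W 0) 0 ∧ a ≤ V 0 ∧ ∀ t, 0 < V t ∧ V t ≤ b ∧ 3 * e * U t ^ 2 ≤ V t ^ 2 ∧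
          V t + |U t| ≤ K * ((1 + t ^ 2) ^ (-((d : ℝ) / 4)) * Real.exp (-|t|)) := by
  obtain ⟨a, ha, b, hb, η, hη, e₀, he₀, K, hK, hmain⟩ := exists_profile d hk hkd
  refine ⟨a, ha, b, hb, η, hη, e₀, he₀, K, hK, fun e he F hF hFu hF2 => ?_⟩
  obtain ⟨V, U, hS, hV0, hb⟩ := hmain e he F hF hFu hF2
  obtain ⟨V', U', W, h1, h2, h3, heven, hodd, heq, h6, h7, h8, h9⟩ :=
    exists_even_odd_extension hF.cont hS
  refine ⟨V', U', W, h1, h2, h3, heven, hodd, h6, h7, h8, h9, by rwa [(heq 0 le_rfl).1], ?_⟩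
  have hnn : ∀ t, 0 ≤ t → 0 < V' t ∧ V' t ≤ b ∧ 3 * e * U' t ^ 2 ≤ V' t ^ 2 ∧
      V' t + |U' t| ≤ K * ((1 + t ^ 2) ^ (-((d : ℝ) / 4)) * Real.exp (-|t|)) := by
    intro t ht
    obtain ⟨g1, g2, g3, g4, g5⟩ := hb t ht
    rw [(heq t ht).1, (heq t ht).2, abs_of_nonneg g3, abs_of_nonneg ht]
    exact ⟨g1, g2, g4, g5⟩
  intro t
  rcases le_total 0 t with h | h
  · exact hnn t h
  · have := hnn (-t) (by linarith)
    rwa [heven, hodd, neg_sq, neg_sq, abs_neg, abs_neg] at this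

/-- The rescaled and truncated nonlinearity. -/
noncomputable def scaledNonlinearity (f : ℝ → ℝ) (k R θ s : ℝ) : ℝ :=
  f (θ ^ (1 / k) * min (max s 0) R) / θ

theorem uniformContinuous_scaledNonlinearity {f : ℝ → ℝ} (hf : Continuous f) {k R θ : ℝ}
    (hR : 0 ≤ R) : UniformContinuous (scaledNonlinearity f k R θ) := by
  have h1 : Continuous fun x : Icc (0 : ℝ) R => f (θ ^ (1 / k) * x) / θ := by fun_prop
  have h2 := (CompactSpace.uniformContinuous_of_continuous h1).comp
    (LipschitzWith.projIcc hR).uniformContinuous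
  have h3 : scaledNonlinearity f k R θ =
      (fun x : Icc (0 : ℝ) R => f (θ ^ (1 / k) * x) / θ) ∘ projIcc 0 R hR := by
    funext s
    simp only [scaledNonlinearity, Function.comp_apply, coe_projIcc]
    rw [max_min_distrib_left, max_eq_right hR, min_comm, max_comm]
  rw [h3]
  exact h2

theorem exists_isAdm_scaledNonlinearity {f : ℝ → ℝ} (hf : Continuous f) {k η R : ℝ} (hk : 0 < k)
    (hη : 0 < η) (hR : 0 < R)
    (hfo : ∀ η > 0, ∃ δ > 0, ∀ τ : ℝ, |τ| ≤ δ → |f τ - |τ| ^ k| ≤ η * |τ| ^ k) :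
    ∃ θ₀ > 0, ∀ θ ∈ Ioc 0 θ₀, IsAdm k η R (scaledNonlinearity f k R θ) ∧
      ∀ s, 0 ≤ s → scaledNonlinearity f k R θ s ≤ 2 * s ^ k := by
  obtain ⟨δ, hδ, hfδ⟩ := hfo (min 1 (η / R ^ k)) (by positivity)
  refine ⟨(δ / R) ^ k, by positivity, fun θ hθ => ?_⟩
  have hθ0 := hθ.1
  have hθδ : θ ^ (1 / k) * R ≤ δ := by
    rw [← le_div_iff₀ hR]
    calc θ ^ (1 / k) ≤ ((δ / R) ^ k) ^ (1 / k) := by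
          gcongr
          exact hθ.2
      _ = δ / R := by
          rw [← Real.rpow_mul (by positivity), mul_one_div_cancel hk.ne', Real.rpow_one]
  have hkey : ∀ s, |scaledNonlinearity f k R θ s - plateau k R s|
      ≤ min 1 (η / R ^ k) * plateau k R s := by
    intro s
    have hσ0 : 0 ≤ min (max s 0) R := le_min (le_max_right _ _) hR.le
    have h0 : 0 ≤ θ ^ (1 / k) * min (max s 0) R := by positivity
    have h1 := hfδ (θ ^ (1 / k) * min (max s 0) R) (by
      rw [abs_of_nonneg h0]
      exact (mul_le_mul_of_nonneg_left (min_le_right _ _) (by positivity)).trans hθδ)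
    rw [abs_of_nonneg h0, Real.mul_rpow (by positivity) hσ0, ← Real.rpow_mul hθ0.le,
      one_div_mul_cancel hk.ne', Real.rpow_one] at h1
    have h2 : scaledNonlinearity f k R θ s - plateau k R s =
        (f (θ ^ (1 / k) * min (max s 0) R) - θ * min (max s 0) R ^ k) / θ := by
      rw [scaledNonlinearity, plateau]
      field_simp
    rw [h2, abs_div, abs_of_pos hθ0, div_le_iff₀ hθ0, plateau]
    linarith
  have hkey1 : ∀ s, |scaledNonlinearity f k R θ s - plateau k R s| ≤ plateau k R s := fun s =>
    (hkey s).trans (mul_le_of_le_one_left (plateau_nonneg hR.le s) (min_le_left _ _))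
  refine ⟨⟨(uniformContinuous_scaledNonlinearity hf hR.le).continuous, fun s => ?_, fun s hs => ?_,
    fun s => ?_⟩, fun s hs => ?_⟩
  · linarith [(abs_le.1 (hkey1 s)).1]
  · have := hkey1 s
    rw [plateau_of_nonpos hk hR.le hs, sub_zero] at this
    exact abs_nonpos_iff.1 this
  · refine (hkey s).trans ?_
    calc min 1 (η / R ^ k) * plateau k R s ≤ η / R ^ k * R ^ k :=
          mul_le_mul (min_le_right _ _) (plateau_le hk hR.le s) (plateau_nonneg hR.le s)
            (by positivity)
      _ = η := by field_simp
  · have h1 := (abs_le.1 (hkey1 s)).2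
    have h2 : plateau k R s ≤ s ^ k := by
      rw [plateau, max_eq_left hs]
      exact Real.rpow_le_rpow (le_min hs hR.le) (min_le_left _ _) hk.le
    linarith

theorem exists_threshold {m θ₀ e₀ : ℝ} (hm : 0 < m) (hθ₀ : 0 < θ₀) (he₀ : 0 < e₀) :
    ∃ ω₁ ∈ Ioo (m / 2) m, ∀ ω ∈ Ioo ω₁ m,
      m - ω ∈ Ioc 0 θ₀ ∧ (m - ω) / (m + ω) ∈ Icc 0 e₀ ∧ m + ω ∈ Icc m (2 * m) := by
  refine ⟨m - min (m / 4) (min θ₀ (e₀ * m)), ⟨?_, ?_⟩, fun ω hω => ?_⟩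
  · linarith [min_le_left (m / 4) (min θ₀ (e₀ * m))]
  · have : 0 < min (m / 4) (min θ₀ (e₀ * m)) := by positivity
    linarith
  have h0 := hω.1
  have h1 := hω.2
  have h2 := min_le_left (m / 4) (min θ₀ (e₀ * m))
  have h3 := (min_le_right (m / 4) (min θ₀ (e₀ * m))).trans (min_le_left _ _)
  have h4 := (min_le_right (m / 4) (min θ₀ (e₀ * m))).trans (min_le_right _ _)
  have h5 : 0 < m + ω := by linarith
  refine ⟨⟨by linarith, by linarith⟩, ⟨div_nonneg (by linarith) h5.le, ?_⟩,
    by linarith, by linarith⟩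
  rw [div_le_iff₀ h5]
  nlinarith

/-- existence of radial solitary-wave profiles for the Soler
model in the nonrelativistic limit `ω ≲ m`: given a continuous nonlinearity
`f(τ) = |τ|^k + o(|τ|^k)`, there are `ω₁ ∈ (m/2, m)`, `b₀` and `c₀ > 0` such
that for every `ω ∈ (ω₁, m)`, with `ε = √(m²−ω²)`, there is a `C¹` solution
`(v,u)` (with `v` even, `u` odd) of the radial system
`u' + ((n−1)/r)u + (m−ω)v = f(v²−u²)v`, `v' + (m+ω)u = f(v²−u²)u`
(at `r = 0` the quotient `u(r)/r` is read as `u'(0)`), which is everywhere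
positive in `v`, satisfies `v²−u² ≥ (v²+u²)/2`, obeys the decay estimate
`|v(r)| + ε⁻¹|u(r)| ≤ b₀ ε^{1/k} (1+ε²r²)^{−(n−1)/4} e^{−ε|r|}`, and satisfies
`v(0) ≥ c₀ ε^{1/k}`. -/
theorem stmt19 (n : ℕ) (hn : 1 ≤ n) (m k : ℝ) (hm : 0 < m) (hk : 0 < k)
    (hkn : 3 ≤ n → k < 2 / ((n : ℝ) - 2))
    (f : ℝ → ℝ) (hfc : Continuous f)
    (hfo : ∀ η > 0, ∃ δ > 0, ∀ τ : ℝ, |τ| ≤ δ → |f τ - |τ| ^ k| ≤ η * |τ| ^ k) :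
    ∃ ω₁ ∈ Set.Ioo (m / 2) m, ∃ b₀ : ℝ, ∃ c₀ > 0,
      ∀ ω ∈ Set.Ioo ω₁ m, ∀ ε : ℝ, ε = Real.sqrt (m ^ 2 - ω ^ 2) →
      ∃ v u : ℝ → ℝ, ContDiff ℝ 1 v ∧ ContDiff ℝ 1 u ∧
        (∀ r : ℝ, v (-r) = v r) ∧ (∀ r : ℝ, u (-r) = -u r) ∧
        (∀ r : ℝ,
          deriv u r + ((n : ℝ) - 1) * (if r = 0 then deriv u 0 else u r / r)
              + (m - ω) * v r
            = f (v r ^ 2 - u r ^ 2) * v r) ∧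
        (∀ r : ℝ,
          deriv v r + (m + ω) * u r = f (v r ^ 2 - u r ^ 2) * u r) ∧
        (∀ r : ℝ, 0 < v r) ∧
        (∀ r : ℝ, (v r ^ 2 + u r ^ 2) / 2 ≤ v r ^ 2 - u r ^ 2) ∧
        (∀ r : ℝ, |v r| + ε⁻¹ * |u r|
            ≤ b₀ * ε ^ (1 / k) * (1 + ε ^ 2 * r ^ 2) ^ (-((n : ℝ) - 1) / 4)
              * Real.exp (-ε * |r|)) ∧
        c₀ * ε ^ (1 / k) ≤ v 0 := by

  obtain ⟨d, rfl⟩ : ∃ d, n = d + 1 := ⟨n - 1, by omega⟩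
  have hkd : 2 ≤ d → k < 2 / ((d : ℝ) - 1) := by
    intro hd
    have := hkn (by omega)
    push_cast at this
    rwa [show (d : ℝ) + 1 - 2 = d - 1 by ring] at this
  obtain ⟨a, ha, b, hb, η, hη, e₀, he₀, K, hK, hmain⟩ := exists_even_odd_profile d hk hkd
  obtain ⟨θ₀, hθ₀, hadm⟩ := exists_isAdm_scaledNonlinearity hfc hk hη (R := b ^ 2)
    (by positivity) hfo
  obtain ⟨ω₁, hω₁, hthr⟩ := exists_threshold hm hθ₀ he₀
  refine ⟨ω₁, hω₁, (1 + 1 / m) * (m ^ (1 / (2 * k)))⁻¹ * K, a * ((2 * m) ^ (1 / (2 * k)))⁻¹,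
    by positivity, fun ω hω ε hε => ?_⟩
  obtain ⟨hθ, he, hlam⟩ := hthr ω hω
  have hεθ : ε ^ 2 = (m - ω) * (m + ω) := by
    rw [hε, Real.sq_sqrt (by nlinarith [hθ.1, hlam.1])]
    ring
  have hε0 : 0 < ε := by
    rw [hε]
    exact Real.sqrt_pos.2 (by nlinarith [hθ.1, hlam.1])
  set θ := m - ω with hθdef
  set L := m + ω with hLdef
  clear_value θ L
  have hθ0 : 0 < θ := hθ.1
  have hL0 : 0 < L := hm.trans_le hlam.1
  obtain ⟨hF, hF2⟩ := hadm θ hθ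
  set F := scaledNonlinearity f k (b ^ 2) θ with hFdef
  obtain ⟨V, U, W, hVc, hUc, hWc, heven, hodd, hW, hVd, hUd, hU0, hVa, hbd⟩ :=
    hmain (θ / L) he F hF (uniformContinuous_scaledNonlinearity hfc (sq_nonneg b)) hF2
  set σ := θ ^ (1 / (2 * k)) with hσ
  have hσ0 : 0 < σ := by positivity
  have hσ2 : σ ^ 2 = θ ^ (1 / k) := by
    rw [hσ, ← Real.rpow_natCast, ← Real.rpow_mul hθ0.le]
    congr 1
    push_cast
    field_simp
  have hεσ : ε ^ (1 / k) = σ * L ^ (1 / (2 * k)) := by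
    rw [hσ, ← Real.mul_rpow hθ0.le hL0.le, ← hεθ, ← Real.rpow_natCast, ← Real.rpow_mul hε0.le]
    congr 1
    push_cast
    field_simp
  set q := θ / ε with hq
  have hq0 : 0 < q := by positivity
  have hqe : q ^ 2 = θ / L := by
    rw [hq, div_pow, hεθ]
    field_simp
  have hqε : q * ε = θ := by
    rw [hq]
    field_simp
  have hLq : L * q = ε := by
    rw [hq]
    field_simp
    linarith
  have heε : θ / L * ε = θ * q := by
    rw [← hqe]
    linear_combination q * hqε
  have hlin : ∀ r, HasDerivAt (fun r : ℝ => ε * r) ε r := fun r => by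
    simpa using (hasDerivAt_id r).const_mul ε
  have hv : ∀ r, HasDerivAt (fun r => σ * V (ε * r))
      (σ * (-((1 - θ / L * F (V (ε * r) ^ 2 - θ / L * U (ε * r) ^ 2)) * U (ε * r)) * ε)) r :=
    fun r => ((hVd (ε * r)).comp r (hlin r)).const_mul σ
  have hu : ∀ r, HasDerivAt (fun r => q * σ * U (ε * r)) (q * σ *
      (((F (V (ε * r) ^ 2 - θ / L * U (ε * r) ^ 2) - 1) * V (ε * r) - d * W (ε * r)) * ε)) r :=
    fun r => ((hUd (ε * r)).comp r (hlin r)).const_mul (q * σ)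
  have hu0 : HasDerivAt (fun r => q * σ * U (ε * r)) (q * σ * (W 0 * ε)) 0 := by
    have h1 : HasDerivAt U (W 0) (ε * 0) := by rwa [mul_zero]
    exact (h1.comp 0 (hlin 0)).const_mul (q * σ)
  have hf : ∀ r, f ((σ * V (ε * r)) ^ 2 - (q * σ * U (ε * r)) ^ 2) =
      θ * F (V (ε * r) ^ 2 - θ / L * U (ε * r) ^ 2) := by
    intro r
    obtain ⟨h1, h2, h3, -⟩ := hbd (ε * r)
    have h4 : 0 ≤ θ / L * U (ε * r) ^ 2 := by positivity
    have h5 : V (ε * r) ^ 2 ≤ b ^ 2 := by gcongr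
    rw [hFdef, scaledNonlinearity, max_eq_left (by nlinarith), min_eq_left (by linarith),
      mul_div_cancel₀ _ hθ0.ne', ← hσ2, ← hqe]
    congr 1
    ring
  refine ⟨fun r => σ * V (ε * r), fun r => q * σ * U (ε * r), ?_, ?_, ?_, ?_, ?_, ?_, ?_, ?_, ?_,
    ?_⟩
  · rw [contDiff_one_iff_deriv]
    refine ⟨fun r => (hv r).differentiableAt, ?_⟩
    rw [funext fun r => (hv r).deriv]
    have := hF.cont
    fun_prop
  · rw [contDiff_one_iff_deriv]
    refine ⟨fun r => (hu r).differentiableAt, ?_⟩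
    rw [funext fun r => (hu r).deriv]
    have := hF.cont
    fun_prop
  · intro r
    simp only [mul_neg, heven]
  · intro r
    simp only [mul_neg, hodd]
  · intro r
    have hquot : (if r = 0 then deriv (fun r => q * σ * U (ε * r)) 0 else q * σ * U (ε * r) / r)
        = q * σ * (W (ε * r) * ε) := by
      split_ifs with hr
      · rw [hu0.deriv, hr, mul_zero]
      · rw [hW _ (mul_ne_zero hε0.ne' hr)]
        field_simp
    simp only [hquot, hf r, (hu r).deriv]
    push_cast
    rw [← hqε]
    ring
  · intro r
    simp only [hf r, (hv r).deriv]
    linear_combination σ * U (ε * r) * hLq +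
      σ * U (ε * r) * F (V (ε * r) ^ 2 - θ / L * U (ε * r) ^ 2) * heε
  · exact fun r => mul_pos hσ0 (hbd _).1
  · intro r
    have h3 := (hbd (ε * r)).2.2.1
    rw [← hqe] at h3
    have h4 := mul_le_mul_of_nonneg_left h3 (sq_nonneg σ)
    simp only
    nlinarith
  · intro r
    obtain ⟨h1, -, -, h4⟩ := hbd (ε * r)
    have h5 : σ ≤ ε ^ (1 / k) * (m ^ (1 / (2 * k)))⁻¹ := by
      rw [hεσ, ← div_eq_mul_inv, le_div_iff₀ (by positivity)]
      have := hlam.1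
      gcongr
    have h6 : ε⁻¹ * q ≤ 1 / m := by
      have : ε⁻¹ * q = 1 / L := by
        rw [← hLq]
        field_simp
      rw [this]
      exact one_div_le_one_div_of_le hm hlam.1
    have h7 : -((d + 1 : ℕ) - 1 : ℝ) / 4 = -((d : ℝ) / 4) := by
      push_cast
      ring
    have h8 : -ε * |r| = -|ε * r| := by
      rw [abs_mul, abs_of_pos hε0]
      ring
    rw [h7, h8, ← mul_pow]
    set E := (1 + (ε * r) ^ 2) ^ (-((d : ℝ) / 4)) * Real.exp (-|ε * r|) with hE
    have hE0 : 0 ≤ E := by positivity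
    have hm1 : 0 < 1 / m := by positivity
    have habs := abs_nonneg (U (ε * r))
    calc |σ * V (ε * r)| + ε⁻¹ * |q * σ * U (ε * r)|
        = σ * (V (ε * r) + ε⁻¹ * q * |U (ε * r)|) := by
          rw [abs_mul, abs_mul, abs_mul, abs_of_pos hσ0, abs_of_pos hq0, abs_of_pos h1]
          ring
      _ ≤ σ * (V (ε * r) + 1 / m * |U (ε * r)|) := by gcongr
      _ ≤ σ * ((1 + 1 / m) * (V (ε * r) + |U (ε * r)|)) := by
          gcongr
          nlinarith
      _ ≤ σ * ((1 + 1 / m) * (K * E)) := by gcongr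
      _ ≤ ε ^ (1 / k) * (m ^ (1 / (2 * k)))⁻¹ * ((1 + 1 / m) * (K * E)) := by gcongr
      _ = _ := by
          rw [hE]
          ring
  · have h5 : ε ^ (1 / k) * ((2 * m) ^ (1 / (2 * k)))⁻¹ ≤ σ := by
      rw [hεσ, ← div_eq_mul_inv, div_le_iff₀ (by positivity)]
      have := hlam.2
      gcongr
    simp only [mul_zero]
    calc a * ((2 * m) ^ (1 / (2 * k)))⁻¹ * ε ^ (1 / k)
        = a * (ε ^ (1 / k) * ((2 * m) ^ (1 / (2 * k)))⁻¹) := by ring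
      _ ≤ V 0 * σ := mul_le_mul hVa h5 (by positivity) (ha.le.trans hVa)
      _ = σ * V 0 := mul_comm _ _
end
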